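/- Existence and uniqueness for the parabolic problem: let m > 0 and λ ≥ 0. For any f ∈ C(Ω̄), u₀ ∈ C(Ω̄) and g ∈ C(∂Ω) satisfying the compatibility condition u₀(x) = g(x) for all x ∈ ∂Ω, there exists a unique global-in-time continuous viscosity solution u : Ω̄ × [0,∞) → ℝ of the generalized initial-boundary value problem E(Ω,f,g,u₀,λ) (i.e., u restricted to Ω̄ × [0,T] is a viscosity solution for every T > 0). -/

import Mathlib

open Set Filter Topology Metric MeasureTheory

noncomputable section

/-- Euclidean space `ℝ^N`. -/
abbrev Euc (N : ℕ) : Type := EuclideanSpace ℝ (Fin N)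

/-- The Laplacian of `φ` at `x`, computed as the trace of the second derivative
in the standard orthonormal basis of `ℝ^N`. -/
noncomputable def lapl {N : ℕ} (φ : Euc N → ℝ) (x : Euc N) : ℝ :=
  ∑ i : Fin N,
    iteratedFDeriv ℝ 2 φ x ![EuclideanSpace.single i 1, EuclideanSpace.single i 1]

/-- `Ω` is a domain with `C²` boundary: it is the sublevel set of a `C²`
defining function whose gradient does not vanish on the boundary. -/
def HasC2Boundary {N : ℕ} (Ω : Set (Euc N)) : Prop :=
  ∃ ρ : Euc N → ℝ, ContDiff ℝ 2 ρ ∧ Ω = {x | ρ x < 0} ∧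
    frontier Ω = {x | ρ x = 0} ∧ ∀ x ∈ frontier Ω, gradient ρ x ≠ 0

/-- The stationary operator `−Δφ(x) + |Dφ(x)|^m + λ r − h(x)` evaluated with the
value `r` of the (sub/super)solution at `x`. -/
noncomputable def statOp {N : ℕ} (h : Euc N → ℝ) (lam m : ℝ)
    (φ : Euc N → ℝ) (r : ℝ) (x : Euc N) : ℝ :=
  -lapl φ x + ‖gradient φ x‖ ^ m + lam * r - h x

/-- Viscosity subsolution of the generalized Dirichlet problem
`S(Ω,h,k,λ)`: `−Δw + |Dw|^m + λ w = h` in `Ω`, `w = k` on `∂Ω`. -/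
def IsStatSub {N : ℕ} (Ω : Set (Euc N)) (h k : Euc N → ℝ) (lam m : ℝ)
    (u : Euc N → ℝ) : Prop :=
  UpperSemicontinuousOn u (closure Ω) ∧
  ∀ φ : Euc N → ℝ, ContDiff ℝ 2 φ → ∀ x₀ ∈ closure Ω,
    IsLocalMaxOn (u - φ) (closure Ω) x₀ →
      (x₀ ∈ Ω → statOp h lam m φ (u x₀) x₀ ≤ 0) ∧
      (x₀ ∈ frontier Ω → min (statOp h lam m φ (u x₀) x₀) (u x₀ - k x₀) ≤ 0)

/-- Viscosity supersolution of the generalized Dirichlet problem `S(Ω,h,k,λ)`. -/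
def IsStatSuper {N : ℕ} (Ω : Set (Euc N)) (h k : Euc N → ℝ) (lam m : ℝ)
    (v : Euc N → ℝ) : Prop :=
  LowerSemicontinuousOn v (closure Ω) ∧
  ∀ φ : Euc N → ℝ, ContDiff ℝ 2 φ → ∀ x₀ ∈ closure Ω,
    IsLocalMinOn (v - φ) (closure Ω) x₀ →
      (x₀ ∈ Ω → 0 ≤ statOp h lam m φ (v x₀) x₀) ∧
      (x₀ ∈ frontier Ω → 0 ≤ max (statOp h lam m φ (v x₀) x₀) (v x₀ - k x₀))

/-- The parabolic operator
`φ_t(x,t) − Δφ(·,t)(x) + |Dφ(·,t)(x)|^m + λ r − f(x)`. -/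
noncomputable def parOp {N : ℕ} (f : Euc N → ℝ) (lam m : ℝ)
    (φ : Euc N × ℝ → ℝ) (r : ℝ) (x : Euc N) (t : ℝ) : ℝ :=
  deriv (fun s => φ (x, s)) t - lapl (fun y => φ (y, t)) x
    + ‖gradient (fun y => φ (y, t)) x‖ ^ m + lam * r - f x

/-- Viscosity subsolution of the generalized initial-boundary value problem
`E(Ω,f,g,u₀,λ)` on the time interval `[0,T]`:
`u_t − Δu + |Du|^m + λ u = f` in `Ω × (0,T]`, `u = g` on `∂Ω × (0,T]`,
`u(·,0) = u₀` on `closure Ω`. -/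
def IsParSub {N : ℕ} (Ω : Set (Euc N)) (f g u₀ : Euc N → ℝ) (lam m T : ℝ)
    (u : Euc N → ℝ → ℝ) : Prop :=
  UpperSemicontinuousOn (fun p : Euc N × ℝ => u p.1 p.2) (closure Ω ×ˢ Ico 0 T) ∧
  (∀ x ∈ closure Ω, u x 0 ≤ u₀ x) ∧
  ∀ φ : Euc N × ℝ → ℝ, ContDiff ℝ 2 φ → ∀ x₀ : Euc N, ∀ t₀ : ℝ,
    (x₀, t₀) ∈ closure Ω ×ˢ Ioc 0 T →
    IsLocalMaxOn (fun p : Euc N × ℝ => u p.1 p.2 - φ p) (closure Ω ×ˢ Ioc 0 T) (x₀, t₀) →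
      (x₀ ∈ Ω → parOp f lam m φ (u x₀ t₀) x₀ t₀ ≤ 0) ∧
      (x₀ ∈ frontier Ω →
        min (parOp f lam m φ (u x₀ t₀) x₀ t₀) (u x₀ t₀ - g x₀) ≤ 0)

/-- Viscosity supersolution of `E(Ω,f,g,u₀,λ)` on the time interval `[0,T]`. -/
def IsParSuper {N : ℕ} (Ω : Set (Euc N)) (f g u₀ : Euc N → ℝ) (lam m T : ℝ)
    (v : Euc N → ℝ → ℝ) : Prop :=
  LowerSemicontinuousOn (fun p : Euc N × ℝ => v p.1 p.2) (closure Ω ×ˢ Icc 0 T) ∧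
  (∀ x ∈ closure Ω, u₀ x ≤ v x 0) ∧
  ∀ φ : Euc N × ℝ → ℝ, ContDiff ℝ 2 φ → ∀ x₀ : Euc N, ∀ t₀ : ℝ,
    (x₀, t₀) ∈ closure Ω ×ˢ Ioc 0 T →
    IsLocalMinOn (fun p : Euc N × ℝ => v p.1 p.2 - φ p) (closure Ω ×ˢ Ioc 0 T) (x₀, t₀) →
      (x₀ ∈ Ω → 0 ≤ parOp f lam m φ (v x₀ t₀) x₀ t₀) ∧
      (x₀ ∈ frontier Ω →
        0 ≤ max (parOp f lam m φ (v x₀ t₀) x₀ t₀) (v x₀ t₀ - g x₀))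

/-- A continuous viscosity solution, global in time, of `E(Ω,f,g,u₀,λ)`. -/
def IsGlobalParSol {N : ℕ} (Ω : Set (Euc N)) (f g u₀ : Euc N → ℝ) (lam m : ℝ)
    (u : Euc N → ℝ → ℝ) : Prop :=
  ContinuousOn (fun p : Euc N × ℝ => u p.1 p.2) (closure Ω ×ˢ Ici 0) ∧
  ∀ T > (0 : ℝ), IsParSub Ω f g u₀ lam m T u ∧ IsParSuper Ω f g u₀ lam m T u

open scoped Classical in
/-- Redefinition of a parabolic subsolution on the lateral boundary by its
`limsup` from inside `Ω × (0,T]`. -/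
noncomputable def uscExtPar {N : ℕ} (Ω : Set (Euc N)) (T : ℝ)
    (u : Euc N → ℝ → ℝ) : Euc N → ℝ → ℝ :=
  fun z t => if z ∈ Ω then u z t
    else limsup (fun p : Euc N × ℝ => u p.1 p.2) (𝓝[Ω ×ˢ Ioc 0 T] (z, t))

open scoped Classical in
/-- Redefinition of a stationary subsolution on the boundary by its `limsup`
from inside `Ω`. -/
noncomputable def uscExtStat {N : ℕ} (Ω : Set (Euc N))
    (u : Euc N → ℝ) : Euc N → ℝ :=
  fun z => if z ∈ Ω then u z else limsup u (𝓝[Ω] z)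

/-- Continuous viscosity solution of the state constraint problem
`−Δw + |Dw|^m + λ w = h` in `Ω`, `−Δw + |Dw|^m + λ w ≥ h` on `∂Ω`. -/
def IsSCSolution {N : ℕ} (Ω : Set (Euc N)) (h : Euc N → ℝ) (lam m : ℝ)
    (w : Euc N → ℝ) : Prop :=
  ContinuousOn w (closure Ω) ∧
  (∀ φ : Euc N → ℝ, ContDiff ℝ 2 φ → ∀ x₀ ∈ Ω, IsLocalMaxOn (w - φ) Ω x₀ →
      statOp h lam m φ (w x₀) x₀ ≤ 0) ∧
  (∀ φ : Euc N → ℝ, ContDiff ℝ 2 φ → ∀ x₀ ∈ closure Ω,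
      IsLocalMinOn (w - φ) (closure Ω) x₀ → 0 ≤ statOp h lam m φ (w x₀) x₀)

/-- Continuous viscosity subsolution of `−Δu + |Du|^m ≤ h` in `Ω`
(no boundary condition). -/
def IsIntSub {N : ℕ} (Ω : Set (Euc N)) (h : Euc N → ℝ) (m : ℝ)
    (u : Euc N → ℝ) : Prop :=
  ∀ φ : Euc N → ℝ, ContDiff ℝ 2 φ → ∀ x₀ ∈ Ω, IsLocalMaxOn (u - φ) Ω x₀ →
    statOp h 0 m φ (u x₀) x₀ ≤ 0

/-- Hölder continuity with exponent `α` on a set. -/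
def HolderOnCl {N : ℕ} (α : ℝ) (s : Set (Euc N)) (w : Euc N → ℝ) : Prop :=
  ∃ C > (0 : ℝ), ∀ x ∈ s, ∀ y ∈ s, |w x - w y| ≤ C * ‖x - y‖ ^ α

/-- Local Lipschitz continuity inside `Ω`. -/
def LocLipIn {N : ℕ} (Ω : Set (Euc N)) (w : Euc N → ℝ) : Prop :=
  ∀ x ∈ Ω, ∃ ε > (0 : ℝ), ∃ K : ℝ, 0 ≤ K ∧
    ∀ y ∈ ball x ε ∩ Ω, ∀ z ∈ ball x ε ∩ Ω, |w y - w z| ≤ K * ‖y - z‖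

/-- A piecewise `C¹` path parametrized on `[0,1]`. -/
def IsPWC1Path {N : ℕ} (γ : ℝ → Euc N) : Prop :=
  ContinuousOn γ (Icc 0 1) ∧
  ∃ n : ℕ, ∃ τ : Fin (n + 1) → ℝ, StrictMono τ ∧ τ 0 = 0 ∧ τ (Fin.last n) = 1 ∧
    ∀ i : Fin n, ContDiffOn ℝ 1 γ (Icc (τ i.castSucc) (τ i.succ))

/-- The length of a path on `[0,1]`. -/
noncomputable def pathLen {N : ℕ} (γ : ℝ → Euc N) : ℝ :=
  ∫ t in (0 : ℝ)..1, ‖derivWithin γ (Icc (0 : ℝ) 1) t‖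

/-- The geodesic-type distance inside `closure S` via piecewise `C¹` paths. -/
noncomputable def dTilde {N : ℕ} (S : Set (Euc N)) (x y : Euc N) : ℝ :=
  sInf {L : ℝ | ∃ γ : ℝ → Euc N, IsPWC1Path γ ∧ γ 0 = x ∧ γ 1 = y ∧
    MapsTo γ (Icc 0 1) (closure S) ∧ L = pathLen γ}

/-- The inner parallel set `Ω_δ = {x ∈ Ω : dist(x,∂Ω) > δ}`. -/
def innerSet {N : ℕ} (Ω : Set (Euc N)) (δ : ℝ) : Set (Euc N) :=
  {x ∈ Ω | δ < infDist x (frontier Ω)}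

end

namespace VS

/-! ### Calculus toolbox in space -/

lemma lapl_eq {N : ℕ} (φ : Euc N → ℝ) (x : Euc N) :
    lapl φ x = ∑ i : Fin N, fderiv ℝ (fderiv ℝ φ) x (EuclideanSpace.single i 1)
      (EuclideanSpace.single i 1) := by
  unfold lapl
  refine Finset.sum_congr rfl fun i _ => ?_
  rw [iteratedFDeriv_two_apply]; simp

lemma lapl_congr {N : ℕ} {φ ψ : Euc N → ℝ} {x : Euc N} (h : φ =ᶠ[𝓝 x] ψ) :
    lapl φ x = lapl ψ x := by
  unfold lapl
  rw [(h.iteratedFDeriv ℝ 2).self_of_nhds]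

lemma lapl_add {N : ℕ} {φ ψ : Euc N → ℝ} {x : Euc N} (hφ : ContDiffAt ℝ 2 φ x)
    (hψ : ContDiffAt ℝ 2 ψ x) : lapl (fun y => φ y + ψ y) x = lapl φ x + lapl ψ x := by
  unfold lapl
  rw [← Finset.sum_add_distrib]
  refine Finset.sum_congr rfl fun i _ => ?_
  have := iteratedFDeriv_add_apply (i := 2) (x := x) hφ hψ
  have h2 : (fun y => φ y + ψ y) = φ + ψ := rfl
  rw [h2, this]; rfl

lemma lapl_const_mul {N : ℕ} {φ : Euc N → ℝ} {x : Euc N} (c : ℝ) (hφ : ContDiffAt ℝ 2 φ x) :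
    lapl (fun y => c * φ y) x = c * lapl φ x := by
  unfold lapl
  rw [Finset.mul_sum]
  refine Finset.sum_congr rfl fun i _ => ?_
  have := iteratedFDeriv_const_smul_apply (i := 2) (x := x) (a := c) hφ
  have h2 : (fun y => c * φ y) = c • φ := rfl
  rw [h2, this]; rfl

lemma lapl_neg {N : ℕ} {φ : Euc N → ℝ} {x : Euc N} :
    lapl (fun y => - φ y) x = - lapl φ x := by
  unfold lapl
  rw [← Finset.sum_neg_distrib]
  refine Finset.sum_congr rfl fun i _ => ?_
  have := iteratedFDeriv_neg_apply (𝕜 := ℝ) (i := 2) (x := x) (f := φ)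
  have h2 : (fun y => - φ y) = - φ := rfl
  rw [h2, this]; rfl

lemma lapl_sub {N : ℕ} {φ ψ : Euc N → ℝ} {x : Euc N} (hφ : ContDiffAt ℝ 2 φ x)
    (hψ : ContDiffAt ℝ 2 ψ x) : lapl (fun y => φ y - ψ y) x = lapl φ x - lapl ψ x := by
  have := lapl_add hφ (hψ.neg)
  simp only [sub_eq_add_neg]
  rw [← lapl_neg (φ := ψ)]; exact this

lemma lapl_const {N : ℕ} (c : ℝ) (x : Euc N) : lapl (fun _ => c) x = 0 := by
  rw [lapl_eq]; simp

lemma lapl_translate {N : ℕ} (φ : Euc N → ℝ) (c x : Euc N) :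
    lapl (fun y => φ (y + c)) x = lapl φ (x + c) := by
  unfold lapl
  rw [iteratedFDeriv_comp_add_right]

lemma grad_congr {N : ℕ} {φ ψ : Euc N → ℝ} {x : Euc N} (h : φ =ᶠ[𝓝 x] ψ) :
    gradient φ x = gradient ψ x := h.gradient_eq

lemma grad_add {N : ℕ} {φ ψ : Euc N → ℝ} {x : Euc N} (hφ : DifferentiableAt ℝ φ x)
    (hψ : DifferentiableAt ℝ ψ x) :
    gradient (fun y => φ y + ψ y) x = gradient φ x + gradient ψ x := by
  unfold gradient
  rw [fderiv_fun_add hφ hψ, map_add]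

lemma grad_const_mul {N : ℕ} {φ : Euc N → ℝ} {x : Euc N} (c : ℝ) (hφ : DifferentiableAt ℝ φ x) :
    gradient (fun y => c * φ y) x = c • gradient φ x := by
  unfold gradient
  rw [fderiv_const_mul hφ]; simp

lemma grad_neg {N : ℕ} {φ : Euc N → ℝ} {x : Euc N} :
    gradient (fun y => - φ y) x = - gradient φ x := by
  unfold gradient
  rw [fderiv_fun_neg]; simp

lemma grad_sub {N : ℕ} {φ ψ : Euc N → ℝ} {x : Euc N} (hφ : DifferentiableAt ℝ φ x)
    (hψ : DifferentiableAt ℝ ψ x) :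
    gradient (fun y => φ y - ψ y) x = gradient φ x - gradient ψ x := by
  unfold gradient
  rw [fderiv_fun_sub hφ hψ, map_sub]

lemma grad_const {N : ℕ} (c : ℝ) (x : Euc N) : gradient (fun _ : Euc N => c) x = 0 :=
  gradient_fun_const x c

lemma grad_translate {N : ℕ} (φ : Euc N → ℝ) (c x : Euc N) :
    gradient (fun y => φ (y + c)) x = gradient φ (x + c) := by
  unfold gradient
  rw [fderiv_comp_add_right]

lemma norm_grad {N : ℕ} (φ : Euc N → ℝ) (x : Euc N) :
    ‖gradient φ x‖ = ‖fderiv ℝ φ x‖ := by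
  unfold gradient; simp

lemma sum_sq_fderiv {N : ℕ} (φ : Euc N → ℝ) (x : Euc N) :
    ∑ i : Fin N, (fderiv ℝ φ x (EuclideanSpace.single i 1)) ^ 2 = ‖gradient φ x‖ ^ 2 := by
  rw [EuclideanSpace.norm_sq_eq]
  refine Finset.sum_congr rfl fun i _ => ?_
  rw [← inner_gradient_left, EuclideanSpace.inner_single_right]
  simp

/-- chain rule for gradient -/
lemma grad_comp {N : ℕ} {d : Euc N → ℝ} {ψ : ℝ → ℝ} {x : Euc N} (hd : DifferentiableAt ℝ d x)
    (hψ : DifferentiableAt ℝ ψ (d x)) :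
    gradient (fun y => ψ (d y)) x = deriv ψ (d x) • gradient d x := by
  unfold gradient
  have : fderiv ℝ (fun y => ψ (d y)) x = deriv ψ (d x) • fderiv ℝ d x :=
    (hψ.hasDerivAt.comp_hasFDerivAt x hd.hasFDerivAt).fderiv
  rw [this]; simp

/-- chain rule for Laplacian -/
lemma lapl_comp {N : ℕ} {d : Euc N → ℝ} {ψ : ℝ → ℝ} {x : Euc N} (hd : ContDiffAt ℝ 2 d x)
    (hψ : ContDiffAt ℝ 2 ψ (d x)) :
    lapl (fun y => ψ (d y)) x
      = deriv (deriv ψ) (d x) * ‖gradient d x‖ ^ 2 + deriv ψ (d x) * lapl d x := by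
  have h1 : ∀ᶠ y in 𝓝 x, fderiv ℝ (fun y => ψ (d y)) y = deriv ψ (d y) • fderiv ℝ d y := by
    have hd' := hd.eventually (by simp)
    have hψ' := hd.continuousAt.eventually (hψ.eventually (by simp))
    filter_upwards [hd', hψ'] with y hy1 hy2
    exact ((hy2.differentiableAt (by norm_num)).hasDerivAt.comp_hasFDerivAt y
      (hy1.differentiableAt (by norm_num)).hasFDerivAt).fderiv
  have hψ1 : DifferentiableAt ℝ (deriv ψ) (d x) := by
    have h0 : DifferentiableAt ℝ (fderiv ℝ ψ) (d x) :=
      (hψ.fderiv_right (m := 1) (by norm_num)).differentiableAt (by norm_num)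
    exact h0.clm_apply (differentiableAt_const (1 : ℝ))
  have hd1 : DifferentiableAt ℝ (fderiv ℝ d) x :=
    (hd.fderiv_right (m := 1) (by norm_num)).differentiableAt (by norm_num)
  have hdd : DifferentiableAt ℝ d x := hd.differentiableAt (by norm_num)
  have hc : HasFDerivAt (fun y => deriv ψ (d y)) (deriv (deriv ψ) (d x) • fderiv ℝ d x) x :=
    hψ1.hasDerivAt.comp_hasFDerivAt x hdd.hasFDerivAt
  have h2 : fderiv ℝ (fderiv ℝ (fun y => ψ (d y))) x = _ :=
    (Filter.EventuallyEq.fderiv_eq h1).trans (hc.smul hd1.hasFDerivAt).fderiv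
  rw [lapl_eq, h2, lapl_eq, ← sum_sq_fderiv, Finset.mul_sum, Finset.mul_sum,
    ← Finset.sum_add_distrib]
  refine Finset.sum_congr rfl fun i _ => ?_
  simp; ring

lemma contDiff_normsq {N : ℕ} (x₀ : Euc N) : ContDiff ℝ 2 (fun y : Euc N => ‖y - x₀‖ ^ 2) :=
  (contDiff_id.sub contDiff_const).norm_sq ℝ

lemma fderiv_normsq {N : ℕ} (x₀ : Euc N) :
    fderiv ℝ (fun y : Euc N => ‖y - x₀‖ ^ 2) = fun x => (2 : ℝ) • innerSL ℝ (x - x₀) := by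
  funext x
  have h := ((hasStrictFDerivAt_norm_sq (x - x₀)).hasFDerivAt).comp x
    ((hasFDerivAt_id x).sub_const x₀)
  have := h.fderiv
  simp only [Function.comp_def, id] at this
  rw [this]; ext v; simp

lemma grad_normsq {N : ℕ} (x₀ x : Euc N) :
    gradient (fun y : Euc N => ‖y - x₀‖ ^ 2) x = (2 : ℝ) • (x - x₀) := by
  apply ext_inner_right ℝ
  intro v
  rw [inner_gradient_left, fderiv_normsq]; simp [inner_smul_left, inner_sub_left]

lemma lapl_normsq {N : ℕ} (x₀ x : Euc N) :
    lapl (fun y : Euc N => ‖y - x₀‖ ^ 2) x = 2 * N := by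
  rw [lapl_eq, fderiv_normsq]
  have : fderiv ℝ (fun x : Euc N => (2 : ℝ) • innerSL ℝ (x - x₀)) x
      = (2 : ℝ) • (innerSL ℝ : Euc N →L[ℝ] Euc N →L[ℝ] ℝ) := by
    have h : HasFDerivAt (fun x : Euc N => innerSL ℝ (x - x₀))
        (innerSL ℝ : Euc N →L[ℝ] Euc N →L[ℝ] ℝ) x :=
      (innerSL ℝ : Euc N →L[ℝ] Euc N →L[ℝ] ℝ).hasFDerivAt.comp x
        ((hasFDerivAt_id x).sub_const x₀)
    exact (h.const_smul (2 : ℝ)).fderiv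
  rw [this]
  have h : ∀ i : Fin N, ((2 : ℝ) • (innerSL ℝ : Euc N →L[ℝ] Euc N →L[ℝ] ℝ))
      (EuclideanSpace.single i 1) (EuclideanSpace.single i 1) = 2 := by
    intro i
    change (2 : ℝ) * (inner ℝ (EuclideanSpace.single i (1:ℝ)) (EuclideanSpace.single i (1:ℝ))) = 2
    rw [real_inner_self_eq_norm_sq]; simp
  rw [Finset.sum_congr rfl fun i _ => h i]; simp; ring

/-- Second order necessary condition on a line. -/
lemma deriv2_nonpos {g : ℝ → ℝ} {s : ℝ} (h : IsLocalMax g s) (hc : ContinuousAt g s) :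
    deriv (deriv g) s ≤ 0 := by
  by_contra hcon
  push Not at hcon
  have h1 := isLocalMin_of_deriv_deriv_pos hcon h.deriv_eq_zero hc
  have h2 : g =ᶠ[𝓝 s] fun _ => g s := by
    filter_upwards [h, h1] with y hy1 hy2
    exact le_antisymm hy1 hy2
  have h3 : deriv (deriv g) s = 0 := by
    rw [h2.deriv.deriv_eq]; simp
  linarith

lemma lapl_nonpos_of_localMax {N : ℕ} {φ : Euc N → ℝ} {x : Euc N} (hφ : ContDiffAt ℝ 2 φ x)
    (h : IsLocalMax φ x) : lapl φ x ≤ 0 := by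
  rw [lapl_eq]
  refine Finset.sum_nonpos fun i _ => ?_
  set e : Euc N := EuclideanSpace.single i 1
  set ℓ : ℝ → Euc N := fun s => x + s • e with hℓ
  have hℓd : ∀ s, HasDerivAt ℓ e s := fun s => by
    have := ((hasDerivAt_id s).smul_const e).const_add x
    rw [one_smul] at this; exact this
  have hℓc : ContinuousAt ℓ 0 := (hℓd 0).continuousAt
  have hℓ0 : ℓ 0 = x := by simp [hℓ]
  have h1 : ∀ᶠ s in 𝓝 (0:ℝ), deriv (fun s => φ (ℓ s)) s = fderiv ℝ φ (ℓ s) e := by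
    have : ∀ᶠ s in 𝓝 (0:ℝ), ContDiffAt ℝ 2 φ (ℓ s) := by
      apply hℓc.eventually; rw [hℓ0]; exact hφ.eventually (by simp)
    filter_upwards [this] with s hs
    exact ((hs.differentiableAt (by norm_num)).hasFDerivAt.comp_hasDerivAt s (hℓd s)).deriv
  have hd1 : DifferentiableAt ℝ (fderiv ℝ φ) x :=
    (hφ.fderiv_right (m := 1) (by norm_num)).differentiableAt (by norm_num)
  have h2 : deriv (deriv (fun s => φ (ℓ s))) 0 = fderiv ℝ (fderiv ℝ φ) x e e := by
    rw [EventuallyEq.deriv_eq h1]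
    have hf : HasFDerivAt (fderiv ℝ φ) (fderiv ℝ (fderiv ℝ φ) x) (ℓ 0) := by
      rw [hℓ0]; exact hd1.hasFDerivAt
    have := (hf.comp_hasDerivAt 0 (hℓd 0)).clm_apply (hasDerivAt_const 0 e)
    simpa using this.deriv
  rw [← h2]
  have hm : IsLocalMax (fun s => φ (ℓ s)) 0 := by
    have h' : IsLocalMax φ (ℓ 0) := by rw [hℓ0]; exact h
    exact h'.comp_continuous hℓc
  refine deriv2_nonpos hm ?_
  have : ContinuousAt φ (ℓ 0) := by rw [hℓ0]; exact hφ.continuousAt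
  exact ContinuousAt.comp (f := ℓ) (g := φ) this hℓc

lemma grad_zero_of_localMax {N : ℕ} {φ : Euc N → ℝ} {x : Euc N}
    (h : IsLocalMax φ x) : gradient φ x = 0 := by
  unfold gradient; rw [h.fderiv_eq_zero]; simp

lemma continuous_grad {N : ℕ} {φ : Euc N → ℝ} (hφ : ContDiff ℝ 2 φ) : Continuous (gradient φ) := by
  unfold gradient
  exact (LinearIsometryEquiv.continuous _).comp (hφ.continuous_fderiv (by norm_num))

lemma continuous_lapl {N : ℕ} {φ : Euc N → ℝ} (hφ : ContDiff ℝ 2 φ) : Continuous (lapl φ) := by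
  have : lapl φ = fun x => ∑ i : Fin N, fderiv ℝ (fderiv ℝ φ) x (EuclideanSpace.single i 1)
      (EuclideanSpace.single i 1) := funext (lapl_eq φ)
  rw [this]
  have h1 : ContDiff ℝ 1 (fderiv ℝ φ) := hφ.fderiv_right (by norm_num)
  have h2 : Continuous (fderiv ℝ (fderiv ℝ φ)) := h1.continuous_fderiv (by norm_num)
  fun_prop

end VS

namespace VS

/-! ### Calculus toolbox in space-time -/

noncomputable def dT {N : ℕ} (φ : Euc N × ℝ → ℝ) (z : Euc N × ℝ) : ℝ :=
  deriv (fun s => φ (z.1, s)) z.2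
noncomputable def dX {N : ℕ} (φ : Euc N × ℝ → ℝ) (z : Euc N × ℝ) : Euc N :=
  gradient (fun y => φ (y, z.2)) z.1
noncomputable def dL {N : ℕ} (φ : Euc N × ℝ → ℝ) (z : Euc N × ℝ) : ℝ :=
  lapl (fun y => φ (y, z.2)) z.1

variable {N : ℕ} {φ ψ : Euc N × ℝ → ℝ} {z : Euc N × ℝ}

lemma parOp_eq (f : Euc N → ℝ) (lam m : ℝ) (φ : Euc N × ℝ → ℝ) (r : ℝ) (z : Euc N × ℝ) :
    parOp f lam m φ r z.1 z.2 = dT φ z - dL φ z + ‖dX φ z‖ ^ m + lam * r - f z.1 := rfl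

lemma sliceX_cd (h : ContDiffAt ℝ 2 φ z) : ContDiffAt ℝ 2 (fun y => φ (y, z.2)) z.1 := by
  have h2 : ContDiffAt ℝ 2 (fun y : Euc N => (y, z.2)) z.1 :=
    contDiffAt_id.prodMk contDiffAt_const
  exact ContDiffAt.comp (g := φ) (f := fun y : Euc N => (y, z.2)) z.1 h h2

lemma sliceT_cd (h : ContDiffAt ℝ 2 φ z) : ContDiffAt ℝ 2 (fun s => φ (z.1, s)) z.2 := by
  have h2 : ContDiffAt ℝ 2 (fun s : ℝ => (z.1, s)) z.2 :=
    contDiffAt_const.prodMk contDiffAt_id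
  exact ContDiffAt.comp (g := φ) (f := fun s : ℝ => (z.1, s)) z.2 h h2

lemma sliceX_d (h : ContDiffAt ℝ 2 φ z) : DifferentiableAt ℝ (fun y => φ (y, z.2)) z.1 :=
  (sliceX_cd h).differentiableAt (by norm_num)
lemma sliceT_d (h : ContDiffAt ℝ 2 φ z) : DifferentiableAt ℝ (fun s => φ (z.1, s)) z.2 :=
  (sliceT_cd h).differentiableAt (by norm_num)

lemma tendsto_sliceX (z : Euc N × ℝ) : Tendsto (fun y : Euc N => (y, z.2)) (𝓝 z.1) (𝓝 z) := by
  have : Continuous (fun y : Euc N => (y, z.2)) := by fun_prop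
  simpa using this.tendsto z.1
lemma tendsto_sliceT (z : Euc N × ℝ) : Tendsto (fun s : ℝ => (z.1, s)) (𝓝 z.2) (𝓝 z) := by
  have : Continuous (fun s : ℝ => (z.1, s)) := by fun_prop
  simpa using this.tendsto z.2

lemma dT_congr (h : φ =ᶠ[𝓝 z] ψ) : dT φ z = dT ψ z :=
  EventuallyEq.deriv_eq ((tendsto_sliceT z).eventually h)
lemma dX_congr (h : φ =ᶠ[𝓝 z] ψ) : dX φ z = dX ψ z :=
  grad_congr ((tendsto_sliceX z).eventually h)
lemma dL_congr (h : φ =ᶠ[𝓝 z] ψ) : dL φ z = dL ψ z :=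
  lapl_congr ((tendsto_sliceX z).eventually h)

lemma dT_add (hφ : ContDiffAt ℝ 2 φ z) (hψ : ContDiffAt ℝ 2 ψ z) :
    dT (fun y => φ y + ψ y) z = dT φ z + dT ψ z := deriv_fun_add (sliceT_d hφ) (sliceT_d hψ)
lemma dX_add (hφ : ContDiffAt ℝ 2 φ z) (hψ : ContDiffAt ℝ 2 ψ z) :
    dX (fun y => φ y + ψ y) z = dX φ z + dX ψ z := grad_add (sliceX_d hφ) (sliceX_d hψ)
lemma dL_add (hφ : ContDiffAt ℝ 2 φ z) (hψ : ContDiffAt ℝ 2 ψ z) :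
    dL (fun y => φ y + ψ y) z = dL φ z + dL ψ z := lapl_add (sliceX_cd hφ) (sliceX_cd hψ)
lemma dT_sub (hφ : ContDiffAt ℝ 2 φ z) (hψ : ContDiffAt ℝ 2 ψ z) :
    dT (fun y => φ y - ψ y) z = dT φ z - dT ψ z := deriv_fun_sub (sliceT_d hφ) (sliceT_d hψ)
lemma dX_sub (hφ : ContDiffAt ℝ 2 φ z) (hψ : ContDiffAt ℝ 2 ψ z) :
    dX (fun y => φ y - ψ y) z = dX φ z - dX ψ z := grad_sub (sliceX_d hφ) (sliceX_d hψ)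
lemma dL_sub (hφ : ContDiffAt ℝ 2 φ z) (hψ : ContDiffAt ℝ 2 ψ z) :
    dL (fun y => φ y - ψ y) z = dL φ z - dL ψ z := lapl_sub (sliceX_cd hφ) (sliceX_cd hψ)
lemma dT_neg : dT (fun y => - φ y) z = - dT φ z := deriv.fun_neg
lemma dX_neg : dX (fun y => - φ y) z = - dX φ z := grad_neg
lemma dL_neg : dL (fun y => - φ y) z = - dL φ z := lapl_neg
lemma dT_const_mul (c : ℝ) (hφ : ContDiffAt ℝ 2 φ z) :
    dT (fun y => c * φ y) z = c * dT φ z := deriv_const_mul c (sliceT_d hφ)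
lemma dX_const_mul (c : ℝ) (hφ : ContDiffAt ℝ 2 φ z) :
    dX (fun y => c * φ y) z = c • dX φ z := grad_const_mul c (sliceX_d hφ)
lemma dL_const_mul (c : ℝ) (hφ : ContDiffAt ℝ 2 φ z) :
    dL (fun y => c * φ y) z = c * dL φ z := lapl_const_mul c (sliceX_cd hφ)

lemma dT_translate (φ : Euc N × ℝ → ℝ) (c z : Euc N × ℝ) :
    dT (fun y => φ (y + c)) z = dT φ (z + c) := by
  unfold dT
  exact deriv_comp_add_const (fun s => φ (z.1 + c.1, s)) c.2 z.2
lemma dX_translate (φ : Euc N × ℝ → ℝ) (c z : Euc N × ℝ) :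
    dX (fun y => φ (y + c)) z = dX φ (z + c) :=
  grad_translate (fun y => φ (y, z.2 + c.2)) c.1 z.1
lemma dL_translate (φ : Euc N × ℝ → ℝ) (c z : Euc N × ℝ) :
    dL (fun y => φ (y + c)) z = dL φ (z + c) :=
  lapl_translate (fun y => φ (y, z.2 + c.2)) c.1 z.1

/-! functions of `x` only, functions of `t` only -/
lemma dT_fst (a : Euc N → ℝ) : dT (fun z => a z.1) z = 0 := by simp [dT]
lemma dX_fst (a : Euc N → ℝ) : dX (fun z => a z.1) z = gradient a z.1 := rfl
lemma dL_fst (a : Euc N → ℝ) : dL (fun z => a z.1) z = lapl a z.1 := rfl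
lemma dT_snd (b : ℝ → ℝ) : dT (fun z : Euc N × ℝ => b z.2) z = deriv b z.2 := rfl
lemma dX_snd (b : ℝ → ℝ) : dX (fun z : Euc N × ℝ => b z.2) z = 0 := grad_const (b z.2) z.1
lemma dL_snd (b : ℝ → ℝ) : dL (fun z : Euc N × ℝ => b z.2) z = 0 := lapl_const (b z.2) z.1
lemma dT_const (c : ℝ) : dT (fun _ : Euc N × ℝ => c) z = 0 := dT_fst (fun _ => c)
lemma dX_const (c : ℝ) : dX (fun _ : Euc N × ℝ => c) z = 0 := grad_const c z.1
lemma dL_const (c : ℝ) : dL (fun _ : Euc N × ℝ => c) z = 0 := lapl_const c z.1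

lemma cd_fst {a : Euc N → ℝ} (h : ContDiffAt ℝ 2 a z.1) :
    ContDiffAt ℝ 2 (fun z : Euc N × ℝ => a z.1) z :=
  ContDiffAt.comp (g := a) z h contDiffAt_fst
lemma cd_snd {b : ℝ → ℝ} (h : ContDiffAt ℝ 2 b z.2) :
    ContDiffAt ℝ 2 (fun z : Euc N × ℝ => b z.2) z :=
  ContDiffAt.comp (g := b) z h contDiffAt_snd

/-! sums of functions of x and of t -/
lemma dT_split {a : Euc N → ℝ} {b : ℝ → ℝ} :
    dT (fun z : Euc N × ℝ => a z.1 + b z.2) z = deriv b z.2 := by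
  unfold dT; simp
lemma dX_split {a : Euc N → ℝ} {b : ℝ → ℝ} :
    dX (fun z : Euc N × ℝ => a z.1 + b z.2) z = gradient a z.1 := by
  unfold dX gradient; simp
lemma dL_split {a : Euc N → ℝ} {b : ℝ → ℝ} :
    dL (fun z : Euc N × ℝ => a z.1 + b z.2) z = lapl a z.1 := by
  unfold dL; rw [lapl_eq, lapl_eq]
  have : fderiv ℝ (fun y => a y + b z.2) = fderiv ℝ a := by funext y; simp
  rw [this]

/-- the quadratic penalisation -/
noncomputable def qd (κ : ℝ) (z₀ z : Euc N × ℝ) : ℝ := κ * ‖z.1 - z₀.1‖ ^ 2 + κ * (z.2 - z₀.2) ^ 2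

lemma qd_contDiff (κ : ℝ) (z₀ : Euc N × ℝ) : ContDiff ℝ 2 (qd κ z₀) := by
  unfold qd
  have : ContDiff ℝ 2 (fun z : Euc N × ℝ => ‖z.1 - z₀.1‖ ^ 2) :=
    (contDiff_normsq z₀.1).comp contDiff_fst
  fun_prop

lemma qd_self (κ : ℝ) (z₀ : Euc N × ℝ) : qd κ z₀ z₀ = 0 := by simp [qd]
lemma qd_nonneg {κ : ℝ} (hκ : 0 ≤ κ) (z₀ z : Euc N × ℝ) : 0 ≤ qd κ z₀ z := by
  unfold qd; positivity

lemma qd_ge {κ r : ℝ} (hκ : 0 ≤ κ) (hr : 0 ≤ r) {z₀ z : Euc N × ℝ} (h : r ≤ dist z z₀) :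
    κ * r ^ 2 ≤ qd κ z₀ z := by
  unfold qd
  rw [Prod.dist_eq, le_max_iff, dist_eq_norm, Real.dist_eq] at h
  have h1 := sq_nonneg ‖z.1 - z₀.1‖
  have h2 := sq_nonneg (z.2 - z₀.2)
  rcases h with h | h
  · have : r ^ 2 ≤ ‖z.1 - z₀.1‖ ^ 2 := by gcongr
    nlinarith
  · have : r ^ 2 ≤ (z.2 - z₀.2) ^ 2 := by rw [← sq_abs (z.2 - z₀.2)]; gcongr
    nlinarith

lemma dT_qd (κ : ℝ) (z₀ z : Euc N × ℝ) : dT (qd κ z₀) z = 2 * κ * (z.2 - z₀.2) := by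
  have : dT (qd κ z₀) z = deriv (fun s => κ * (s - z₀.2) ^ 2) z.2 :=
    dT_split (a := fun x => κ * ‖x - z₀.1‖ ^ 2) (b := fun s => κ * (s - z₀.2) ^ 2)
  rw [this]
  have := (((hasDerivAt_id z.2).sub_const z₀.2).pow 2).const_mul κ
  have := this.deriv
  simp only [id, Pi.pow_apply] at this
  convert this using 1
  simp; ring
lemma dX_qd (κ : ℝ) (z₀ z : Euc N × ℝ) : dX (qd κ z₀) z = (2 * κ) • (z.1 - z₀.1) := by
  have : dX (qd κ z₀) z = gradient (fun x => κ * ‖x - z₀.1‖ ^ 2) z.1 :=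
    dX_split (a := fun x => κ * ‖x - z₀.1‖ ^ 2) (b := fun s => κ * (s - z₀.2) ^ 2)
  rw [this, grad_const_mul _ ((contDiff_normsq z₀.1).differentiable (by norm_num) _), grad_normsq,
    smul_smul]
  congr 1; ring
lemma dL_qd (κ : ℝ) (z₀ z : Euc N × ℝ) : dL (qd κ z₀) z = 2 * N * κ := by
  have : dL (qd κ z₀) z = lapl (fun x => κ * ‖x - z₀.1‖ ^ 2) z.1 :=
    dL_split (a := fun x => κ * ‖x - z₀.1‖ ^ 2) (b := fun s => κ * (s - z₀.2) ^ 2)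
  rw [this, lapl_const_mul _ (contDiff_normsq z₀.1).contDiffAt, lapl_normsq]
  ring

/-! continuity -/
lemma dT_eq (h : DifferentiableAt ℝ φ z) : dT φ z = fderiv ℝ φ z (0, 1) := by
  have h1 : HasDerivAt (fun s : ℝ => (z.1, s)) ((0 : Euc N), (1 : ℝ)) z.2 :=
    (hasDerivAt_const z.2 z.1).prodMk (hasDerivAt_id z.2)
  exact (HasFDerivAt.comp_hasDerivAt (l := φ) z.2 h.hasFDerivAt h1).deriv

lemma sliceX_fderiv (h : DifferentiableAt ℝ φ z) :
    fderiv ℝ (fun y => φ (y, z.2)) z.1 = (fderiv ℝ φ z).comp (ContinuousLinearMap.inl ℝ (Euc N) ℝ) := by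
  have h1 : HasFDerivAt (fun y : Euc N => (y, z.2)) (ContinuousLinearMap.inl ℝ (Euc N) ℝ) z.1 :=
    hasFDerivAt_prodMk_left z.1 z.2
  exact (HasFDerivAt.comp (g := φ) z.1 h.hasFDerivAt h1).fderiv

lemma dL_eq (h : ContDiff ℝ 2 φ) : dL φ z = ∑ i : Fin N,
    fderiv ℝ (fderiv ℝ φ) z (EuclideanSpace.single i 1, 0) (EuclideanSpace.single i 1, 0) := by
  unfold dL
  rw [lapl_eq]
  have hd : Differentiable ℝ φ := h.differentiable (by norm_num)
  have h1 : fderiv ℝ (fun y => φ (y, z.2)) = fun y =>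
      (fderiv ℝ φ (y, z.2)).comp (ContinuousLinearMap.inl ℝ (Euc N) ℝ) := by
    funext y; exact sliceX_fderiv (z := (y, z.2)) (hd _)
  have h2 : ContDiff ℝ 1 (fderiv ℝ φ) := h.fderiv_right (by norm_num)
  have h3 : HasFDerivAt (fun y : Euc N => (y, z.2)) (ContinuousLinearMap.inl ℝ (Euc N) ℝ) z.1 :=
    hasFDerivAt_prodMk_left z.1 z.2
  have h4 : HasFDerivAt (fun y => fderiv ℝ φ (y, z.2)) _ z.1 :=
    HasFDerivAt.comp (g := fderiv ℝ φ) z.1 (h2.differentiable (by norm_num) z).hasFDerivAt h3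
  have h5 := h4.clm_comp (hasFDerivAt_const (ContinuousLinearMap.inl ℝ (Euc N) ℝ) z.1)
  rw [h1, h5.fderiv]
  simp

lemma continuous_dT (h : ContDiff ℝ 2 φ) : Continuous (dT φ) := by
  have : dT φ = fun z => fderiv ℝ φ z (0, 1) :=
    funext fun z => dT_eq (h.differentiable (by norm_num) z)
  rw [this]
  have := h.continuous_fderiv (by norm_num)
  fun_prop

lemma continuous_dX (h : ContDiff ℝ 2 φ) : Continuous (dX φ) := by
  have : dX φ = fun z => (InnerProductSpace.toDual ℝ (Euc N)).symm
      ((fderiv ℝ φ z).comp (ContinuousLinearMap.inl ℝ (Euc N) ℝ)) :=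
    funext fun z => by
      unfold dX gradient; rw [sliceX_fderiv (h.differentiable (by norm_num) z)]
  rw [this]
  have := h.continuous_fderiv (by norm_num)
  exact (LinearIsometryEquiv.continuous _).comp (this.clm_comp continuous_const)

lemma continuous_dL (h : ContDiff ℝ 2 φ) : Continuous (dL φ) := by
  have : dL φ = fun z => ∑ i : Fin N,
    fderiv ℝ (fderiv ℝ φ) z (EuclideanSpace.single i 1, 0) (EuclideanSpace.single i 1, 0) :=
    funext fun z => dL_eq h
  rw [this]
  have h1 : ContDiff ℝ 1 (fderiv ℝ φ) := h.fderiv_right (by norm_num)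
  have h2 : Continuous (fderiv ℝ (fderiv ℝ φ)) := h1.continuous_fderiv (by norm_num)
  fun_prop

/-- Localization: a function which is `C²` at a point agrees near it with a global `C²` one. -/
lemma exists_global (h : ContDiffAt ℝ 2 φ z) : ∃ ψ, ContDiff ℝ 2 ψ ∧ ψ =ᶠ[𝓝 z] φ := by
  have hev := h.eventually (by simp)
  obtain ⟨r, hr, hb⟩ := Metric.eventually_nhds_iff_ball.1 hev
  let χ : ContDiffBump z := ⟨r / 3, r / 2, by positivity, by linarith⟩
  refine ⟨fun y => χ y * φ y, ?_, ?_⟩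
  · rw [contDiff_iff_contDiffAt]
    intro y
    by_cases hy : dist y z < r
    · exact (χ.contDiff.contDiffAt).mul (hb y hy)
    · have : (fun y => χ y * φ y) =ᶠ[𝓝 y] fun _ => 0 := by
        have : ∀ᶠ y' in 𝓝 y, r / 2 < dist y' z := by
          have : Continuous fun y' => dist y' z := by fun_prop
          exact this.continuousAt.eventually (lt_mem_nhds (by push Not at hy; linarith))
        filter_upwards [this] with y' hy'
        rw [χ.zero_of_le_dist hy'.le, zero_mul]
      exact contDiffAt_const.congr_of_eventuallyEq this
  · filter_upwards [χ.eventuallyEq_one] with y hy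
    simp only [hy, Pi.one_apply, one_mul]

/-- derivatives at an interior local max -/
lemma localMax_derivs (h : ContDiffAt ℝ 2 φ z) (hm : IsLocalMax φ z) :
    dT φ z = 0 ∧ dX φ z = 0 ∧ dL φ z ≤ 0 := by
  have h1 : IsLocalMax (fun s => φ (z.1, s)) z.2 := (tendsto_sliceT z).eventually hm
  have h2 : IsLocalMax (fun y => φ (y, z.2)) z.1 := (tendsto_sliceX z).eventually hm
  exact ⟨h1.deriv_eq_zero, grad_zero_of_localMax h2, lapl_nonpos_of_localMax (sliceX_cd h) h2⟩

/-- two functions touching -/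
lemma touch_derivs {b : Euc N × ℝ → ℝ} (hb : ContDiffAt ℝ 2 b z) (h : ContDiffAt ℝ 2 φ z)
    (hm : IsLocalMax (fun y => b y - φ y) z) :
    dT b z = dT φ z ∧ dX b z = dX φ z ∧ dL b z ≤ dL φ z := by
  obtain ⟨h1, h2, h3⟩ := localMax_derivs (hb.sub h) hm
  rw [dT_sub hb h] at h1
  rw [dX_sub hb h] at h2
  rw [dL_sub hb h] at h3
  exact ⟨by linarith, sub_eq_zero.1 h2, by linarith⟩

end VS

namespace VS

variable {N : ℕ}

/-- generalized viscosity subsolution: tests are maxima relative to `S` at points of `D` -/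
def GSub (S D : Set (Euc N × ℝ)) (G : Euc N × ℝ → Euc N → ℝ) (w : Euc N × ℝ → ℝ) : Prop :=
  ∀ φ : Euc N × ℝ → ℝ, ContDiff ℝ 2 φ → ∀ z ∈ D, IsLocalMaxOn (fun y => w y - φ y) S z →
    dT φ z - dL φ z + G z (dX φ z) ≤ 0

/-- the nonlinearity; `σ = 1` for subsolutions, `σ = -1` for negatives of supersolutions -/
noncomputable def Gf (σ m lam : ℝ) (f : Euc N → ℝ) (w : Euc N × ℝ → ℝ) (z : Euc N × ℝ) (p : Euc N) : ℝ :=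
  σ * ‖p‖ ^ m + lam * w z - σ * f z.1

lemma localMaxOn_congr {S : Set (Euc N × ℝ)} {z : Euc N × ℝ} {w φ ψ : Euc N × ℝ → ℝ}
    (h : ψ =ᶠ[𝓝 z] φ) (hm : IsLocalMaxOn (fun y => w y - φ y) S z) :
    IsLocalMaxOn (fun y => w y - ψ y) S z := by
  have h0 : ψ z = φ z := h.self_of_nhds
  filter_upwards [hm, h.filter_mono nhdsWithin_le_nhds] with y hy1 hy2
  rw [hy2, h0]; exact hy1

lemma GSub.cdAt {S D : Set (Euc N × ℝ)} {G : Euc N × ℝ → Euc N → ℝ} {w : Euc N × ℝ → ℝ}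
    (h : GSub S D G w) {φ : Euc N × ℝ → ℝ} {z : Euc N × ℝ} (hφ : ContDiffAt ℝ 2 φ z) (hz : z ∈ D)
    (hm : IsLocalMaxOn (fun y => w y - φ y) S z) : dT φ z - dL φ z + G z (dX φ z) ≤ 0 := by
  obtain ⟨ψ, hψ, he⟩ := exists_global hφ
  have := h ψ hψ z hz (localMaxOn_congr he hm)
  rwa [dT_congr he, dX_congr he, dL_congr he] at this

lemma GSub.mono_set {S S' D D' : Set (Euc N × ℝ)} {G : Euc N × ℝ → Euc N → ℝ} {w : Euc N × ℝ → ℝ}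
    (h : GSub S D G w) (hD : D' ⊆ D) (hS : ∀ z ∈ D', S' ∈ 𝓝[S] z) : GSub S' D' G w := by
  intro φ hφ z hz hm
  refine h φ hφ z (hD hz) ?_
  exact hm.filter_mono (nhdsWithin_le_iff.2 (hS z hz))

/-- classical subsolutions are viscosity subsolutions at interior points -/
lemma classical_sub {S : Set (Euc N × ℝ)} {b φ : Euc N × ℝ → ℝ} {z : Euc N × ℝ}
    (hS : S ∈ 𝓝 z) (hb : ContDiffAt ℝ 2 b z) (hφ : ContDiffAt ℝ 2 φ z)
    (hm : IsLocalMaxOn (fun y => b y - φ y) S z) :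
    dT b z = dT φ z ∧ dX b z = dX φ z ∧ dL b z ≤ dL φ z :=
  touch_derivs hb hφ (hm.isLocalMax hS)

/-- Perturbed touching lemma. -/
lemma perturbed_touch {K : Set (Euc N × ℝ)} (hK : IsCompact K) {z₀ : Euc N × ℝ}
    {φ : Euc N × ℝ → ℝ} (hφ : ContDiff ℝ 2 φ) {ε : ℝ} (hε : 0 < ε) :
    ∃ ψ, ContDiff ℝ 2 ψ ∧ ∃ η > 0, ∀ (w' : Euc N × ℝ → ℝ) (m₀ : ℝ), UpperSemicontinuousOn w' K →
      (∀ y ∈ K, w' y - φ y ≤ m₀ - φ z₀ + η) → (∃ z' ∈ K, dist z' z₀ < η ∧ m₀ - η < w' z') →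
      ∃ y ∈ K, dist y z₀ < ε ∧ IsMaxOn (fun y => w' y - ψ y) K y ∧ |w' y - m₀| < ε ∧
        |dT ψ y - dT φ z₀| < ε ∧ ‖dX ψ y - dX φ z₀‖ < ε ∧ |dL ψ y - dL φ z₀| < ε := by
  set κ : ℝ := ε / (4 * (N + 1)) with hκ
  have hκ0 : 0 < κ := by positivity
  have hκN : 2 * N * κ < ε / 2 + κ := by
    have : κ * (4 * (N + 1)) = ε := by rw [hκ]; field_simp
    nlinarith
  set ψ : Euc N × ℝ → ℝ := fun y => φ y + qd κ z₀ y with hψ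
  have hψc : ContDiff ℝ 2 ψ := hφ.add (qd_contDiff κ z₀)
  have hT : dT ψ z₀ = dT φ z₀ := by
    rw [hψ, dT_add hφ.contDiffAt (qd_contDiff κ z₀).contDiffAt, dT_qd]; simp
  have hX : dX ψ z₀ = dX φ z₀ := by
    rw [hψ, dX_add hφ.contDiffAt (qd_contDiff κ z₀).contDiffAt, dX_qd]; simp
  have hL : dL ψ z₀ = dL φ z₀ + 2 * N * κ := by
    rw [hψ, dL_add hφ.contDiffAt (qd_contDiff κ z₀).contDiffAt, dL_qd]
  have hκN' : 2 * N * κ < ε := by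
    have : κ * (4 * (N + 1)) = ε := by rw [hκ]; field_simp
    nlinarith
  have e1 : ∀ᶠ y in 𝓝 z₀, |dT ψ y - dT φ z₀| < ε := by
    have : ContinuousAt (fun y => |dT ψ y - dT φ z₀|) z₀ :=
      ((continuous_dT hψc).sub continuous_const).abs.continuousAt
    refine this.eventually (gt_mem_nhds ?_); simp only; rw [hT]; simpa using hε
  have e2 : ∀ᶠ y in 𝓝 z₀, ‖dX ψ y - dX φ z₀‖ < ε := by
    have : ContinuousAt (fun y => ‖dX ψ y - dX φ z₀‖) z₀ :=
      ((continuous_dX hψc).sub continuous_const).norm.continuousAt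
    refine this.eventually (gt_mem_nhds ?_); simp only; rw [hX]; simpa using hε
  have e3 : ∀ᶠ y in 𝓝 z₀, |dL ψ y - dL φ z₀| < ε := by
    have : ContinuousAt (fun y => |dL ψ y - dL φ z₀|) z₀ :=
      ((continuous_dL hψc).sub continuous_const).abs.continuousAt
    refine this.eventually (gt_mem_nhds ?_); simp only; rw [hL, abs_of_nonneg]
    · linarith
    · have : 0 ≤ 2 * (N : ℝ) * κ := by positivity
      linarith
  have e4 : ∀ᶠ y in 𝓝 z₀, |φ y - φ z₀| < ε / 4 := by
    have : ContinuousAt (fun y => |φ y - φ z₀|) z₀ :=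
      (hφ.continuous.sub continuous_const).abs.continuousAt
    refine this.eventually (gt_mem_nhds ?_); simp only; simp; linarith
  obtain ⟨r0, hr0, hr⟩ := Metric.eventually_nhds_iff_ball.1 (e1.and (e2.and (e3.and e4)))
  set r := min r0 ε with hrdef
  have hr1 : 0 < r := lt_min hr0 hε
  set s := min (κ * r ^ 2 / 4) (ε / 4) with hs
  have hs0 : 0 < s := by positivity
  have e5 : ∀ᶠ y in 𝓝 z₀, |ψ y - ψ z₀| < s := by
    have : ContinuousAt (fun y => |ψ y - ψ z₀|) z₀ :=
      (hψc.continuous.sub continuous_const).abs.continuousAt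
    refine this.eventually (gt_mem_nhds ?_); simp only; simpa using hs0
  obtain ⟨η0, hη0, hη⟩ := Metric.eventually_nhds_iff_ball.1 e5
  have hψ0 : ψ z₀ = φ z₀ := by simp [hψ, qd_self]
  refine ⟨ψ, hψc, min η0 s, lt_min hη0 hs0, ?_⟩
  rintro w' m₀ hw hle ⟨z', hz', hd, hz'w⟩
  have husc : UpperSemicontinuousOn (fun y => w' y - ψ y) K := by
    simp only [sub_eq_add_neg]
    exact hw.add (hψc.continuous.neg.upperSemicontinuous.upperSemicontinuousOn K)
  obtain ⟨y, hyK, hy⟩ := husc.exists_isMaxOn ⟨z', hz'⟩ hK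
  have h1 := hy hz'
  simp only [mem_ofPred_eq] at h1
  have h2 := hη z' (lt_of_lt_of_le hd (min_le_left _ _))
  have h3 := hle y hyK
  have h4 : min η0 s ≤ s := min_le_right _ _
  have h5 : ψ y = φ y + qd κ z₀ y := rfl
  have hs1 : s ≤ κ * r ^ 2 / 4 := min_le_left _ _
  have hs2 : s ≤ ε / 4 := min_le_right _ _
  rw [abs_lt] at h2
  have hκr : 0 < κ * r ^ 2 := by positivity
  have hdist : dist y z₀ < r := by
    by_contra hcon
    push Not at hcon
    have := qd_ge hκ0.le hr1.le hcon
    linarith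
  obtain ⟨g1, g2, g3, g4⟩ := hr y (lt_of_lt_of_le hdist (min_le_left _ _))
  have hq := qd_nonneg hκ0.le z₀ y
  rw [abs_lt] at g4
  refine ⟨y, hyK, lt_of_lt_of_le hdist (min_le_right _ _), hy, ?_, g1, g2, g3⟩
  rw [abs_lt]
  constructor <;> linarith

lemma perturbed_touch_loc {S : Set (Euc N × ℝ)} {z₀ : Euc N × ℝ} {R : ℝ} (hR : 0 < R)
    (hS : IsCompact (S ∩ closedBall z₀ R)) {φ w : Euc N × ℝ → ℝ} (hφ : ContDiff ℝ 2 φ)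
    (hm : IsLocalMaxOn (fun y => w y - φ y) S z₀) {ε : ℝ} (hε : 0 < ε) :
    ∃ R' > 0, R' ≤ R ∧ ∃ η > 0, ∀ w' : Euc N × ℝ → ℝ, UpperSemicontinuousOn w' (S ∩ closedBall z₀ R') →
      (∀ y ∈ S ∩ closedBall z₀ R', w' y ≤ w y + η) →
      (∃ z' ∈ S, dist z' z₀ < η ∧ w z₀ - η < w' z') →
      ∃ ψ, ContDiff ℝ 2 ψ ∧ ∃ y ∈ S, dist y z₀ < ε ∧ IsLocalMaxOn (fun y => w' y - ψ y) S y ∧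
        |w' y - w z₀| < ε ∧
        |dT ψ y - dT φ z₀| < ε ∧ ‖dX ψ y - dX φ z₀‖ < ε ∧ |dL ψ y - dL φ z₀| < ε := by
  have hm' : ∀ᶠ y in 𝓝[S] z₀, w y - φ y ≤ w z₀ - φ z₀ := hm
  rw [eventually_nhdsWithin_iff] at hm'
  obtain ⟨r, hr, hb⟩ := Metric.eventually_nhds_iff_ball.1 hm'
  set R' := min (r / 2) R with hR'
  have hR'0 : 0 < R' := by positivity
  have hK : IsCompact (S ∩ closedBall z₀ R') := by
    have : S ∩ closedBall z₀ R' = (S ∩ closedBall z₀ R) ∩ closedBall z₀ R' := by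
      rw [inter_assoc, inter_eq_right.2 (closedBall_subset_closedBall (min_le_right _ _))]
    rw [this]; exact hS.inter_right isClosed_closedBall
  obtain ⟨ψ, hψ, η, hη, H⟩ := perturbed_touch (z₀ := z₀) hK hφ (lt_min hε hR'0)
  refine ⟨R', hR'0, min_le_right _ _, min η R', lt_min hη hR'0, ?_⟩
  rintro w' hw hle ⟨z', hz', hd, hz'w⟩
  obtain ⟨y, hyK, hyd, hmax, h1, h2, h3, h4⟩ := H w' (w z₀) hw
    (fun y hy => by
      have a1 := hb y (by
        have : dist y z₀ ≤ R' := hy.2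
        have : R' ≤ r / 2 := min_le_left _ _
        rw [mem_ball]; linarith) hy.1
      have a2 := hle y hy
      have : min η R' ≤ η := min_le_left _ _
      linarith)
    ⟨z', ⟨hz', mem_closedBall.2 (hd.le.trans (min_le_right _ _))⟩, lt_of_lt_of_le hd (min_le_left _ _), by
      have : min η R' ≤ η := min_le_left _ _
      linarith⟩
  have hm1 : min ε R' ≤ ε := min_le_left _ _
  refine ⟨ψ, hψ, y, hyK.1, lt_of_lt_of_le hyd hm1, ?_, lt_of_lt_of_le h1 hm1, lt_of_lt_of_le h2 hm1,
    lt_of_lt_of_le h3 hm1, lt_of_lt_of_le h4 hm1⟩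
  have : ∀ᶠ y' in 𝓝[S] y, y' ∈ S ∩ closedBall z₀ R' := by
    have h5 : ∀ᶠ y' in 𝓝[S] y, y' ∈ ball z₀ R' :=
      nhdsWithin_le_nhds (isOpen_ball.mem_nhds (lt_of_lt_of_le hyd (min_le_right _ _)))
    filter_upwards [h5, self_mem_nhdsWithin] with y' h6 h7 using ⟨h7, ball_subset_closedBall h6⟩
  filter_upwards [this] with y' hy' using hmax hy'

lemma expr_stab {C : Set (Euc N)} {f : Euc N → ℝ} {x₀ : Euc N} (hf : ContinuousWithinAt f C x₀)
    {m : ℝ} (hm : 0 < m) (σ lam a b r : ℝ) (p : Euc N)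
    (h : 0 < a - b + (σ * ‖p‖ ^ m + lam * r - σ * f x₀)) :
    ∃ ε > 0, ∀ (a' b' r' : ℝ) (p' x' : Euc N), |a' - a| < ε → |b' - b| < ε → |r' - r| < ε →
      ‖p' - p‖ < ε → x' ∈ C → dist x' x₀ < ε →
      0 < a' - b' + (σ * ‖p'‖ ^ m + lam * r' - σ * f x') := by
  set c := a - b + (σ * ‖p‖ ^ m + lam * r - σ * f x₀) with hc
  have t1 : ∀ᶠ p' in 𝓝 p, |σ * ‖p'‖ ^ m - σ * ‖p‖ ^ m| < c / 8 := by
    have : ContinuousAt (fun p' : Euc N => |σ * ‖p'‖ ^ m - σ * ‖p‖ ^ m|) p := by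
      have : Continuous (fun p' : Euc N => ‖p'‖ ^ m) :=
        continuous_norm.rpow_const (fun _ => Or.inr hm.le)
      exact ((continuous_const.mul this).sub continuous_const).abs.continuousAt
    refine this.eventually (gt_mem_nhds ?_); simp only; simp; linarith
  have t2 : ∀ᶠ r' in 𝓝 r, |lam * r' - lam * r| < c / 8 := by
    have : ContinuousAt (fun r' : ℝ => |lam * r' - lam * r|) r := by fun_prop
    refine this.eventually (gt_mem_nhds ?_); simp only; simp; linarith
  have t3 : ∀ᶠ x' in 𝓝[C] x₀, |σ * f x' - σ * f x₀| < c / 8 := by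
    have : ContinuousWithinAt (fun x' => |σ * f x' - σ * f x₀|) C x₀ := by
      exact ((continuousWithinAt_const.mul hf).sub continuousWithinAt_const).abs
    refine this.eventually (gt_mem_nhds ?_); simp only; simp; linarith
  rw [eventually_nhdsWithin_iff] at t3
  obtain ⟨ε1, hε1, h1⟩ := Metric.eventually_nhds_iff_ball.1 t1
  obtain ⟨ε2, hε2, h2⟩ := Metric.eventually_nhds_iff_ball.1 t2
  obtain ⟨ε3, hε3, h3⟩ := Metric.eventually_nhds_iff_ball.1 t3
  refine ⟨min (min ε1 ε2) (min ε3 (c / 8)), by positivity, ?_⟩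
  intro a' b' r' p' x' ha hb hr hp hx hxd
  simp only [lt_min_iff] at ha hb hr hp hxd
  have u1 := h1 p' (by rw [mem_ball, dist_eq_norm]; exact hp.1.1)
  have u2 := h2 r' (by rw [mem_ball, Real.dist_eq]; exact hr.1.2)
  have u3 := h3 x' (by rw [mem_ball]; exact hxd.2.1) hx
  rw [abs_lt] at u1 u2 u3
  have ha' := abs_lt.1 ha.2.2
  have hb' := abs_lt.1 hb.2.2
  linarith

/-- General stability: approximate subsolutions from outside. -/
lemma stab {S : Set (Euc N × ℝ)} {C : Set (Euc N)} {z₀ : Euc N × ℝ} {R : ℝ} (hR : 0 < R)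
    (hS : IsCompact (S ∩ closedBall z₀ R)) (hSC : ∀ z ∈ S, z.1 ∈ C) {f : Euc N → ℝ}
    (hf : ContinuousWithinAt f C z₀.1) {m : ℝ} (hm0 : 0 < m) {σ lam : ℝ}
    {φ w : Euc N × ℝ → ℝ} (hφ : ContDiff ℝ 2 φ)
    (hm : IsLocalMaxOn (fun y => w y - φ y) S z₀)
    {δ : ℝ} (hδ : 0 < δ)
    (H : ∀ R' > 0, R' ≤ R → ∀ η > 0, ∃ (w' : Euc N × ℝ → ℝ) (D : Set (Euc N × ℝ)),
      UpperSemicontinuousOn w' (S ∩ closedBall z₀ R') ∧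
      (∀ y ∈ S ∩ closedBall z₀ R', w' y ≤ w y + η) ∧ (∃ z' ∈ S, dist z' z₀ < η ∧ w z₀ - η < w' z') ∧
      (∀ y ∈ S, dist y z₀ < δ → |w' y - w z₀| < δ → y ∈ D) ∧ GSub S D (Gf σ m lam f w') w') :
    dT φ z₀ - dL φ z₀ + Gf σ m lam f w z₀ (dX φ z₀) ≤ 0 := by
  by_contra hcon
  push Not at hcon
  obtain ⟨ε, hε, he⟩ := expr_stab hf hm0 σ lam _ _ _ _ hcon
  obtain ⟨R', hR', hRR, η, hη, h1⟩ := perturbed_touch_loc hR hS hφ hm (lt_min hε hδ)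
  obtain ⟨w', D, a1, a2, a3, a4, a5⟩ := H R' hR' hRR η hη
  obtain ⟨ψ, hψ, y, hyS, b1, b2, b3, b4, b5, b6⟩ := h1 w' a1 a2 a3
  simp only [lt_min_iff] at b1 b3 b4 b5 b6
  have h2 := a5 ψ hψ y (a4 y hyS b1.2 b3.2) b2
  have h3 := he (dT ψ y) (dL ψ y) (w' y) (dX ψ y) y.1 b4.1 b6.1 b3.1 b5.1 (hSC y hyS)
    (lt_of_le_of_lt (by rw [Prod.dist_eq]; exact le_max_left _ _) b1.1)
  unfold Gf at h2
  linarith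

end VS

namespace VS

variable {N : ℕ}

/-! ### polynomials on `Euc N` -/

noncomputable def pe (P : MvPolynomial (Fin N) ℝ) (x : Euc N) : ℝ := MvPolynomial.eval (fun i => x i) P

lemma pe_add (P Q : MvPolynomial (Fin N) ℝ) : pe (P + Q) = fun x => pe P x + pe Q x := by
  funext x; simp [pe]
lemma pe_mul (P Q : MvPolynomial (Fin N) ℝ) : pe (P * Q) = fun x => pe P x * pe Q x := by
  funext x; simp [pe]
lemma pe_C (c : ℝ) : pe (MvPolynomial.C c : MvPolynomial (Fin N) ℝ) = fun _ => c := by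
  funext x; simp [pe]
lemma pe_X (i : Fin N) : pe (MvPolynomial.X i : MvPolynomial (Fin N) ℝ) =
    (EuclideanSpace.proj i : Euc N →L[ℝ] ℝ) := by
  funext x; simp [pe]

lemma pe_contDiff (P : MvPolynomial (Fin N) ℝ) : ContDiff ℝ 2 (pe P) := by
  induction P using MvPolynomial.induction_on with
  | C c => rw [pe_C]; exact contDiff_const
  | add p q hp hq => rw [pe_add]; exact hp.add hq
  | mul_X p i hp => 
    rw [pe_mul, pe_X]; exact hp.mul (ContinuousLinearMap.contDiff _)

lemma pe_diff (P : MvPolynomial (Fin N) ℝ) : Differentiable ℝ (pe P) :=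
  (pe_contDiff P).differentiable (by norm_num)

lemma pe_fderiv (P : MvPolynomial (Fin N) ℝ) (i : Fin N) (x : Euc N) :
    fderiv ℝ (pe P) x (EuclideanSpace.single i 1) = pe (MvPolynomial.pderiv i P) x := by
  induction P using MvPolynomial.induction_on with
  | C c => rw [pe_C]; simp [pe]
  | add p q hp hq =>
    rw [pe_add, fderiv_fun_add (pe_diff p x) (pe_diff q x)]
    simp only [map_add, pe_add]
    rw [← hp, ← hq]; rfl
  | mul_X p j hp =>
    have hX := pe_diff (MvPolynomial.X j : MvPolynomial (Fin N) ℝ) x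
    rw [pe_mul, fderiv_fun_mul (pe_diff p x) hX, MvPolynomial.pderiv_mul]
    simp only [add_apply, smul_apply, hp, pe_add, pe_mul]
    have : fderiv ℝ (pe (MvPolynomial.X j : MvPolynomial (Fin N) ℝ)) x (EuclideanSpace.single i 1)
        = pe (MvPolynomial.pderiv i (MvPolynomial.X j)) x := by
      rw [pe_X, ContinuousLinearMap.fderiv]
      by_cases hij : j = i
      · subst hij; simp [pe]
      · rw [MvPolynomial.pderiv_X_of_ne hij]; simp [pe, hij]
    rw [this]; simp only [smul_eq_mul]; ring

noncomputable def plap (P : MvPolynomial (Fin N) ℝ) : MvPolynomial (Fin N) ℝ :=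
  ∑ i : Fin N, MvPolynomial.pderiv i (MvPolynomial.pderiv i P)

lemma lapl_pe (P : MvPolynomial (Fin N) ℝ) (x : Euc N) : lapl (pe P) x = pe (plap P) x := by
  rw [lapl_eq]
  have : pe (plap P) x = ∑ i : Fin N, pe (MvPolynomial.pderiv i (MvPolynomial.pderiv i P)) x := by
    simp [pe, plap]
  rw [this]
  refine Finset.sum_congr rfl fun i _ => ?_
  rw [← pe_fderiv]
  have h1 : pe (MvPolynomial.pderiv i P) = fun y => fderiv ℝ (pe P) y (EuclideanSpace.single i 1) :=
    funext fun y => (pe_fderiv P i y).symm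
  have h2 : DifferentiableAt ℝ (fderiv ℝ (pe P)) x :=
    ((pe_contDiff P).fderiv_right (m := 1) (by norm_num)).differentiable (by norm_num) x
  rw [h1, fderiv_clm_apply h2 (differentiableAt_const _)]
  simp

lemma deg_pderiv {P : MvPolynomial (Fin N) ℝ} {k : ℕ} (h : P.totalDegree ≤ k + 1) (i : Fin N) :
    (MvPolynomial.pderiv i P).totalDegree ≤ k := by
  rw [← MvPolynomial.mem_restrictTotalDegree]
  have : MvPolynomial.pderiv i P = ∑ s ∈ P.support,
      MvPolynomial.pderiv i (MvPolynomial.monomial s (P.coeff s)) := by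
    conv_lhs => rw [MvPolynomial.as_sum P, map_sum]
  rw [this]
  refine Submodule.sum_mem _ fun s hs => ?_
  rw [MvPolynomial.pderiv_monomial, MvPolynomial.mem_restrictTotalDegree]
  by_cases hsi : s i = 0
  · simp [hsi]
  · have h1 := (MvPolynomial.le_totalDegree hs).trans h
    refine (MvPolynomial.totalDegree_monomial_le _ _).trans ?_
    have h2 : s = (s - Finsupp.single i 1) + Finsupp.single i 1 := by
      ext j
      by_cases hj : i = j
      · subst hj; simp; omega
      · simp [Finsupp.single_apply, hj]
    have h3 : (s.sum fun _ e => e) = ((s - Finsupp.single i 1).sum fun _ e => e) + 1 := by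
      conv_lhs => rw [h2]
      rw [Finsupp.sum_add_index' (by simp) (by simp)]
      simp
    have h4 : ((s - Finsupp.single i 1).sum fun _ => id) = ((s - Finsupp.single i 1).sum fun _ e => e) := rfl
    omega

lemma deg_plap {P : MvPolynomial (Fin N) ℝ} {k : ℕ} (h : P.totalDegree ≤ k + 2) :
    (plap P).totalDegree ≤ k := by
  rw [← MvPolynomial.mem_restrictTotalDegree]
  refine Submodule.sum_mem _ fun i _ => ?_
  rw [MvPolynomial.mem_restrictTotalDegree]
  exact deg_pderiv (deg_pderiv h i) i

/-- classical maximum principle -/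
lemma max_principle_strict {h : Euc N → ℝ} {x₀ : Euc N} {r : ℝ} (hr : 0 < r)
    (hc : ContDiff ℝ 2 h) (hl : ∀ x ∈ ball x₀ r, 0 < lapl h x) (hs : ∀ x ∈ sphere x₀ r, h x ≤ 0) :
    ∀ x ∈ closedBall x₀ r, h x ≤ 0 := by
  obtain ⟨y, hy, hmax⟩ := (isCompact_closedBall x₀ r).exists_isMaxOn ⟨x₀, by simp [hr.le]⟩
    hc.continuous.continuousOn
  intro x hx
  refine (hmax hx).trans ?_
  rcases (mem_closedBall.1 hy).lt_or_eq with h1 | h1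
  · have : IsLocalMax h y := by
      filter_upwards [isOpen_ball.mem_nhds (mem_ball.2 h1)] with z hz
      exact hmax (ball_subset_closedBall hz)
    have h2 := lapl_nonpos_of_localMax hc.contDiffAt this
    have h3 := hl y h1
    linarith
  · exact hs y h1

lemma max_principle (hN : 1 ≤ N) {h : Euc N → ℝ} {x₀ : Euc N} {r : ℝ} (hr : 0 < r)
    (hc : ContDiff ℝ 2 h) (hl : ∀ x ∈ ball x₀ r, 0 ≤ lapl h x) (hs : ∀ x ∈ sphere x₀ r, h x ≤ 0) :
    ∀ x ∈ closedBall x₀ r, h x ≤ 0 := by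
  intro x hx
  by_contra hcon
  push Not at hcon
  set δ := h x / (2 * r ^ 2) with hδ
  have hδ0 : 0 < δ := by positivity
  have hN' : (1 : ℝ) ≤ N := by exact_mod_cast hN
  have hc2 : ContDiff ℝ 2 (fun y => δ * ‖y - x₀‖ ^ 2) := contDiff_const.mul (contDiff_normsq x₀)
  have := max_principle_strict (h := fun y => (h y + δ * ‖y - x₀‖ ^ 2) - δ * r ^ 2) hr
    ((hc.add hc2).sub contDiff_const)
    (fun y hy => by
      rw [lapl_sub (hc.add hc2).contDiffAt contDiffAt_const, lapl_add hc.contDiffAt hc2.contDiffAt,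
        lapl_const_mul _ (contDiff_normsq x₀).contDiffAt, lapl_normsq, lapl_const]
      have := hl y hy
      have : 0 < δ * (2 * N) := by positivity
      linarith)
    (fun y hy => by
      have h1 := hs y hy
      have h2 : ‖y - x₀‖ = r := by rw [← dist_eq_norm]; exact hy
      rw [h2]; linarith) x hx
  have h3 : δ * r ^ 2 = h x / 2 := by rw [hδ]; field_simp
  have h4 : 0 ≤ δ * ‖x - x₀‖ ^ 2 := by positivity
  linarith

/-- `r² - |x|²` as a polynomial -/
noncomputable def pr (N : ℕ) (r : ℝ) : MvPolynomial (Fin N) ℝ :=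
  MvPolynomial.C (r ^ 2) - ∑ i : Fin N, MvPolynomial.X i * MvPolynomial.X i

lemma pe_pr (r : ℝ) (x : Euc N) : pe (pr N r) x = r ^ 2 - ‖x‖ ^ 2 := by
  rw [EuclideanSpace.norm_sq_eq]; simp [pe, pr]; simp [sq]

lemma deg_pr (r : ℝ) : (pr N r).totalDegree ≤ 2 := by
  rw [← MvPolynomial.mem_restrictTotalDegree]
  refine Submodule.sub_mem _ ?_ (Submodule.sum_mem _ fun i _ => ?_)
  · rw [MvPolynomial.mem_restrictTotalDegree, MvPolynomial.totalDegree_C]; omega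
  · rw [MvPolynomial.mem_restrictTotalDegree]
    refine (MvPolynomial.totalDegree_mul _ _).trans ?_
    simp

lemma poly_zero_of_ball {Q : MvPolynomial (Fin N) ℝ} {r : ℝ} (hr : 0 < r)
    (h : ∀ x ∈ ball (0 : Euc N) r, pe Q x = 0) : Q = 0 := by
  set c := r / (N + 1) with hc
  have hc0 : 0 < c := by positivity
  refine MvPolynomial.funext_set (s := fun _ => Icc 0 c) (fun _ => Icc_infinite hc0) ?_
  intro x hx
  have := h (WithLp.toLp 2 x) (by
    rw [mem_ball_zero_iff]
    have : ‖(WithLp.toLp 2 x : Euc N)‖ ^ 2 < r ^ 2 := by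
      rw [EuclideanSpace.norm_sq_eq]
      calc ∑ i, ‖x i‖ ^ 2 ≤ ∑ i : Fin N, c ^ 2 := by
            refine Finset.sum_le_sum fun i _ => ?_
            have := hx i (mem_univ _)
            rw [Real.norm_eq_abs, sq_abs]
            have h1 := this.1; have h2 := this.2
            gcongr
        _ = N * c ^ 2 := by simp
        _ < r ^ 2 := by
            have h1 : r = c * (N + 1) := by rw [hc]; field_simp
            rw [h1]
            have : (0:ℝ) ≤ N := by positivity
            have : 0 < c ^ 2 := by positivity
            nlinarith
    exact lt_of_pow_lt_pow_left₀ 2 hr.le this)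
  simpa [pe] using this

/-- the harmonic correction exists -/
lemma exists_corr (hN : 1 ≤ N) {r : ℝ} (hr : 0 < r) (P : MvPolynomial (Fin N) ℝ) :
    ∃ Q, plap (P + pr N r * Q) = 0 := by
  set k := P.totalDegree with hk
  set W := MvPolynomial.restrictTotalDegree (Fin N) ℝ k with hW
  let L0 : MvPolynomial (Fin N) ℝ →ₗ[ℝ] MvPolynomial (Fin N) ℝ :=
    { toFun := fun Q => plap (pr N r * Q)
      map_add' := by intro a b; simp [plap, mul_add, Finset.sum_add_distrib]
      map_smul' := by
        intro c a
        simp only [plap, mul_smul_comm, RingHom.id_apply, Finset.smul_sum]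
        refine Finset.sum_congr rfl fun i _ => ?_
        rw [Derivation.map_smul, Derivation.map_smul] }
  have hmap : ∀ Q ∈ W, L0 Q ∈ W := by
    intro Q hQ
    rw [hW, MvPolynomial.mem_restrictTotalDegree] at hQ ⊢
    refine deg_plap ((MvPolynomial.totalDegree_mul _ _).trans ?_)
    have := deg_pr (N := N) r
    omega
  have hinj : ∀ Q, L0 Q = 0 → Q = 0 := by
    intro Q hQ
    have hQ' : plap (pr N r * Q) = 0 := hQ
    have hl : ∀ x, lapl (pe (pr N r * Q)) x = 0 := fun x => by rw [lapl_pe, hQ']; simp [pe]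
    have hs : ∀ x ∈ sphere (0 : Euc N) r, pe (pr N r * Q) x = 0 := fun x hx => by
      rw [pe_mul]; simp only; rw [pe_pr]
      have : ‖x‖ = r := by simpa using hx
      rw [this]; ring
    have h1 := max_principle hN hr (pe_contDiff (pr N r * Q)) (fun x _ => (hl x).ge)
      (fun x hx => (hs x hx).le)
    have h2 := max_principle hN (h := fun x => - pe (pr N r * Q) x) hr (pe_contDiff (pr N r * Q)).neg
      (fun x _ => by rw [lapl_neg, hl x]; simp) (fun x hx => by rw [hs x hx]; simp)
    refine poly_zero_of_ball hr fun x hx => ?_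
    have h3 := h1 x (ball_subset_closedBall hx)
    have h4 := h2 x (ball_subset_closedBall hx)
    rw [pe_mul] at h3 h4
    simp only at h3 h4
    rw [pe_pr] at h3 h4
    have h5 : 0 < r ^ 2 - ‖x‖ ^ 2 := by
      rw [mem_ball_zero_iff] at hx
      have := norm_nonneg x
      nlinarith
    have : (r ^ 2 - ‖x‖ ^ 2) * pe Q x = 0 := by linarith
    rcases mul_eq_zero.1 this with h | h
    · linarith
    · exact h
  let L : W →ₗ[ℝ] W := L0.restrict hmap
  have hLinj : Function.Injective L := by
    rw [← LinearMap.ker_eq_bot, LinearMap.ker_eq_bot']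
    intro Q hQ
    have : L0 Q = 0 := by
      have := congrArg Subtype.val hQ
      simpa [L] using this
    exact Subtype.ext (hinj _ this)
  have hLsurj : Function.Surjective L := LinearMap.injective_iff_surjective.1 hLinj
  have hP : - plap P ∈ W := by
    rw [neg_mem_iff, hW, MvPolynomial.mem_restrictTotalDegree]
    exact deg_plap (by omega)
  obtain ⟨⟨Q, hQW⟩, hQ⟩ := hLsurj ⟨_, hP⟩
  refine ⟨Q, ?_⟩
  have h1 : plap (pr N r * Q) = - plap P := congrArg Subtype.val hQ
  have h2 : plap (P + pr N r * Q) = plap P + plap (pr N r * Q) := by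
    simp [plap, Finset.sum_add_distrib]
  rw [h2, h1]; simp

/-- Stone-Weierstrass -/
lemma exists_poly {K : Set (Euc N)} (hK : IsCompact K) {a : Euc N → ℝ} (ha : ContinuousOn a K)
    {ε : ℝ} (hε : 0 < ε) : ∃ P : MvPolynomial (Fin N) ℝ, ∀ x ∈ K, |pe P x - a x| < ε := by
  haveI : CompactSpace K := isCompact_iff_compactSpace.1 hK
  let co : Fin N → C(K, ℝ) := fun i => ⟨fun x => (x : Euc N) i, by fun_prop⟩
  let A : Subalgebra ℝ C(K, ℝ) := (MvPolynomial.aeval co : MvPolynomial (Fin N) ℝ →ₐ[ℝ] C(K, ℝ)).range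
  have hA : A.SeparatesPoints := by
    intro x y hxy
    have : ∃ i, (x : Euc N) i ≠ (y : Euc N) i := by
      by_contra hcon
      push Not at hcon
      exact hxy (Subtype.ext (by ext i; exact hcon i))
    obtain ⟨i, hi⟩ := this
    exact ⟨co i, ⟨co i, ⟨MvPolynomial.X i, by simp⟩, rfl⟩, hi⟩
  obtain ⟨⟨g, ⟨P, hP⟩⟩, hg⟩ := ContinuousMap.exists_mem_subalgebra_near_continuous_of_separatesPoints A hA
    (fun x : K => a x) (continuousOn_iff_continuous_domRestrict.1 ha) ε hε
  refine ⟨P, fun x hx => ?_⟩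
  have h1 := hg ⟨x, hx⟩
  have h2 : g ⟨x, hx⟩ = pe P x := by
    have h3 : (MvPolynomial.aeval co P : C(K, ℝ)) = g := hP
    rw [← h3]
    have h4 : ∀ P : MvPolynomial (Fin N) ℝ, (MvPolynomial.aeval co P : C(K, ℝ)) ⟨x, hx⟩ = pe P x := by
      intro P
      induction P using MvPolynomial.induction_on with
      | C c => simp [pe]
      | add p q hp hq =>
        rw [pe_add, map_add, ContinuousMap.add_apply, hp, hq]
      | mul_X p i hp =>
        rw [pe_mul, map_mul, ContinuousMap.mul_apply, hp, pe_X, MvPolynomial.aeval_X]; rfl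
    exact h4 P
  simpa [h2, Real.norm_eq_abs] using h1

/-- harmonic approximation of boundary data on spheres -/
lemma exists_harmonic (hN : 1 ≤ N) {x₀ : Euc N} {r : ℝ} (hr : 0 < r) {a : Euc N → ℝ}
    (ha : ContinuousOn a (sphere x₀ r)) {ε : ℝ} (hε : 0 < ε) :
    ∃ h : Euc N → ℝ, ContDiff ℝ 2 h ∧ (∀ x, lapl h x = 0) ∧ ∀ x ∈ sphere x₀ r, |h x - a x| < ε := by
  have ha' : ContinuousOn (fun x => a (x + x₀)) (sphere 0 r) := by
    refine ha.comp (by fun_prop) fun x hx => ?_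
    simpa [dist_eq_norm] using hx
  obtain ⟨P, hP⟩ := exists_poly (isCompact_sphere 0 r) ha' hε
  obtain ⟨Q, hQ⟩ := exists_corr hN hr P
  refine ⟨fun x => pe (P + pr N r * Q) (x + (-x₀)), ?_, ?_, ?_⟩
  · exact (pe_contDiff _).comp (by fun_prop)
  · intro x
    rw [lapl_translate, lapl_pe, hQ]; simp [pe]
  · intro x hx
    have hx' : ‖x + -x₀‖ = r := by rw [← sub_eq_add_neg, ← dist_eq_norm]; exact hx
    have := hP (x + -x₀) (by simpa using hx')
    rw [pe_add, pe_mul]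
    simp only
    rw [pe_pr, hx']
    simpa using this

end VS

namespace VS

variable {N : ℕ}

/-! ### A theorem on sums without Alexandrov -/

lemma slice_le {A : Euc N × ℝ → ℝ} (hA : Continuous A) {zh : Euc N × ℝ} {r₀ c : ℝ}
    (hT : ∀ φ, ContDiff ℝ 2 φ → ∀ z, dist z zh < r₀ → IsLocalMax (fun y => A y - φ y) z → -dL φ z ≤ c)
    {r : ℝ} (hr : 0 < r) (hrr : r < r₀) {h : Euc N → ℝ} (hh : ContDiff ℝ 2 h)
    (hl : ∀ x ∈ ball zh.1 r, c < - lapl h x) (hs : ∀ x ∈ sphere zh.1 r, A (x, zh.2) ≤ h x) :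
    ∀ x ∈ closedBall zh.1 r, A (x, zh.2) ≤ h x := by
  intro x₁ hx₁
  by_contra hcon
  push Not at hcon
  set θ := A (x₁, zh.2) - h x₁ with hθ
  have hθ0 : 0 < θ := by linarith
  have hcont : Continuous fun z : Euc N × ℝ => A z - h z.1 :=
    hA.sub (hh.continuous.comp continuous_fst)
  have e1 : ∀ᶠ t in 𝓝 zh.2, ∀ x ∈ sphere zh.1 r, A (x, t) - h x < θ := by
    refine (isCompact_sphere zh.1 r).eventually_forall_of_forall_eventually fun x hx => ?_
    have : Continuous fun q : ℝ × Euc N => A (q.2, q.1) - h q.2 := by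
      exact hcont.comp (continuous_snd.prodMk continuous_fst)
    refine this.continuousAt.eventually (gt_mem_nhds ?_)
    have := hs x hx
    simp only
    linarith
  obtain ⟨τ0, hτ0, hτ⟩ := Metric.eventually_nhds_iff_ball.1 e1
  set τ := min (τ0 / 2) r with hτdef
  have hτp : 0 < τ := by positivity
  have hτ1 : τ < τ0 := lt_of_le_of_lt (min_le_left _ _) (by linarith)
  have hτ2 : τ ≤ r := min_le_right _ _
  set K : Set (Euc N × ℝ) := closedBall zh.1 r ×ˢ Icc (zh.2 - τ) (zh.2 + τ) with hK
  have hKc : IsCompact K := (isCompact_closedBall _ _).prod isCompact_Icc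
  have hne : K.Nonempty := ⟨(x₁, zh.2), hx₁, by constructor <;> linarith⟩
  obtain ⟨zM, hzM, hM⟩ := hKc.exists_isMaxOn hne hcont.continuousOn
  set C := A zM - h zM.1 with hC
  set n := (|C| + 1) / τ ^ 2 with hn
  have hn0 : 0 < n := by positivity
  set φ : Euc N × ℝ → ℝ := fun z => h z.1 + n * (z.2 - zh.2) ^ 2 with hφ
  have hφc : ContDiff ℝ 2 φ := by
    have : ContDiff ℝ 2 (fun z : Euc N × ℝ => h z.1) := hh.comp contDiff_fst
    fun_prop
  obtain ⟨y, hyK, hy⟩ := hKc.exists_isMaxOn hne (hA.sub hφc.continuous).continuousOn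
  have h1 : θ ≤ A y - φ y := by
    have : (x₁, zh.2) ∈ K := ⟨hx₁, by constructor <;> linarith⟩
    have := hy this
    simp only [mem_ofPred_eq, Pi.sub_apply, hφ] at this
    simp only [hφ]
    simp at this
    linarith
  have h2 : A y - h y.1 ≤ C := hM hyK
  have hφy : φ y = h y.1 + n * (y.2 - zh.2) ^ 2 := rfl
  have h3 : |y.2 - zh.2| < τ := by
    by_contra hcon'
    push Not at hcon'
    have : τ ^ 2 ≤ (y.2 - zh.2) ^ 2 := by rw [← sq_abs (y.2 - zh.2)]; gcongr
    have h4 : n * τ ^ 2 ≤ n * (y.2 - zh.2) ^ 2 := by gcongr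
    have h5 : n * τ ^ 2 = |C| + 1 := by rw [hn]; field_simp
    have := le_abs_self C
    linarith
  have h4 : dist y.1 zh.1 < r := by
    rcases (mem_closedBall.1 hyK.1).lt_or_eq with h | h
    · exact h
    · have := hτ y.2 (by rw [mem_ball, Real.dist_eq]; linarith) y.1 h
      have h6 : 0 ≤ n * (y.2 - zh.2) ^ 2 := by positivity
      have h7 : A (y.1, y.2) = A y := rfl
      linarith
  have h5 : IsLocalMax (fun z => A z - φ z) y := by
    have hKn : K ∈ 𝓝 y := by
      refine prod_mem_nhds (closedBall_mem_nhds_of_mem h4) ?_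
      rw [abs_lt] at h3
      exact Icc_mem_nhds (by linarith) (by linarith)
    filter_upwards [hKn] with z hz using hy hz
  have h6 := hT φ hφc y (by
    rw [Prod.dist_eq, max_lt_iff, Real.dist_eq]; exact ⟨by linarith, by linarith⟩) h5
  have h7 : dL φ y = lapl h y.1 := dL_split (a := h) (b := fun s => n * (s - zh.2) ^ 2)
  have h8 := hl y.1 h4
  linarith

lemma sum_lemma (hN : 1 ≤ N) {A B Φ : Euc N × ℝ → ℝ} (hA : Continuous A) (hB : Continuous B)
    (hΦ : ContDiff ℝ 2 Φ) {zh : Euc N × ℝ} {r₀ cA cB : ℝ} (hr₀ : 0 < r₀)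
    (hTA : ∀ φ, ContDiff ℝ 2 φ → ∀ z, dist z zh < r₀ → IsLocalMax (fun y => A y - φ y) z → -dL φ z ≤ cA)
    (hTB : ∀ φ, ContDiff ℝ 2 φ → ∀ z, dist z zh < r₀ → IsLocalMax (fun y => B y - φ y) z → -dL φ z ≤ cB)
    (hmax : IsLocalMax (fun y => A y + B y - Φ y) zh) : - cA - cB ≤ dL Φ zh := by
  by_contra hcon
  push Not at hcon
  set s := - cA - cB - dL Φ zh with hs
  have hs0 : 0 < s := by linarith
  have hN' : (0 : ℝ) < N := by exact_mod_cast hN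
  have e1 : ∀ᶠ z in 𝓝 zh, dL Φ z < dL Φ zh + s / 4 :=
    (continuous_dL hΦ).continuousAt.eventually (gt_mem_nhds (by linarith))
  obtain ⟨r1, hr1, h1⟩ := Metric.eventually_nhds_iff_ball.1 (e1.and hmax)
  set r := min (r1 / 2) (r₀ / 2) with hr
  have hr0 : 0 < r := by positivity
  have hrr₀ : r < r₀ := lt_of_le_of_lt (min_le_right _ _) (by linarith)
  have hrr1 : r < r1 := lt_of_le_of_lt (min_le_left _ _) (by linarith)
  set κ := s / (16 * N) with hκ
  have hκ0 : 0 < κ := by positivity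
  have hκN : 2 * N * κ = s / 8 := by rw [hκ]; field_simp; norm_num
  set ε := κ * r ^ 2 / 8 with hε
  have hε0 : 0 < ε := by positivity
  have key : ∀ (A : Euc N × ℝ → ℝ) (c : ℝ), Continuous A →
      (∀ φ, ContDiff ℝ 2 φ → ∀ z, dist z zh < r₀ → IsLocalMax (fun y => A y - φ y) z → -dL φ z ≤ c) →
      ∃ h : Euc N → ℝ, ContDiff ℝ 2 h ∧ (∀ x, lapl h x = - (c + s / 8)) ∧ A zh ≤ h zh.1 ∧
        ∀ x ∈ sphere zh.1 r, h x ≤ A (x, zh.2) + 2 * ε := by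
    intro A c hA hTA
    set k := (c + s / 8) / (2 * N) with hk
    have hkN : k * (2 * N) = c + s / 8 := by rw [hk]; field_simp
    obtain ⟨h0, g1, g2, g3⟩ := exists_harmonic hN (x₀ := zh.1) hr0
      (a := fun x => A (x, zh.2) + k * r ^ 2 + ε) (by fun_prop) hε0
    have hq : ContDiff ℝ 2 (fun y : Euc N => k * ‖y - zh.1‖ ^ 2) :=
      contDiff_const.mul (contDiff_normsq zh.1)
    have hl : ∀ x, lapl (fun x => h0 x - k * ‖x - zh.1‖ ^ 2) x = - (c + s / 8) := by
      intro x
      rw [lapl_sub g1.contDiffAt hq.contDiffAt, g2,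
        lapl_const_mul _ (contDiff_normsq zh.1).contDiffAt, lapl_normsq]
      linarith
    have hsph : ∀ x ∈ sphere zh.1 r, |(h0 x - k * ‖x - zh.1‖ ^ 2) - A (x, zh.2) - ε| < ε := by
      intro x hx
      have : ‖x - zh.1‖ = r := by rw [← dist_eq_norm]; exact hx
      rw [this]
      have := g3 x hx
      convert this using 2
      ring
    refine ⟨fun x => h0 x - k * ‖x - zh.1‖ ^ 2, g1.sub hq, hl, ?_, ?_⟩
    · have := slice_le hA hTA hr0 hrr₀ (g1.sub hq) (fun x _ => by rw [hl x]; linarith)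
        (fun x hx => by
          have := (abs_lt.1 (hsph x hx)).1
          linarith) zh.1 (by simp [hr0.le])
      exact this
    · intro x hx
      have := (abs_lt.1 (hsph x hx)).2
      simp only
      linarith
  obtain ⟨hA', a1, a2, a3, a4⟩ := key A cA hA hTA
  obtain ⟨hB', b1, b2, b3, b4⟩ := key B cB hB hTB
  set M := A zh + B zh - Φ zh with hM
  have hq : ContDiff ℝ 2 (fun y : Euc N => κ * ‖y - zh.1‖ ^ 2) :=
    contDiff_const.mul (contDiff_normsq zh.1)
  have hΦs : ContDiff ℝ 2 (fun y : Euc N => Φ (y, zh.2)) :=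
    hΦ.comp (contDiff_id.prodMk contDiff_const)
  have hP := max_principle_strict (x₀ := zh.1) (h := fun x => (((hA' x + hB' x) - Φ (x, zh.2)) -
      κ * ‖x - zh.1‖ ^ 2) - (M + 4 * ε - κ * r ^ 2)) hr0
    ((((a1.add b1).sub hΦs).sub hq).sub contDiff_const)
    (fun x hx => by
      rw [lapl_sub (((a1.add b1).sub hΦs).sub hq).contDiffAt contDiffAt_const, lapl_const,
        lapl_sub ((a1.add b1).sub hΦs).contDiffAt hq.contDiffAt,
        lapl_sub (a1.add b1).contDiffAt hΦs.contDiffAt, lapl_add a1.contDiffAt b1.contDiffAt,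
        lapl_const_mul _ (contDiff_normsq zh.1).contDiffAt, lapl_normsq, a2, b2]
      have := (h1 (x, zh.2) (by
        rw [mem_ball, Prod.dist_eq]
        simp only [dist_self]
        have : dist x zh.1 < r := hx
        rw [max_lt_iff]; exact ⟨by linarith, by linarith⟩)).1
      have h3 : dL Φ (x, zh.2) = lapl (fun y => Φ (y, zh.2)) x := rfl
      rw [← h3]
      have : κ * (2 * N) = s / 8 := by linarith
      linarith)
    (fun x hx => by
      have hn : ‖x - zh.1‖ = r := by rw [← dist_eq_norm]; exact hx
      rw [hn]
      have := (h1 (x, zh.2) (by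
        rw [mem_ball, Prod.dist_eq]
        simp only [dist_self]
        have : dist x zh.1 = r := hx
        rw [max_lt_iff]; exact ⟨by linarith, by linarith⟩)).2
      have g1 := a4 x hx
      have g2 := b4 x hx
      linarith) zh.1 (by simp [hr0.le])
  simp only [sub_self, norm_zero] at hP
  have h9 : Φ (zh.1, zh.2) = Φ zh := rfl
  have : 4 * ε = κ * r ^ 2 / 2 := by rw [hε]; ring
  have : 0 < κ * r ^ 2 := by positivity
  rw [h9] at hP
  linarith

end VS

namespace VS

variable {N : ℕ}

/-! ### sup-convolutions -/

lemma qd_symm (κ : ℝ) (a z : Euc N × ℝ) : qd κ a z = qd κ z a := by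
  unfold qd; rw [norm_sub_rev]; ring

lemma qd_cont2 (κ : ℝ) : Continuous fun q : (Euc N × ℝ) × (Euc N × ℝ) => qd κ q.1 q.2 := by
  unfold qd; fun_prop

/-- `a` maximizes `A - κ|· - z|²` over `K` -/
def IsMx (κ : ℝ) (K : Set (Euc N × ℝ)) (A : Euc N × ℝ → ℝ) (z a : Euc N × ℝ) : Prop :=
  a ∈ K ∧ ∀ y ∈ K, A y - qd κ y z ≤ A a - qd κ a z

lemma exists_mx {κ : ℝ} {K : Set (Euc N × ℝ)} {A : Euc N × ℝ → ℝ} (hK : IsCompact K)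
    (hne : K.Nonempty) (hA : UpperSemicontinuousOn A K) (z : Euc N × ℝ) : ∃ a, IsMx κ K A z a := by
  have : UpperSemicontinuousOn (fun y => A y - qd κ y z) K := by
    simp only [sub_eq_add_neg]
    refine hA.add (Continuous.upperSemicontinuous ?_ |>.upperSemicontinuousOn K)
    exact ((qd_cont2 κ).comp (continuous_id.prodMk continuous_const)).neg
  obtain ⟨a, ha, hm⟩ := this.exists_isMaxOn hne hK
  exact ⟨a, ha, fun y hy => hm hy⟩

noncomputable def sc (κ : ℝ) (K : Set (Euc N × ℝ)) (A : Euc N × ℝ → ℝ) (z : Euc N × ℝ) : ℝ :=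
  sSup ((fun y => A y - qd κ y z) '' K)

lemma IsMx.sc_eq {κ : ℝ} {K : Set (Euc N × ℝ)} {A : Euc N × ℝ → ℝ} {z a : Euc N × ℝ}
    (h : IsMx κ K A z a) : sc κ K A z = A a - qd κ a z := by
  refine IsGreatest.csSup_eq ⟨⟨a, h.1, rfl⟩, ?_⟩
  rintro _ ⟨y, hy, rfl⟩
  exact h.2 y hy

section
variable {κ : ℝ} {K : Set (Euc N × ℝ)} {A : Euc N × ℝ → ℝ}

lemma qd_near (hK : IsCompact K) (κ : ℝ) (z : Euc N × ℝ) {ε : ℝ} (hε : 0 < ε) :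
    ∀ᶠ z' in 𝓝 z, ∀ a ∈ K, |qd κ a z' - qd κ a z| < ε := by
  refine hK.eventually_forall_of_forall_eventually fun a _ => ?_
  have : Continuous fun q : (Euc N × ℝ) × (Euc N × ℝ) => |qd κ q.2 q.1 - qd κ q.2 z| :=
    (((qd_cont2 κ).comp (continuous_snd.prodMk continuous_fst)).sub
      ((qd_cont2 κ).comp (continuous_snd.prodMk continuous_const))).abs
  refine this.continuousAt.eventually (gt_mem_nhds ?_)
  simpa using hε

lemma le_sc (hK : IsCompact K) (hne : K.Nonempty) (hA : UpperSemicontinuousOn A K)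
    (z y : Euc N × ℝ) (hy : y ∈ K) : A y - qd κ y z ≤ sc κ K A z := by
  obtain ⟨a, ha⟩ := exists_mx (κ := κ) hK hne hA z
  rw [ha.sc_eq]; exact ha.2 y hy

lemma sc_near (hK : IsCompact K) (hne : K.Nonempty) (hA : UpperSemicontinuousOn A K)
    (z : Euc N × ℝ) {ε : ℝ} (hε : 0 < ε) :
    ∀ᶠ z' in 𝓝 z, |sc κ K A z' - sc κ K A z| < ε := by
  filter_upwards [qd_near hK κ z hε] with z' hz'
  obtain ⟨a, ha⟩ := exists_mx (κ := κ) hK hne hA z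
  obtain ⟨a', ha'⟩ := exists_mx (κ := κ) hK hne hA z'
  have h1 := ha.2 a' ha'.1
  have h2 := ha'.2 a ha.1
  have h3 := abs_lt.1 (hz' a ha.1)
  have h4 := abs_lt.1 (hz' a' ha'.1)
  rw [ha.sc_eq, ha'.sc_eq, abs_lt]
  constructor <;> linarith

lemma sc_cont (hK : IsCompact K) (hne : K.Nonempty) (hA : UpperSemicontinuousOn A K)
    : Continuous (sc κ K A) := by
  rw [continuous_iff_continuousAt]
  intro z
  rw [ContinuousAt, Metric.tendsto_nhds]
  intro ε hε
  simpa [Real.dist_eq] using sc_near hK hne hA z hε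

lemma sc_test (hK : IsCompact K) (hne : K.Nonempty) (hA : UpperSemicontinuousOn A K)
    {φ : Euc N × ℝ → ℝ} (hφ : ContDiff ℝ 2 φ) {z a : Euc N × ℝ} (ha : IsMx κ K A z a)
    (hm : IsLocalMax (fun y => sc κ K A y - φ y) z) :
    dT φ z = 2 * κ * (a.2 - z.2) ∧ dX φ z = (2 * κ) • (a.1 - z.1) ∧
    IsLocalMaxOn (fun y => A y - φ (y + (z - a))) K a := by
  have h0 : ContDiff ℝ 2 (fun y => A a - qd κ a y) := contDiff_const.sub (qd_contDiff κ a)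
  have h1 : IsLocalMax (fun y => (A a - qd κ a y) - φ y) z := by
    filter_upwards [hm] with y hy
    have h2 := le_sc (κ := κ) hK hne hA y a ha.1
    have h3 := ha.sc_eq
    linarith
  obtain ⟨g1, g2, -⟩ := touch_derivs h0.contDiffAt hφ.contDiffAt h1
  rw [dT_sub contDiffAt_const (qd_contDiff κ a).contDiffAt, dT_const, dT_qd] at g1
  rw [dX_sub contDiffAt_const (qd_contDiff κ a).contDiffAt, dX_const, dX_qd] at g2
  refine ⟨by linarith, ?_, ?_⟩
  · rw [← g2, zero_sub, ← smul_neg, neg_sub]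
  · have hc : Tendsto (fun y => y + (z - a)) (𝓝 a) (𝓝 z) := by
      have : Continuous fun y : Euc N × ℝ => y + (z - a) := by fun_prop
      simpa using this.tendsto a
    have h4 := hc.eventually hm
    filter_upwards [h4.filter_mono nhdsWithin_le_nhds, self_mem_nhdsWithin] with y hy hyK
    have h5 := le_sc (κ := κ) hK hne hA (y + (z - a)) y hyK
    have h6 := ha.sc_eq
    have h7 : qd κ y (y + (z - a)) = qd κ a z := by simp [qd]
    have h8 : a + (z - a) = z := by abel
    rw [h8]
    linarith

/-- maximizers converge to a unique maximizer -/
lemma mx_near (hK : IsCompact K) (hne : K.Nonempty) (hA : UpperSemicontinuousOn A K)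
    {z a : Euc N × ℝ} (ha : IsMx κ K A z a) (huniq : ∀ a', IsMx κ K A z a' → a' = a)
    {ρ : ℝ} (hρ : 0 < ρ) : ∀ᶠ z' in 𝓝 z, ∀ a', IsMx κ K A z' a' →
      dist a' a < ρ ∧ |A a' - A a| < ρ := by
  have hclose : ∀ ρ > 0, ∀ᶠ z' in 𝓝 z, ∀ a', IsMx κ K A z' a' → dist a' a < ρ := by
    intro ρ hρ
    by_cases hne' : (K ∩ (ball a ρ)ᶜ).Nonempty
    · have hK' : IsCompact (K ∩ (ball a ρ)ᶜ) := hK.inter_right isOpen_ball.isClosed_compl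
      obtain ⟨b, hb⟩ := exists_mx (κ := κ) hK' hne' (hA.mono inter_subset_left) z
      set γ := sc κ K A z - (A b - qd κ b z) with hγ
      have hγ0 : 0 < γ := by
        have h1 := le_sc (κ := κ) hK hne hA z b hb.1.1
        rcases h1.lt_or_eq with h | h
        · linarith
        · exfalso
          have : b = a := huniq b ⟨hb.1.1, fun y hy => by
            rw [h]; exact le_sc (κ := κ) hK hne hA z y hy⟩
          apply hb.1.2
          rw [this]; simp [hρ]
      filter_upwards [qd_near hK κ z (half_pos (half_pos hγ0)),
        sc_near (κ := κ) hK hne hA z (half_pos (half_pos hγ0))] with z' h1 h2 a' ha'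
      by_contra hcon
      have hmem : a' ∈ K ∩ (ball a ρ)ᶜ := ⟨ha'.1, by simpa using hcon⟩
      have h3 := hb.2 a' hmem
      have h4 := abs_lt.1 (h1 a' ha'.1)
      have h5 := abs_lt.1 h2
      have h6 := ha'.sc_eq
      linarith
    · refine Eventually.of_forall fun z' a' ha' => ?_
      by_contra hcon
      exact hne' ⟨a', ha'.1, by simpa using hcon⟩
  have hq : ∀ᶠ q in 𝓝 (a, z), |qd κ q.1 q.2 - qd κ a z| < ρ / 2 := by
    have : Continuous fun q : (Euc N × ℝ) × (Euc N × ℝ) => |qd κ q.1 q.2 - qd κ a z| :=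
      ((qd_cont2 κ).sub continuous_const).abs
    refine this.continuousAt.eventually (gt_mem_nhds ?_)
    simpa using hρ
  obtain ⟨r, hr, hb⟩ := Metric.eventually_nhds_iff_ball.1 hq
  filter_upwards [hclose ρ hρ, hclose r hr, sc_near (κ := κ) hK hne hA z (half_pos hρ),
    ball_mem_nhds z hr] with z' h1 h2 h3 h4 a' ha'
  refine ⟨h1 a' ha', ?_⟩
  have h5 := abs_lt.1 (hb (a', z') (by
    rw [mem_ball, Prod.dist_eq, max_lt_iff]; exact ⟨h2 a' ha', h4⟩))
  have h6 := abs_lt.1 h3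
  rw [ha'.sc_eq, ha.sc_eq] at h6
  simp only at h5
  rw [abs_lt]
  constructor <;> linarith

end

/-- local (robust) subsolution property at a point -/
def LSub (K : Set (Euc N × ℝ)) (A : Euc N × ℝ → ℝ) (G : Euc N × ℝ → Euc N → ℝ) (a : Euc N × ℝ) : Prop :=
  ∀ p : Euc N, ∀ θ > 0, ∃ ρ > 0, ∀ a' ∈ K, dist a' a < ρ → |A a' - A a| < ρ →
    ∀ φ, ContDiff ℝ 2 φ → IsLocalMaxOn (fun y => A y - φ y) K a' → ‖dX φ a' - p‖ < ρ →
      dT φ a' - dL φ a' + G a p - θ ≤ 0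

lemma test_bound {κ : ℝ} {K : Set (Euc N × ℝ)} {A : Euc N × ℝ → ℝ} (hK : IsCompact K)
    (hne : K.Nonempty) (hA : UpperSemicontinuousOn A K) {G : Euc N × ℝ → Euc N → ℝ}
    {zh a : Euc N × ℝ} (ha : IsMx κ K A zh a) (huniq : ∀ a', IsMx κ K A zh a' → a' = a)
    (hL : LSub K A G a) {θ : ℝ} (hθ : 0 < θ) :
    ∃ r > 0, ∀ φ, ContDiff ℝ 2 φ → ∀ z, dist z zh < r → IsLocalMax (fun y => sc κ K A y - φ y) z →
      - dL φ z ≤ - (2 * κ * (a.2 - zh.2) + G a ((2 * κ) • (a.1 - zh.1))) + θ := by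
  obtain ⟨ρ, hρ, H⟩ := hL ((2 * κ) • (a.1 - zh.1)) (θ / 2) (half_pos hθ)
  have c1 : ∀ᶠ q in 𝓝 (a, zh), ‖(2 * κ) • (q.1.1 - q.2.1) - (2 * κ) • (a.1 - zh.1)‖ < ρ := by
    have : Continuous fun q : (Euc N × ℝ) × (Euc N × ℝ) =>
      ‖(2 * κ) • (q.1.1 - q.2.1) - (2 * κ) • (a.1 - zh.1)‖ := by fun_prop
    refine this.continuousAt.eventually (gt_mem_nhds ?_)
    simpa using hρ
  have c2 : ∀ᶠ q in 𝓝 (a, zh), |2 * κ * (q.1.2 - q.2.2) - 2 * κ * (a.2 - zh.2)| < θ / 2 := by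
    have : Continuous fun q : (Euc N × ℝ) × (Euc N × ℝ) =>
      |2 * κ * (q.1.2 - q.2.2) - 2 * κ * (a.2 - zh.2)| := by fun_prop
    refine this.continuousAt.eventually (gt_mem_nhds ?_)
    simpa using hθ
  obtain ⟨s, hs, hb⟩ := Metric.eventually_nhds_iff_ball.1 (c1.and c2)
  have e := (mx_near hK hne hA ha huniq hρ).and ((mx_near hK hne hA ha huniq hs).and (ball_mem_nhds zh hs))
  obtain ⟨r, hr, hb'⟩ := Metric.eventually_nhds_iff_ball.1 e
  refine ⟨r, hr, fun φ hφ z hz hm => ?_⟩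
  obtain ⟨g1, g2, g3⟩ := hb' z hz
  obtain ⟨a', ha'⟩ := exists_mx (κ := κ) hK hne hA z
  obtain ⟨k1, k2, k3⟩ := sc_test hK hne hA hφ ha' hm
  obtain ⟨l1, l2⟩ := hb (a', z) (by
    rw [mem_ball, Prod.dist_eq, max_lt_iff]; exact ⟨(g2 a' ha').1, g3⟩)
  have hz' : a' + (z - a') = z := by abel
  have := H a' ha'.1 (g1 a' ha').1 (g1 a' ha').2 (fun y => φ (y + (z - a')))
    (hφ.comp (contDiff_id.add contDiff_const)) k3 (by
      rw [dX_translate, hz', k2]; exact l1)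
  rw [dT_translate, dL_translate, hz', k1] at this
  have l3 := abs_lt.1 l2
  simp only at l3
  linarith

/-- theorem on sums -/
lemma theorem_on_sums (hN : 1 ≤ N) {κ : ℝ} (hκ : 0 < κ) {KA KB : Set (Euc N × ℝ)}
    {A B Φ : Euc N × ℝ → ℝ} (hKA : IsCompact KA) (hKB : IsCompact KB)
    (hA : UpperSemicontinuousOn A KA) (hB : UpperSemicontinuousOn B KB) (hΦ : ContDiff ℝ 2 Φ)
    {GA GB : Euc N × ℝ → Euc N → ℝ} {zh a b : Euc N × ℝ} (ha : IsMx κ KA A zh a)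
    (hb : IsMx κ KB B zh b)
    (hmax : IsLocalMax (fun y => sc κ KA A y + sc κ KB B y - Φ y) zh)
    (hLA : LSub KA A GA a) (hLB : LSub KB B GB b) :
    ∃ p q : Euc N, p + q = dX Φ zh ∧ dT Φ zh - dL Φ zh + GA a p + GB b q ≤ 0 := by
  have hneA : KA.Nonempty := ⟨a, ha.1⟩
  have hneB : KB.Nonempty := ⟨b, hb.1⟩
  have rel : ∀ a b, IsMx κ KA A zh a → IsMx κ KB B zh b →
      2 * κ * (a.2 - zh.2) + 2 * κ * (b.2 - zh.2) = dT Φ zh ∧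
      (2 * κ) • (a.1 - zh.1) + (2 * κ) • (b.1 - zh.1) = dX Φ zh := by
    intro a b ha hb
    have c1 : ContDiff ℝ 2 (fun y => A a - qd κ a y) := contDiff_const.sub (qd_contDiff κ a)
    have c2 : ContDiff ℝ 2 (fun y => B b - qd κ b y) := contDiff_const.sub (qd_contDiff κ b)
    have h1 : IsLocalMax (fun y => ((A a - qd κ a y) + (B b - qd κ b y)) - Φ y) zh := by
      filter_upwards [hmax] with y hy
      have h2 := le_sc (κ := κ) hKA hneA hA y a ha.1
      have h3 := le_sc (κ := κ) hKB hneB hB y b hb.1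
      have h4 := ha.sc_eq
      have h5 := hb.sc_eq
      linarith
    obtain ⟨g1, g2, -⟩ := touch_derivs (c1.add c2).contDiffAt hΦ.contDiffAt h1
    rw [dT_add c1.contDiffAt c2.contDiffAt, dT_sub contDiffAt_const (qd_contDiff κ a).contDiffAt,
      dT_sub contDiffAt_const (qd_contDiff κ b).contDiffAt, dT_const, dT_const, dT_qd, dT_qd] at g1
    rw [dX_add c1.contDiffAt c2.contDiffAt, dX_sub contDiffAt_const (qd_contDiff κ a).contDiffAt,
      dX_sub contDiffAt_const (qd_contDiff κ b).contDiffAt, dX_const, dX_const, dX_qd, dX_qd] at g2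
    refine ⟨by linarith, ?_⟩
    rw [← g2, zero_sub, zero_sub, ← smul_neg, ← smul_neg, neg_sub, neg_sub]
  obtain ⟨r1, r2⟩ := rel a b ha hb
  have uA : ∀ a', IsMx κ KA A zh a' → a' = a := by
    intro a' ha'
    obtain ⟨s1, s2⟩ := rel a' b ha' hb
    have t1 : (2 * κ) * (a'.2 - zh.2) = (2 * κ) * (a.2 - zh.2) := by linarith
    have t2 : (2 * κ) • (a'.1 - zh.1) = (2 * κ) • (a.1 - zh.1) := by
      rw [← r2] at s2; exact add_right_cancel s2
    have t3 := mul_left_cancel₀ (by positivity) t1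
    have t4 := (smul_right_injective (Euc N) (by positivity : 2 * κ ≠ 0)) t2
    exact Prod.ext (sub_left_injective t4) (by linarith)
  have uB : ∀ b', IsMx κ KB B zh b' → b' = b := by
    intro b' hb'
    obtain ⟨s1, s2⟩ := rel a b' ha hb'
    have t1 : (2 * κ) * (b'.2 - zh.2) = (2 * κ) * (b.2 - zh.2) := by linarith
    have t2 : (2 * κ) • (b'.1 - zh.1) = (2 * κ) • (b.1 - zh.1) := by
      rw [← r2] at s2; exact add_left_cancel s2
    have t3 := mul_left_cancel₀ (by positivity) t1
    have t4 := (smul_right_injective (Euc N) (by positivity : 2 * κ ≠ 0)) t2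
    exact Prod.ext (sub_left_injective t4) (by linarith)
  refine ⟨_, _, r2, ?_⟩
  refine le_of_forall_pos_le_add fun θ hθ => ?_
  obtain ⟨ρ1, hρ1, H1⟩ := test_bound hKA hneA hA ha uA hLA (half_pos hθ)
  obtain ⟨ρ2, hρ2, H2⟩ := test_bound hKB hneB hB hb uB hLB (half_pos hθ)
  have := sum_lemma hN (sc_cont hKA hneA hA) (sc_cont hKB hneB hB) hΦ (lt_min hρ1 hρ2)
    (fun φ hφ z hz hm => H1 φ hφ z (lt_of_lt_of_le hz (min_le_left _ _)) hm)
    (fun φ hφ z hz hm => H2 φ hφ z (lt_of_lt_of_le hz (min_le_right _ _)) hm) hmax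
  linarith

end VS

namespace VS

variable {N : ℕ}

/-! ### doubling of variables -/

lemma doubling {KA KB : Set (Euc N × ℝ)} (hKA : IsCompact KA) (hKB : IsCompact KB)
    {A B Φ : Euc N × ℝ → ℝ} (hA : UpperSemicontinuousOn A KA) (hB : UpperSemicontinuousOn B KB)
    (hΦ : Continuous Φ) {ρ₁ ρ₂ M : ℝ} (hρ₁ : ρ₁ ≤ 1) (hρ₂ : 0 < ρ₂) {z₀ z₁ : Euc N × ℝ}
    (hz₁A : z₁ ∈ KA) (hz₁B : z₁ ∈ KB) (hz₁ : M ≤ A z₁ + B z₁ - Φ z₁)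
    (hloc : ∀ z ∈ KA, z ∈ KB → M ≤ A z + B z - Φ z → dist z z₀ < ρ₁) :
    ∃ κ > 0, ∃ zh a b, IsMx κ KA A zh a ∧ IsMx κ KB B zh b ∧
      IsLocalMax (fun y => sc κ KA A y + sc κ KB B y - Φ y) zh ∧
      dist zh z₀ < ρ₁ ∧ dist a z₀ < ρ₁ ∧ dist b z₀ < ρ₁ ∧ dist a b < ρ₂ ∧
      M + Φ zh ≤ A a + B b := by
  set K : Set ((Euc N × ℝ) × (Euc N × ℝ) × (Euc N × ℝ)) := KA ×ˢ KB ×ˢ closedBall z₀ 2 with hKdef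
  have hK : IsCompact K := hKA.prod (hKB.prod (isCompact_closedBall z₀ 2))
  set J : ℕ → (Euc N × ℝ) × (Euc N × ℝ) × (Euc N × ℝ) → ℝ := fun n q =>
    A q.1 + (B q.2.1 + -(Φ q.2.2 + qd (n + 1) q.1 q.2.2 + qd (n + 1) q.2.1 q.2.2)) with hJ
  have hJu : ∀ n, UpperSemicontinuousOn (J n) K := by
    intro n
    refine UpperSemicontinuousOn.add ?_ (UpperSemicontinuousOn.add ?_ ?_)
    · exact hA.comp continuous_fst.continuousOn (fun q hq => hq.1)
    · exact hB.comp (continuous_fst.comp continuous_snd).continuousOn (fun q hq => hq.2.1)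
    · refine (Continuous.upperSemicontinuous ?_).upperSemicontinuousOn K
      unfold qd
      fun_prop
  set Bad : Set ((Euc N × ℝ) × (Euc N × ℝ) × (Euc N × ℝ)) :=
    {q | ρ₁ ≤ dist q.2.2 z₀ ∨ ρ₁ ≤ dist q.1 z₀ ∨ ρ₁ ≤ dist q.2.1 z₀ ∨ ρ₂ ≤ dist q.1 q.2.1} with hBad
  have hBc : IsClosed Bad := by
    have c1 : IsClosed {q : (Euc N × ℝ) × (Euc N × ℝ) × (Euc N × ℝ) | ρ₁ ≤ dist q.2.2 z₀} :=
      isClosed_le continuous_const (by fun_prop)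
    have c2 : IsClosed {q : (Euc N × ℝ) × (Euc N × ℝ) × (Euc N × ℝ) | ρ₁ ≤ dist q.1 z₀} :=
      isClosed_le continuous_const (by fun_prop)
    have c3 : IsClosed {q : (Euc N × ℝ) × (Euc N × ℝ) × (Euc N × ℝ) | ρ₁ ≤ dist q.2.1 z₀} :=
      isClosed_le continuous_const (by fun_prop)
    have c4 : IsClosed {q : (Euc N × ℝ) × (Euc N × ℝ) × (Euc N × ℝ) | ρ₂ ≤ dist q.1 q.2.1} :=
      isClosed_le continuous_const (by fun_prop)
    exact c1.union (c2.union (c3.union c4))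
  set E : ℕ → Set ((Euc N × ℝ) × (Euc N × ℝ) × (Euc N × ℝ)) := fun n => (K ∩ J n ⁻¹' Ici M) ∩ Bad with hE
  have hEc : ∀ n, IsCompact (E n) := fun n =>
    ((hJu n).isCompact_inter_preimage_Ici hK M).inter_right hBc
  have hanti : ∀ n, E (n + 1) ⊆ E n := by
    rintro n q ⟨⟨h1, h2⟩, h3⟩
    refine ⟨⟨h1, ?_⟩, h3⟩
    simp only [mem_preimage, mem_Ici, hJ] at h2 ⊢
    have e1 : qd ((n : ℝ) + 1) q.1 q.2.2 ≤ qd ((n + 1 : ℕ) + 1 : ℝ) q.1 q.2.2 := by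
      unfold qd; push_cast; gcongr <;> linarith
    have e2 : qd ((n : ℝ) + 1) q.2.1 q.2.2 ≤ qd ((n + 1 : ℕ) + 1 : ℝ) q.2.1 q.2.2 := by
      unfold qd; push_cast; gcongr <;> linarith
    linarith
  have hex : ∃ n, ¬ (E n).Nonempty := by
    by_contra hcon
    push Not at hcon
    obtain ⟨⟨a, b, z⟩, hq⟩ := IsCompact.nonempty_iInter_of_sequence_nonempty_isCompact_isClosed E hanti hcon
      (hEc 0) (fun n => (hEc n).isClosed)
    rw [mem_iInter] at hq
    obtain ⟨⟨⟨ha, hb, hz⟩, -⟩, hbad⟩ := hq 0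
    have hq' : ∀ n : ℕ, (n + 1 : ℝ) * (qd 1 a z + qd 1 b z) ≤ A a + B b - Φ z - M := by
      intro n
      have := (hq n).1.2
      simp only [mem_preimage, mem_Ici, hJ] at this
      have e : ∀ c, qd (n + 1 : ℝ) c z = (n + 1 : ℝ) * qd 1 c z := by intro c; unfold qd; ring
      rw [e, e] at this
      linarith
    have hS : qd 1 a z + qd 1 b z ≤ 0 := by
      by_contra hc
      push Not at hc
      obtain ⟨n, hn⟩ := exists_nat_gt ((A a + B b - Φ z - M) / (qd 1 a z + qd 1 b z))
      rw [div_lt_iff₀ hc] at hn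
      have := hq' n
      nlinarith
    have n1 := qd_nonneg zero_le_one a z
    have n2 := qd_nonneg zero_le_one b z
    have key : ∀ c : Euc N × ℝ, qd 1 c z ≤ 0 → c = z := by
      intro c hc
      by_contra hne
      have hd : 0 < dist z c := dist_pos.2 (Ne.symm hne)
      have := qd_ge zero_le_one hd.le (le_refl (dist z c))
      nlinarith
    have hs0 := hq' 0
    obtain rfl := key a (by linarith)
    obtain rfl := key b (by linarith)
    have hd := hloc b ha hb (by push_cast at hs0; nlinarith)
    rcases hbad with h | h | h | h <;> simp only at h
    · linarith
    · linarith
    · linarith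
    · simp at h; linarith
  obtain ⟨n, hn⟩ := hex
  have hz1d := hloc z₁ hz₁A hz₁B hz₁
  have hz₁K : (z₁, z₁, z₁) ∈ K := ⟨hz₁A, hz₁B, by simp; linarith⟩
  obtain ⟨⟨a, b, zh⟩, hqK, hmax⟩ := (hJu n).exists_isMaxOn ⟨_, hz₁K⟩ hK
  have hJM : M ≤ J n (a, b, zh) := by
    refine le_trans ?_ (hmax hz₁K)
    simp only [hJ, qd_self]; linarith
  have hgood : (a, b, zh) ∉ Bad := fun hb => hn ⟨_, ⟨hqK, hJM⟩, hb⟩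
  simp only [hBad, mem_ofPred_eq, not_or, not_le] at hgood
  obtain ⟨g1, g2, g3, g4⟩ := hgood
  have hJle : ∀ a' ∈ KA, ∀ b' ∈ KB, ∀ z' ∈ closedBall z₀ 2, J n (a', b', z') ≤ J n (a, b, zh) :=
    fun a' h1 b' h2 z' h3 => hmax ⟨h1, h2, h3⟩
  have hneA : KA.Nonempty := ⟨_, hz₁A⟩
  have hneB : KB.Nonempty := ⟨_, hz₁B⟩
  have mA : IsMx (n + 1 : ℝ) KA A zh a := ⟨hqK.1, fun y hy => by
    have := hJle y hy b hqK.2.1 zh hqK.2.2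
    simp only [hJ] at this; linarith⟩
  have mB : IsMx (n + 1 : ℝ) KB B zh b := ⟨hqK.2.1, fun y hy => by
    have := hJle a hqK.1 y hy zh hqK.2.2
    simp only [hJ] at this; linarith⟩
  refine ⟨n + 1, by positivity, zh, a, b, mA, mB, ?_, g1, g2, g3, g4, ?_⟩
  · have : closedBall z₀ 2 ∈ 𝓝 zh :=
      mem_of_superset (isOpen_ball.mem_nhds (show zh ∈ ball z₀ 2 by rw [mem_ball]; linarith)) ball_subset_closedBall
    filter_upwards [this] with y hy
    obtain ⟨a', ha'⟩ := exists_mx (κ := (n + 1 : ℝ)) hKA hneA hA y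
    obtain ⟨b', hb'⟩ := exists_mx (κ := (n + 1 : ℝ)) hKB hneB hB y
    have := hJle a' ha'.1 b' hb'.1 y hy
    simp only [hJ] at this
    rw [ha'.sc_eq, hb'.sc_eq, mA.sc_eq, mB.sc_eq]
    linarith
  · have h1 := qd_nonneg (show (0 : ℝ) ≤ n + 1 by positivity) a zh
    have h2 := qd_nonneg (show (0 : ℝ) ≤ n + 1 by positivity) b zh
    simp only [hJ] at hJM
    linarith

end VS

namespace VS

variable {N : ℕ}

/-! ### the local comparison lemma -/

lemma usc_nested {X : Type*} [TopologicalSpace X] {K : Set X} (hK : IsCompact K) {h d : X → ℝ}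
    (hh : UpperSemicontinuousOn h K) (hd : Continuous d) (hd0 : ∀ x, 0 ≤ d x) {M : ℝ}
    (H : ∀ q ∈ K, d q = 0 → h q < M) : ∃ η > 0, ∀ q ∈ K, d q ≤ η → h q < M - η := by
  rcases K.eq_empty_or_nonempty with rfl | hne
  · exact ⟨1, one_pos, fun q hq => hq.elim⟩
  have husc : UpperSemicontinuousOn (fun q => min (h q + (-M)) (-d q)) K :=
    (hh.add (continuous_const.upperSemicontinuous.upperSemicontinuousOn K)).inf
      (hd.neg.upperSemicontinuous.upperSemicontinuousOn K)
  obtain ⟨q, hq, hm⟩ := husc.exists_isMaxOn hne hK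
  have hneg : min (h q + (-M)) (-d q) < 0 := by
    rcases (hd0 q).lt_or_eq with h1 | h1
    · exact min_lt_iff.2 (Or.inr (by linarith))
    · exact min_lt_iff.2 (Or.inl (by linarith [H q hq h1.symm]))
  refine ⟨-(min (h q + (-M)) (-d q)) / 2, by linarith, fun y hy hdy => ?_⟩
  have h1 : min (h y + (-M)) (-d y) ≤ min (h q + (-M)) (-d q) := hm hy
  rcases min_le_iff.1 h1 with h2 | h2 <;> linarith

lemma lsub_of {K : Set (Euc N × ℝ)} {A h : Euc N × ℝ → ℝ} {a : Euc N × ℝ} {σ m lam : ℝ} (hm : 0 < m)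
    (hh : ContinuousWithinAt h K a)
    (H : ∃ ρ > 0, ∀ a' ∈ K, dist a' a < ρ → |A a' - A a| < ρ → ∀ φ, ContDiff ℝ 2 φ →
      IsLocalMaxOn (fun y => A y - φ y) K a' →
      dT φ a' - dL φ a' + (σ * ‖dX φ a'‖ ^ m + lam * A a' - h a') ≤ 0) :
    LSub K A (fun z p => σ * ‖p‖ ^ m + lam * A z - h z) a := by
  obtain ⟨ρ, hρ, H⟩ := H
  intro p θ hθ
  have t1 : ∀ᶠ p' in 𝓝 p, |σ * ‖p'‖ ^ m - σ * ‖p‖ ^ m| < θ / 4 := by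
    have : ContinuousAt (fun p' : Euc N => |σ * ‖p'‖ ^ m - σ * ‖p‖ ^ m|) p := by
      have : Continuous (fun p' : Euc N => ‖p'‖ ^ m) :=
        continuous_norm.rpow_const (fun _ => Or.inr hm.le)
      exact ((continuous_const.mul this).sub continuous_const).abs.continuousAt
    refine this.eventually (gt_mem_nhds ?_); simp only; simp; linarith
  have t2 : ∀ᶠ r' in 𝓝 (A a), |lam * r' - lam * A a| < θ / 4 := by
    have : ContinuousAt (fun r' : ℝ => |lam * r' - lam * A a|) (A a) := by fun_prop
    refine this.eventually (gt_mem_nhds ?_); simp only; simp; linarith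
  have t3 : ∀ᶠ x' in 𝓝[K] a, |h x' - h a| < θ / 4 := by
    have : ContinuousWithinAt (fun x' => |h x' - h a|) K a :=
      (hh.sub continuousWithinAt_const).abs
    refine this.eventually (gt_mem_nhds ?_); simp only; simp; linarith
  rw [eventually_nhdsWithin_iff] at t3
  obtain ⟨ε1, hε1, h1⟩ := Metric.eventually_nhds_iff_ball.1 t1
  obtain ⟨ε2, hε2, h2⟩ := Metric.eventually_nhds_iff_ball.1 t2
  obtain ⟨ε3, hε3, h3⟩ := Metric.eventually_nhds_iff_ball.1 t3
  refine ⟨min (min ε1 ε2) (min ε3 ρ), by positivity, ?_⟩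
  intro a' ha' hd hA φ hφ hmx hp
  simp only [lt_min_iff] at hd hA hp
  have u1 := h1 (dX φ a') (by rw [mem_ball, dist_eq_norm]; exact hp.1.1)
  have u2 := h2 (A a') (by rw [mem_ball, Real.dist_eq]; exact hA.1.2)
  have u3 := h3 a' (by rw [mem_ball]; exact hd.2.1) ha'
  have u4 := H a' ha' hd.2.2 hA.2.2 φ hφ hmx
  rw [abs_lt] at u1 u2 u3
  linarith

/-- Scaled translated subsolution. -/
lemma shift_scale {Q : Set (Euc N × ℝ)} {G : Euc N × ℝ → Euc N → ℝ} {u : Euc N × ℝ → ℝ}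
    (hu : GSub Q Q G u) {μ : ℝ} (hμ : 0 < μ) (c : Euc N × ℝ) {a : Euc N × ℝ} (ha : a + c ∈ Q)
    {φ : Euc N × ℝ → ℝ} (hφ : ContDiff ℝ 2 φ)
    (hm : IsLocalMax (fun y => μ * u (y + c) - φ y) a) :
    dT φ a - dL φ a + μ * G (a + c) (μ⁻¹ • dX φ a) ≤ 0 := by
  have hψ1 : ContDiff ℝ 2 (fun y => φ (y + -c)) := hφ.comp (contDiff_id.add contDiff_const)
  have hψ : ContDiff ℝ 2 (fun y => μ⁻¹ * φ (y + -c)) := contDiff_const.mul hψ1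
  have hlm : IsLocalMaxOn (fun y => u y - μ⁻¹ * φ (y + -c)) Q (a + c) := by
    have hc : Tendsto (fun y => y + -c) (𝓝 (a + c)) (𝓝 a) := by
      have : Continuous fun y : Euc N × ℝ => y + -c := by fun_prop
      simpa using this.tendsto (a + c)
    refine IsLocalMax.on ?_ Q
    filter_upwards [hc.eventually hm] with y hy
    have e1 : a + c + -c = a := by abel
    have e2 : y + -c + c = y := by abel
    rw [e2] at hy
    rw [e1]
    have := mul_le_mul_of_nonneg_left hy (inv_pos.2 hμ).le
    rw [mul_sub, mul_sub, ← mul_assoc, ← mul_assoc, inv_mul_cancel₀ hμ.ne', one_mul, one_mul] at this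
    exact this
  have := hu _ hψ _ ha hlm
  rw [dT_const_mul _ hψ1.contDiffAt, dX_const_mul _ hψ1.contDiffAt, dL_const_mul _ hψ1.contDiffAt,
    dT_translate, dX_translate, dL_translate] at this
  have e1 : a + c + -c = a := by abel
  rw [e1] at this
  have h2 := mul_le_mul_of_nonneg_left this hμ.le
  have h3 : μ * (μ⁻¹ * dT φ a - μ⁻¹ * dL φ a + G (a + c) (μ⁻¹ • dX φ a)) =
    dT φ a - dL φ a + μ * G (a + c) (μ⁻¹ • dX φ a) := by
    field_simp
  rw [h3] at h2
  simpa using h2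

lemma usc_upper {S : Set (Euc N × ℝ)} {w : Euc N × ℝ → ℝ} (hw : UpperSemicontinuousOn w S)
    {z : Euc N × ℝ} (hz : z ∈ S) {ε : ℝ} (hε : 0 < ε) : ∃ r > 0, ∀ y ∈ S, dist y z < r → w y < w z + ε := by
  have := hw z hz (w z + ε) (by linarith)
  rw [eventually_nhdsWithin_iff] at this
  obtain ⟨r, hr, h⟩ := Metric.eventually_nhds_iff_ball.1 this
  exact ⟨r, hr, fun y hy hd => h y hd hy⟩

lemma usc_smul {S : Set (Euc N × ℝ)} {w : Euc N × ℝ → ℝ} (hw : UpperSemicontinuousOn w S) {μ : ℝ}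
    (hμ : 0 < μ) : UpperSemicontinuousOn (fun z => μ * w z) S := by
  intro z hz y hy
  have hy' : μ * w z < y := hy
  have := hw z hz (y / μ) (by show w z < y / μ; rw [lt_div_iff₀ hμ]; linarith)
  filter_upwards [this] with z' hz'
  rw [lt_div_iff₀ hμ] at hz'; linarith

set_option maxHeartbeats 1000000 in
lemma no_max (hN : 1 ≤ N) {Ω C : Set (Euc N)} (hΩ : IsOpen Ω) (hC : IsClosed C) (hsub : Ω ⊆ C) {f : Euc N → ℝ}
    (hf : ContinuousOn f C) {m lam μ Kc : ℝ} (hm : 0 < m) (hlam : 0 ≤ lam) (hμ : 0 < μ) (hμ1 : μ ≤ 1)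
    (hKc : 0 ≤ Kc)
    (hpow : ∀ p q : Euc N, ‖q‖ ^ m ≤ μ ^ (1 - m) * ‖p‖ ^ m + Kc * ‖p + q‖ ^ m)
    {u B : Euc N × ℝ → ℝ} {Dv : Set (Euc N × ℝ)}
    (huc : UpperSemicontinuousOn u (C ×ˢ Ioi 0)) (hBc : UpperSemicontinuousOn B (C ×ˢ Ioi 0))
    (hu : GSub (Ω ×ˢ Ioi 0) (Ω ×ˢ Ioi 0) (Gf 1 m lam f u) u)
    (hB : GSub (C ×ˢ Ioi 0) Dv (Gf (-1) m lam f B) B)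
    {χ : ℝ → ℝ} (hχ : ContDiff ℝ 2 χ) {z₀ : Euc N × ℝ} (hz₀ : z₀ ∈ C ×ˢ Ioi (0 : ℝ))
    (hmax : IsLocalMaxOn (fun z => μ * u z + B z - χ z.2) (C ×ˢ Ioi 0) z₀)
    (hpos : 0 < μ * u z₀ + B z₀) (hχ' : 0 < deriv χ z₀.2 + (1 - μ) * f z₀.1)
    {δ : ℝ} (hδ : 0 < δ) (hDv : ∀ z ∈ C ×ˢ Ioi (0 : ℝ), dist z z₀ < δ → |B z - B z₀| < δ → z ∈ Dv)
    (hshift : ∀ η > 0, ∃ e : Euc N, ‖e‖ < η ∧ z₀.1 + e ∈ C ∧ u z₀ - η < u (z₀ + (e, 0)) ∧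
      ∃ ρ₂ > 0, ∀ x y, dist x z₀.1 < δ → dist y z₀.1 < δ → y ∈ C → dist x y < ρ₂ → x + e ∈ Ω) :
    False := by
  have hmax' : ∀ᶠ z in 𝓝[C ×ˢ Ioi 0] z₀, μ * u z + B z - χ z.2 ≤ μ * u z₀ + B z₀ - χ z₀.2 := hmax
  rw [eventually_nhdsWithin_iff] at hmax'
  obtain ⟨r0, hr0, hmx⟩ := Metric.eventually_nhds_iff_ball.1 hmax'
  have ht0 : 0 < z₀.2 := hz₀.2
  set R := min (min (r0 / 2) (z₀.2 / 2)) (min δ 1) with hR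
  have hR0 : 0 < R := by positivity
  have hRr : R < r0 := lt_of_le_of_lt ((min_le_left _ _).trans (min_le_left _ _)) (by linarith)
  have hRt : R < z₀.2 := lt_of_le_of_lt ((min_le_left _ _).trans (min_le_right _ _)) (by linarith)
  have hRδ : R ≤ δ := (min_le_right _ _).trans (min_le_left _ _)
  have hR1 : R ≤ 1 := (min_le_right _ _).trans (min_le_right _ _)
  have htpos : ∀ z : Euc N × ℝ, dist z z₀ ≤ R → 0 < z.2 := by
    intro z hz
    have : dist z.2 z₀.2 ≤ R := le_trans (by rw [Prod.dist_eq]; exact le_max_right _ _) hz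
    rw [Real.dist_eq] at this
    have := (abs_le.1 this).1
    linarith
  have hd1 : ∀ z z' : Euc N × ℝ, dist z.1 z'.1 ≤ dist z z' := fun z z' => by
    rw [Prod.dist_eq]; exact le_max_left _ _
  set K : Set (Euc N × ℝ) := {z | z.1 ∈ C} ∩ closedBall z₀ R with hK
  have hCc : IsClosed {z : Euc N × ℝ | z.1 ∈ C} := hC.preimage continuous_fst
  have hKc' : IsCompact K := (isCompact_closedBall z₀ R).inter_left hCc
  have hKs : K ⊆ C ×ˢ Ioi 0 := fun z hz => ⟨hz.1, htpos z hz.2⟩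
  -- parameters
  set c0 := deriv χ z₀.2 + (1 - μ) * f z₀.1 with hc0
  set κ : ℝ := c0 / (8 * (N + 1)) with hκ
  have hκ0 : 0 < κ := by positivity
  have hκN : 2 * N * κ ≤ c0 / 4 := by
    have : κ * (8 * (N + 1)) = c0 := by rw [hκ]; field_simp
    nlinarith
  set Φ : Euc N × ℝ → ℝ := fun z => χ z.2 + qd κ z₀ z with hΦ
  have hχc : ContDiff ℝ 2 (fun z : Euc N × ℝ => χ z.2) := hχ.comp contDiff_snd
  have hΦc : ContDiff ℝ 2 Φ := hχc.add (qd_contDiff κ z₀)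
  have hE0T : dT Φ z₀ = deriv χ z₀.2 := by
    rw [hΦ, dT_add hχc.contDiffAt (qd_contDiff κ z₀).contDiffAt, dT_qd, dT_snd]; simp
  have hE0X : dX Φ z₀ = 0 := by
    rw [hΦ, dX_add hχc.contDiffAt (qd_contDiff κ z₀).contDiffAt, dX_qd, dX_snd]; simp
  have hE0L : dL Φ z₀ = 2 * N * κ := by
    rw [hΦ, dL_add hχc.contDiffAt (qd_contDiff κ z₀).contDiffAt, dL_qd, dL_snd]; simp
  set EE : Euc N × ℝ → ℝ := fun z => dT Φ z - dL Φ z - Kc * ‖dX Φ z‖ ^ m with hEE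
  have hEEc : Continuous EE := by
    have h1 : Continuous (fun p' : Euc N => ‖p'‖ ^ m) :=
      continuous_norm.rpow_const (fun _ => Or.inr hm.le)
    exact ((continuous_dT hΦc).sub (continuous_dL hΦc)).sub
      (continuous_const.mul (h1.comp (continuous_dX hΦc)))
  have hEE0 : EE z₀ = deriv χ z₀.2 - 2 * N * κ := by
    simp only [hEE, hE0T, hE0X, hE0L, norm_zero, Real.zero_rpow hm.ne']; ring
  set P := μ * u z₀ + B z₀ with hP
  have e1 : ∀ᶠ z in 𝓝 z₀, EE z₀ - c0 / 8 < EE z :=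
    hEEc.continuousAt.eventually (lt_mem_nhds (by linarith))
  have e2 : ∀ᶠ z in 𝓝 z₀, Φ z₀ - P / 4 < Φ z :=
    hΦc.continuous.continuousAt.eventually (lt_mem_nhds (by linarith))
  have e2' : ∀ᶠ z in 𝓝 z₀, Φ z₀ - δ / 8 < Φ z :=
    hΦc.continuous.continuousAt.eventually (lt_mem_nhds (by linarith))
  have e3 : ∀ᶠ x in 𝓝[C] z₀.1, |f x - f z₀.1| < c0 / 8 := by
    have : ContinuousWithinAt (fun x' => |f x' - f z₀.1|) C z₀.1 :=
      ((hf z₀.1 hz₀.1).sub continuousWithinAt_const).abs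
    refine this.eventually (gt_mem_nhds ?_); simp only; simp; positivity
  rw [eventually_nhdsWithin_iff] at e3
  obtain ⟨r1, hr1, h1⟩ := Metric.eventually_nhds_iff_ball.1 (e1.and (e2.and e2'))
  obtain ⟨r3, hr3, h3⟩ := Metric.eventually_nhds_iff_ball.1 e3
  obtain ⟨r4, hr4, h4⟩ := usc_upper huc hz₀ (show 0 < δ / 8 by positivity)
  obtain ⟨r5, hr5, h5⟩ := usc_upper hBc hz₀ (show 0 < δ / 2 by positivity)
  set ρ₁ := min (min r1 (r3 / 2)) (min (min (r4 / 2) r5) (R / 4)) with hρ₁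
  have hρ0 : 0 < ρ₁ := by positivity
  have hρa : ρ₁ ≤ r1 := (min_le_left _ _).trans (min_le_left _ _)
  have hρb : ρ₁ ≤ r3 / 2 := (min_le_left _ _).trans (min_le_right _ _)
  have hρc : ρ₁ ≤ r4 / 2 := (min_le_right _ _).trans ((min_le_left _ _).trans (min_le_left _ _))
  have hρd : ρ₁ ≤ r5 := (min_le_right _ _).trans ((min_le_left _ _).trans (min_le_right _ _))
  have hρe : ρ₁ ≤ R / 4 := (min_le_right _ _).trans (min_le_right _ _)
  set m0 := μ * u z₀ + B z₀ - Φ z₀ with hm0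
  have hΦ0 : Φ z₀ = χ z₀.2 := by simp [hΦ, qd_self]
  -- the nested lemma
  obtain ⟨η, hη, hnest⟩ := usc_nested (K := (K ×ˢ K) ∩ {q | ρ₁ ≤ dist q.1 z₀})
    ((hKc'.prod hKc').inter_right (isClosed_le continuous_const (by fun_prop)))
    (h := fun q => μ * u q.2 + (B q.1 + -Φ q.1)) (d := fun q => dist q.1 q.2) (M := m0)
    (by
      refine UpperSemicontinuousOn.add ?_ (UpperSemicontinuousOn.add ?_ ?_)
      · exact (usc_smul huc hμ).comp continuous_snd.continuousOn (fun q hq => hKs hq.1.2)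
      · exact hBc.comp continuous_fst.continuousOn (fun q hq => hKs hq.1.1)
      · exact (hΦc.continuous.neg.comp continuous_fst).upperSemicontinuous.upperSemicontinuousOn _)
    (by fun_prop) (fun _ => dist_nonneg)
    (by
      rintro ⟨z, z'⟩ ⟨⟨hz, hz'⟩, hzd⟩ hd
      simp only [mem_ofPred_eq] at hz hz' hzd hd
      obtain rfl := dist_eq_zero.1 hd
      have a1 := hmx z (lt_of_le_of_lt hz.2 hRr) (hKs hz)
      have a2 := qd_ge hκ0.le hρ0.le hzd
      have a3 : 0 < κ * ρ₁ ^ 2 := by positivity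
      have a4 : Φ z = χ z.2 + qd κ z₀ z := rfl
      simp only
      rw [hm0, hΦ0, a4]
      linarith)
  set η' := min (min η (R / 8)) (min (P / 8) (min (δ / 8) (min ρ₁ (δ / 4)))) with hη'
  have hη'0 : 0 < η' := by positivity
  have hη'1 : η' ≤ η := (min_le_left _ _).trans (min_le_left _ _)
  have hη'2 : η' ≤ R / 8 := (min_le_left _ _).trans (min_le_right _ _)
  have hη'3 : η' ≤ P / 8 := (min_le_right _ _).trans (min_le_left _ _)
  have hη'4 : η' ≤ δ / 8 := (min_le_right _ _).trans ((min_le_right _ _).trans (min_le_left _ _))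
  have hη'5 : η' ≤ ρ₁ := (min_le_right _ _).trans ((min_le_right _ _).trans ((min_le_right _ _).trans (min_le_left _ _)))
  obtain ⟨e, he, hez, heu, ρ₂, hρ₂, hcone⟩ := hshift η' hη'0
  set c : Euc N × ℝ := (e, 0) with hc
  have hcn : ∀ z : Euc N × ℝ, dist (z + c) z = ‖e‖ := by
    intro z; rw [dist_eq_norm, add_sub_cancel_left, hc, Prod.norm_def]; simp
  have hcdist : ∀ z : Euc N × ℝ, dist (z + c) z₀ ≤ ‖e‖ + dist z z₀ := by
    intro z; rw [← hcn z]; exact dist_triangle _ _ _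
  set A : Euc N × ℝ → ℝ := fun z => μ * u (z + c) with hA
  set KA : Set (Euc N × ℝ) := {z | z.1 + e ∈ C} ∩ closedBall z₀ (R / 2) with hKA
  set KB : Set (Euc N × ℝ) := {z | z.1 ∈ C} ∩ closedBall z₀ (R / 2) with hKB
  have hKAc : IsCompact KA := (isCompact_closedBall z₀ _).inter_left
    (hC.preimage (by fun_prop : Continuous fun z : Euc N × ℝ => z.1 + e))
  have hKBc : IsCompact KB := (isCompact_closedBall z₀ _).inter_left hCc
  have hKAK : ∀ z ∈ KA, z + c ∈ K := by
    intro z hz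
    refine ⟨hz.1, ?_⟩
    have : dist z z₀ ≤ R / 2 := hz.2
    have := hcdist z
    rw [mem_closedBall]; linarith
  have hKBK : KB ⊆ K := fun z hz => ⟨hz.1, closedBall_subset_closedBall (by linarith) hz.2⟩
  have hAu : UpperSemicontinuousOn A KA := by
    exact (usc_smul huc hμ).comp (g := fun z => z + c) (t := KA) (by fun_prop) (fun z hz => hKs (hKAK z hz))
  have hBu : UpperSemicontinuousOn B KB := hBc.mono (hKBK.trans hKs)
  have hz₀A : z₀ ∈ KA := ⟨hez, mem_closedBall_self (by linarith)⟩
  have hz₀B : z₀ ∈ KB := ⟨hz₀.1, mem_closedBall_self (by linarith)⟩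
  obtain ⟨k, hk, zh, a, b, hma, hmb, hlm, hzh, hda, hdb, hab, hM⟩ := doubling hKAc hKBc hAu hBu hΦc.continuous
    (ρ₁ := ρ₁) (ρ₂ := ρ₂) (M := m0 - η') (by linarith) hρ₂ hz₀A hz₀B
    (by
      have : μ * (u z₀ - η') ≤ A z₀ := mul_le_mul_of_nonneg_left heu.le hμ.le
      have : μ * η' ≤ η' := by nlinarith
      rw [hm0]; linarith)
    (by
      intro z hzA hzB hle
      by_contra hcon
      push Not at hcon
      have := hnest (z, z + c) ⟨⟨hKBK hzB, hKAK z hzA⟩, hcon⟩ (by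
        simp only; rw [dist_comm, hcn]; linarith)
      simp only at this
      simp only [hA] at hle
      linarith)
  -- properties of a, b
  have haΩ : a.1 + e ∈ Ω := hcone a.1 b.1 (lt_of_le_of_lt (hd1 a z₀) (by linarith))
    (lt_of_le_of_lt (hd1 b z₀) (by linarith)) hmb.1.1 (lt_of_le_of_lt (hd1 a b) hab)
  have hac := hcdist a
  have hAa : A a ≤ μ * u z₀ + δ / 8 := by
    have := h4 (a + c) (hKs (hKAK a hma.1)) (by linarith)
    have h6 : A a ≤ μ * (u z₀ + δ / 8) := mul_le_mul_of_nonneg_left this.le hμ.le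
    nlinarith
  obtain ⟨g1, g2, g2'⟩ := h1 zh (lt_of_lt_of_le hzh hρa)
  have hBb1 : B z₀ - δ / 2 < B b := by
    simp only [hm0] at hM; linarith
  have hBb2 : B b < B z₀ + δ / 2 := h5 b (hKs (hKBK hmb.1)) (by linarith)
  have hAB : 0 < A a + B b := by
    simp only [hm0] at hM; linarith
  -- LSub for A
  have hLA : LSub KA A (fun z p => μ ^ (1 - m) * ‖p‖ ^ m + lam * A z - μ * f (z.1 + e)) a := by
    refine lsub_of hm ?_ ?_
    · have : ContinuousOn (fun z : Euc N × ℝ => f (z.1 + e)) KA :=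
        hf.comp (by fun_prop) (fun z hz => hz.1)
      exact continuousWithinAt_const.mul (this a hma.1)
    · have hn : ∀ᶠ a' in 𝓝 a, a'.1 + e ∈ Ω ∧ a' ∈ ball z₀ (R / 2) := by
        refine (?_ : ∀ᶠ a' in 𝓝 a, a'.1 + e ∈ Ω).and (isOpen_ball.mem_nhds (by rw [mem_ball]; linarith))
        exact (hΩ.preimage (by fun_prop : Continuous fun z : Euc N × ℝ => z.1 + e)).mem_nhds haΩ
      obtain ⟨ρ, hρ, hρ'⟩ := Metric.eventually_nhds_iff_ball.1 hn
      refine ⟨ρ, hρ, fun a' ha' hda' _ φ hφ hlmA => ?_⟩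
      obtain ⟨w1, w2⟩ := hρ' a' hda'
      have w3 : 0 < a'.2 := htpos a' (by rw [mem_ball] at w2; linarith)
      have hnear1 : ∀ᶠ y in 𝓝 a', y.1 + e ∈ Ω :=
        (hΩ.preimage (by fun_prop : Continuous fun z : Euc N × ℝ => z.1 + e)).mem_nhds w1
      have hnear2 : ∀ᶠ y in 𝓝 a', y ∈ ball z₀ (R / 2) := isOpen_ball.mem_nhds w2
      · have hl : IsLocalMax (fun y => A y - φ y) a' := by
          refine hlmA.isLocalMax ?_
          filter_upwards [hnear1, hnear2] with y hy1 hy2 using ⟨hsub hy1, ball_subset_closedBall hy2⟩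
        have := shift_scale hu hμ c (a := a') ⟨w1, by simpa [hc] using w3⟩ hφ hl
        unfold Gf at this
        rw [norm_smul, Real.norm_of_nonneg (inv_pos.2 hμ).le,
          Real.mul_rpow (inv_pos.2 hμ).le (norm_nonneg _), Real.inv_rpow hμ.le] at this
        rw [Real.rpow_sub hμ, Real.rpow_one]
        simp only [hA]
        have e5 : (a' + c).1 = a'.1 + e := rfl
        rw [e5] at this
        calc _ = _ := by ring
          _ ≤ 0 := this
  have hLB : LSub KB B (fun z p => (-1) * ‖p‖ ^ m + lam * B z - (- f z.1)) b := by
    refine lsub_of hm ?_ ?_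
    · have : ContinuousOn (fun z : Euc N × ℝ => f z.1) KB :=
        hf.comp (by fun_prop) (fun z hz => hz.1)
      exact (this b hmb.1).neg
    · refine ⟨min (δ / 2) (R / 4), by positivity, fun b' hb' hd hBB φ hφ hl => ?_⟩
      simp only [lt_min_iff] at hd hBB
      have htr := dist_triangle b' b z₀
      have hb'D : b' ∈ Dv := by
        refine hDv b' (hKs (hKBK hb')) (by linarith) ?_
        have := abs_lt.1 hBB.1
        rw [abs_lt]; constructor <;> linarith
      have := hB φ hφ b' hb'D (hl.filter_mono (nhdsWithin_le_iff.2 ?_))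
      · unfold Gf at this; linarith
      · have : ball z₀ (R / 2) ∈ 𝓝 b' := isOpen_ball.mem_nhds (by rw [mem_ball]; linarith)
        filter_upwards [self_mem_nhdsWithin, nhdsWithin_le_nhds this] with y y1 y2
        exact ⟨y1.1, ball_subset_closedBall y2⟩
  obtain ⟨p, q, hpq, hfin⟩ := theorem_on_sums hN hk hKAc hKBc hAu hBu hΦc hma hmb hlm hLA hLB
  have k1 := hpow p q
  rw [hpq] at k1
  have k2 := h3 b.1 (lt_of_le_of_lt (hd1 b z₀) (by linarith)) hmb.1.1
  have k3 := h3 (a.1 + e) (lt_of_le_of_lt (hd1 (a + c) z₀) (by linarith)) hma.1.1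
  have k4 := mul_nonneg hlam hAB.le
  rw [abs_lt] at k2 k3
  rw [hEE0] at g1
  simp only [hEE] at g1
  have k5 : μ * f (a.1 + e) ≤ μ * (f z₀.1 + c0 / 8) := mul_le_mul_of_nonneg_left (by linarith) hμ.le
  have k6 : μ * (c0 / 8) ≤ c0 / 8 := by nlinarith
  linarith

end VS

namespace VS

variable {N : ℕ}

/-! ### the comparison principle -/

lemma pow_ineq {m μ : ℝ} (hm : 0 < m) (hμ : 0 < μ) (h : (m ≤ 1 ∧ μ = 1) ∨ (1 < m ∧ μ < 1)) :
    ∃ Kc : ℝ, 0 ≤ Kc ∧ ∀ p q : Euc N, ‖q‖ ^ m ≤ μ ^ (1 - m) * ‖p‖ ^ m + Kc * ‖p + q‖ ^ m := by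
  have htri : ∀ p q : Euc N, ‖q‖ ≤ ‖p‖ + ‖p + q‖ := fun p q => by
    have : q = (p + q) - p := by abel
    calc ‖q‖ = ‖(p + q) - p‖ := by rw [← this]
      _ ≤ ‖p + q‖ + ‖p‖ := norm_sub_le _ _
      _ = _ := by ring
  rcases h with ⟨h1, rfl⟩ | ⟨h1, h2⟩
  · refine ⟨1, zero_le_one, fun p q => ?_⟩
    rw [Real.one_rpow, one_mul, one_mul]
    exact (Real.rpow_le_rpow (norm_nonneg _) (htri p q) hm.le).trans
      (Real.rpow_add_le_add_rpow (norm_nonneg _) (norm_nonneg _) hm.le h1)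
  · set k := μ ^ ((1 - m) / m) with hk
    have hk1 : 1 < k := Real.one_lt_rpow_of_pos_of_lt_one_of_neg hμ h2 (div_neg_of_neg_of_pos (by linarith) hm)
    have hkm : k ^ m = μ ^ (1 - m) := by
      rw [hk, ← Real.rpow_mul hμ.le, div_mul_cancel₀ _ hm.ne']
    have hk0 : 0 < k - 1 := by linarith
    refine ⟨((k - 1)⁻¹ + 1) ^ m, by positivity, fun p q => ?_⟩
    have h3 := htri p q
    rcases le_total ‖p + q‖ ((k - 1) * ‖p‖) with h4 | h4
    · have h5 : ‖q‖ ≤ k * ‖p‖ := by nlinarith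
      have h6 := Real.rpow_le_rpow (norm_nonneg _) h5 hm.le
      rw [Real.mul_rpow (by linarith) (norm_nonneg _), hkm] at h6
      have : 0 ≤ ((k - 1)⁻¹ + 1) ^ m * ‖p + q‖ ^ m := by positivity
      linarith
    · have h5 : ‖q‖ ≤ ((k - 1)⁻¹ + 1) * ‖p + q‖ := by
        have : ‖p‖ ≤ (k - 1)⁻¹ * ‖p + q‖ := by
          rw [inv_mul_eq_div, le_div_iff₀ hk0]; linarith
        linarith
      have h6 := Real.rpow_le_rpow (norm_nonneg _) h5 hm.le
      rw [Real.mul_rpow (by positivity) (norm_nonneg _)] at h6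
      have : 0 ≤ μ ^ (1 - m) * ‖p‖ ^ m := by positivity
      linarith

lemma cone {Ω : Set (Euc N)} {ρ : Euc N → ℝ} (hρ : ContDiff ℝ 2 ρ) (hΩ : Ω = {x | ρ x < 0})
    {x₀ : Euc N} (hx₀ : gradient ρ x₀ ≠ 0) :
    ∃ r > 0, ∃ c > 0, ∀ ε > 0, ε < r → ∀ x y, dist x x₀ < r → dist y x₀ < r → y ∈ closure Ω →
      dist x y < c * ε → x + ε • (- gradient ρ x₀) ∈ Ω := by
  set n := - gradient ρ x₀ with hn
  have hn0 : 0 < ‖n‖ := by rw [hn, norm_neg]; exact norm_pos_iff.2 hx₀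
  have hcl : ∀ y ∈ closure Ω, ρ y ≤ 0 := by
    have : closure Ω ⊆ {x | ρ x ≤ 0} :=
      closure_minimal (by rw [hΩ]; intro x hx; have h : ρ x < 0 := hx; exact h.le) (isClosed_le hρ.continuous continuous_const)
    exact this
  have hd := hρ.contDiffAt.hasStrictFDerivAt (x := x₀) (by norm_num)
  have hlit := hd.isLittleO.def (show 0 < ‖n‖ / 4 by positivity)
  rw [Metric.eventually_nhds_iff_ball] at hlit
  obtain ⟨r, hr, h⟩ := hlit
  have hfn : ‖fderiv ℝ ρ x₀‖ = ‖n‖ := by rw [hn, norm_neg, norm_grad]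
  have hfnn : fderiv ℝ ρ x₀ n = - ‖n‖ ^ 2 := by
    have : ∀ v, fderiv ℝ ρ x₀ v = inner ℝ (gradient ρ x₀) v := fun v => by
      rw [gradient, InnerProductSpace.toDual_symm_apply]
    rw [this, hn, inner_neg_right, norm_neg, real_inner_self_eq_norm_sq]
  refine ⟨min (r / 2) (r / (2 * (‖n‖ + 1))), by positivity, ‖n‖ / 4, by positivity, ?_⟩
  intro ε hε hεr x y hx hy hyC hxy
  have hx' : dist x x₀ < r / 2 := lt_of_lt_of_le hx (min_le_left _ _)
  have hy' : dist y x₀ < r / 2 := lt_of_lt_of_le hy (min_le_left _ _)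
  have hε' : ε < r / (2 * (‖n‖ + 1)) := lt_of_lt_of_le hεr (min_le_right _ _)
  rw [lt_div_iff₀ (by positivity)] at hε'
  have hxe : dist (x + ε • n) x₀ < r := by
    calc dist (x + ε • n) x₀ ≤ dist (x + ε • n) x + dist x x₀ := dist_triangle _ _ _
      _ = ε * ‖n‖ + dist x x₀ := by rw [dist_eq_norm, add_sub_cancel_left, norm_smul, Real.norm_of_nonneg hε.le]
      _ < r := by nlinarith
  have h1 := h (x + ε • n, y) (by
    rw [mem_ball, Prod.dist_eq]; exact max_lt hxe (by linarith))
  simp only at h1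
  have h2 : x + ε • n - y = (x - y) + ε • n := by abel
  rw [h2] at h1
  have h3 : ‖(x - y) + ε • n‖ ≤ ‖n‖ / 4 * ε + ε * ‖n‖ := by
    refine (norm_add_le _ _).trans ?_
    rw [norm_smul, Real.norm_of_nonneg hε.le, ← dist_eq_norm]
    linarith
  have h4 : fderiv ℝ ρ x₀ ((x - y) + ε • n) ≤ ‖n‖ * (‖n‖ / 4 * ε) - ε * ‖n‖ ^ 2 := by
    rw [map_add, map_smul, hfnn, smul_eq_mul]
    have h5 := (le_abs_self _).trans ((fderiv ℝ ρ x₀).le_opNorm (x - y))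
    rw [hfn, ← dist_eq_norm] at h5
    have h6 := mul_le_mul_of_nonneg_left hxy.le hn0.le
    linarith
  have h5 := (le_abs_self _).trans h1
  have h6 := mul_le_mul_of_nonneg_left h3 (show 0 ≤ ‖n‖ / 4 by positivity)
  have h7 := hcl y hyC
  rw [hΩ]
  show ρ (x + ε • n) < 0
  have h8 : 0 < ε * ‖n‖ ^ 2 := by positivity
  nlinarith

lemma lsc_neg {S : Set (Euc N × ℝ)} {v : Euc N × ℝ → ℝ} (hv : LowerSemicontinuousOn v S) :
    UpperSemicontinuousOn (fun z => - v z) S := by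
  intro z hz y hy
  have := hv z hz (-y) (by have : -v z < y := hy; show -y < v z; linarith)
  filter_upwards [this] with z' hz'
  linarith

set_option maxHeartbeats 1000000 in
theorem comparison (hN : 1 ≤ N) {Ω : Set (Euc N)} (hΩo : IsOpen Ω) (hΩb : Bornology.IsBounded Ω)
    {ρ : Euc N → ℝ} (hρ : ContDiff ℝ 2 ρ) (hΩρ : Ω = {x | ρ x < 0})
    (hgr : ∀ x ∈ frontier Ω, gradient ρ x ≠ 0) {m lam : ℝ} (hm : 0 < m) (hlam : 0 ≤ lam) {f g : Euc N → ℝ}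
    (hf : ContinuousOn f (closure Ω)) (hg : ContinuousOn g (frontier Ω))
    {u v : Euc N × ℝ → ℝ} (huc : UpperSemicontinuousOn u (closure Ω ×ˢ Ici 0))
    (hvc : LowerSemicontinuousOn v (closure Ω ×ˢ Ici 0))
    (hu : GSub (Ω ×ˢ Ioi 0) (Ω ×ˢ Ioi 0) (Gf 1 m lam f u) u)
    (hug : ∀ z ∈ frontier Ω ×ˢ Ioi (0 : ℝ), u z ≤ g z.1)
    (hv : GSub (closure Ω ×ˢ Ioi 0) {z | z ∈ closure Ω ×ˢ Ioi (0 : ℝ) ∧ (z.1 ∈ Ω ∨ v z < g z.1)}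
      (Gf (-1) m lam f (fun z => - v z)) (fun z => - v z))
    (h0 : ∀ x ∈ closure Ω, u (x, 0) ≤ v (x, 0))
    (hc : ∀ z ∈ frontier Ω ×ˢ Ioi (0 : ℝ), u z ≤ v z ∨ ∀ η > (0 : ℝ), ∃ ε₀ > (0 : ℝ), ∀ ε > (0 : ℝ), ε < ε₀ →
      u z - η < u (z.1 + ε • (- gradient ρ z.1), z.2)) :
    ∀ z ∈ closure Ω ×ˢ Ici (0 : ℝ), u z ≤ v z := by
  by_contra hcon
  push Not at hcon
  obtain ⟨z₁, hz₁, hlt⟩ := hcon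
  set σ := (u z₁ - v z₁) / 4 with hσ
  have hσ0 : 0 < σ := by linarith
  set T := z₁.2 + 1 with hT
  have ht₁ : 0 ≤ z₁.2 := hz₁.2
  set K : Set (Euc N × ℝ) := closure Ω ×ˢ Icc 0 T with hK
  have hΩcomp : IsCompact (closure Ω) := hΩb.isCompact_closure
  have hKc : IsCompact K := hΩcomp.prod isCompact_Icc
  have hKs : K ⊆ closure Ω ×ˢ Ici 0 := prod_mono le_rfl (fun t ht => ht.1)
  have hz₁K : z₁ ∈ K := ⟨hz₁.1, ht₁, by linarith⟩
  have hne : K.Nonempty := ⟨_, hz₁K⟩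
  obtain ⟨zu, hzu, hU⟩ := (huc.mono hKs).exists_isMaxOn hne hKc
  obtain ⟨zv, hzv, hL⟩ := ((lsc_neg hvc).mono hKs).exists_isMaxOn hne hKc
  set U := |u zu| with hUd
  set L := |v zv| with hLd
  have hUle : ∀ z ∈ K, u z ≤ U := fun z hz => (hU hz).trans (le_abs_self _)
  have hLle : ∀ z ∈ K, -L ≤ v z := fun z hz => by
    have h1 : - v z ≤ - v zv := hL hz
    have := neg_abs_le (v zv)
    linarith
  obtain ⟨F, hF⟩ := hΩcomp.exists_bound_of_continuousOn hf
  have hF0 : 0 ≤ F := (norm_nonneg _).trans (hF z₁.1 hz₁.1)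
  have hU0 : 0 ≤ U := abs_nonneg _
  have hL0 : 0 ≤ L := abs_nonneg _
  -- the function χ
  set Big := U + L + 1 with hBig
  set k := Big / σ with hk
  have hk0 : 0 < k := by positivity
  set c := σ * Real.exp (-(k * z₁.2)) with hc_def
  have hc0 : 0 < c := by positivity
  set χ : ℝ → ℝ := fun t => c * Real.exp (k * t) with hχ
  have hχc : ContDiff ℝ 2 χ := by rw [hχ]; fun_prop
  have hχd : ∀ t, deriv χ t = c * (Real.exp (k * t) * k) := by
    intro t
    have h1 : HasDerivAt (fun t : ℝ => k * t) k t := by simpa using (hasDerivAt_id t).const_mul k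
    exact (h1.exp.const_mul c).deriv
  have hχ0 : ∀ t, 0 < χ t := fun t => by simp only [hχ]; positivity
  have hχ1 : χ z₁.2 = σ := by
    simp only [hχ, hc_def]; rw [mul_assoc, ← Real.exp_add]; simp
  have hχT : Big ≤ χ T := by
    have e1 : χ T = σ * Real.exp k := by
      simp only [hχ, hc_def, hT]; rw [mul_assoc, ← Real.exp_add]; ring_nf
    rw [e1]
    have e2 := Real.add_one_le_exp k
    have e3 : σ * k = Big := by rw [hk]; field_simp
    nlinarith
  have hχ' : ∀ t, 0 ≤ t → c * k ≤ deriv χ t := by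
    intro t ht
    rw [hχd]
    have : 1 ≤ Real.exp (k * t) := Real.one_le_exp (by positivity)
    have h2 : 1 * k ≤ Real.exp (k * t) * k := mul_le_mul_of_nonneg_right this hk0.le
    have := mul_le_mul_of_nonneg_left h2 hc0.le
    linarith
  -- the choice of μ
  obtain ⟨μ, hμ, hμ1, hμm, hμa, hμb, hμF⟩ : ∃ μ : ℝ, 1 / 2 ≤ μ ∧ μ ≤ 1 ∧
      ((m ≤ 1 ∧ μ = 1) ∨ (1 < m ∧ μ < 1)) ∧ (1 - μ) * |u z₁| ≤ σ ∧ (1 - μ) * (2 * L) < 2 * σ ∧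
      (1 - μ) * F < c * k := by
    rcases le_or_gt m 1 with h | h
    · refine ⟨1, by norm_num, le_rfl, Or.inl ⟨h, rfl⟩, ?_, ?_, ?_⟩ <;> simp <;> positivity
    · set ν := min (1 / 2) (min (σ / (|u z₁| + 1)) (min (σ / (2 * L + 1)) (c * k / (F + 1)))) with hν
      have hν0 : 0 < ν := by positivity
      have n1 : ν ≤ 1 / 2 := min_le_left _ _
      have n2 : ν ≤ σ / (|u z₁| + 1) := (min_le_right _ _).trans (min_le_left _ _)
      have n3 : ν ≤ σ / (2 * L + 1) := (min_le_right _ _).trans ((min_le_right _ _).trans (min_le_left _ _))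
      have n4 : ν ≤ c * k / (F + 1) := (min_le_right _ _).trans ((min_le_right _ _).trans (min_le_right _ _))
      rw [le_div_iff₀ (by positivity)] at n2 n3 n4
      have e : 1 - (1 - ν) = ν := by ring
      refine ⟨1 - ν, by linarith, by linarith, Or.inr ⟨h, by linarith⟩, ?_, ?_, ?_⟩ <;> rw [e] <;> nlinarith
  have hμ0 : 0 < μ := by linarith
  have hμu : UpperSemicontinuousOn (fun z => μ * u z + (-v z + -χ z.2)) K := by
    refine ((usc_smul huc hμ0).mono hKs).add (((lsc_neg hvc).mono hKs).add ?_)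
    exact (hχc.continuous.neg.comp continuous_snd).upperSemicontinuous.upperSemicontinuousOn _
  obtain ⟨z₀, hz₀, hmax⟩ := hμu.exists_isMaxOn hne hKc
  have hv1 : 2 * σ ≤ μ * u z₀ - v z₀ - χ z₀.2 := by
    have h1 : μ * u z₁ + (-v z₁ + -χ z₁.2) ≤ μ * u z₀ + (-v z₀ + -χ z₀.2) := hmax hz₁K
    have h2 : (1 - μ) * u z₁ ≤ (1 - μ) * |u z₁| := mul_le_mul_of_nonneg_left (le_abs_self _) (by linarith)
    rw [hχ1] at h1
    linarith
  have hχz := hχ0 z₀.2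
  have hvL := hLle z₀ hz₀
  -- v < u at z₀
  have hvu : v z₀ < u z₀ := by
    have h1 : -(2 * L) ≤ u z₀ := by
      by_contra hh
      push Not at hh
      nlinarith
    have h2 := mul_le_mul_of_nonneg_left h1 (show 0 ≤ 1 - μ by linarith)
    linarith
  have ht0 : 0 < z₀.2 := by
    rcases hz₀.2.1.lt_or_eq with h | h
    · exact h
    · exfalso
      have h1 := h0 z₀.1 hz₀.1
      have h2 : z₀ = (z₀.1, 0) := by ext1 <;> simp [← h]
      rw [← h2] at h1
      linarith
  have htT : z₀.2 < T := by
    rcases hz₀.2.2.lt_or_eq with h | h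
    · exact h
    · exfalso
      rw [h] at hv1
      have h1 := hUle z₀ hz₀
      have h2 : μ * u z₀ ≤ U := by nlinarith
      linarith
  have hz₀S : z₀ ∈ closure Ω ×ˢ Ioi (0 : ℝ) := ⟨hz₀.1, ht0⟩
  have hS : closure Ω ×ˢ Ioi (0 : ℝ) ⊆ closure Ω ×ˢ Ici 0 := prod_mono le_rfl Ioi_subset_Ici_self
  have hloc : IsLocalMaxOn (fun z => μ * u z + (fun z => - v z) z - χ z.2) (closure Ω ×ˢ Ioi 0) z₀ := by
    have h1 : ∀ᶠ z : Euc N × ℝ in 𝓝[closure Ω ×ˢ Ioi 0] z₀, z.2 < T :=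
      nhdsWithin_le_nhds (continuous_snd.continuousAt.eventually (gt_mem_nhds htT))
    filter_upwards [h1, self_mem_nhdsWithin] with z hz hzS
    have h2 : μ * u z + (-v z + -χ z.2) ≤ μ * u z₀ + (-v z₀ + -χ z₀.2) :=
      hmax ⟨hzS.1, le_of_lt hzS.2, hz.le⟩
    linarith
  obtain ⟨Kc, hKc0, hpow⟩ := pow_ineq (N := N) hm hμ0 hμm
  have hf1 : 0 < deriv χ z₀.2 + (1 - μ) * f z₀.1 := by
    have h1 := hχ' z₀.2 ht0.le
    have h2 := hF z₀.1 hz₀.1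
    rw [Real.norm_eq_abs] at h2
    have h3 := (abs_le.1 h2).1
    have h4 := mul_le_mul_of_nonneg_left h3 (show 0 ≤ 1 - μ by linarith)
    linarith
  by_cases hx : z₀.1 ∈ Ω
  · obtain ⟨r, hr, hball⟩ := Metric.isOpen_iff.1 hΩo z₀.1 hx
    have hd1 : ∀ z z' : Euc N × ℝ, dist z.1 z'.1 ≤ dist z z' := fun z z' => by
      rw [Prod.dist_eq]; exact le_max_left _ _
    refine no_max hN hΩo isClosed_closure subset_closure hf hm hlam hμ0 hμ1 hKc0 hpow (huc.mono hS)
      ((lsc_neg hvc).mono hS) hu hv hχc hz₀S hloc (by linarith) hf1 hr ?_ ?_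
    · intro z hz hzd _
      exact ⟨hz, Or.inl (hball (lt_of_le_of_lt (hd1 z z₀) hzd))⟩
    · intro η hη
      refine ⟨0, by simpa using hη, by simpa using hz₀.1, ?_, 1, one_pos, ?_⟩
      · have : z₀ + ((0 : Euc N), (0 : ℝ)) = z₀ := by ext1 <;> simp
        rw [this]; linarith
      · intro x y hx _ _ _
        simpa using hball hx
  · have hfr : z₀.1 ∈ frontier Ω := ⟨hz₀.1, by rwa [hΩo.interior_eq]⟩
    have hfrz : z₀ ∈ frontier Ω ×ˢ Ioi (0 : ℝ) := ⟨hfr, ht0⟩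
    have hcont := (hc z₀ hfrz).resolve_left (by linarith)
    have hvg : v z₀ < g z₀.1 := lt_of_lt_of_le hvu (hug z₀ hfrz)
    set d := g z₀.1 - v z₀ with hd
    have hgc : ∀ᶠ x in 𝓝[frontier Ω] z₀.1, g z₀.1 - d / 2 < g x :=
      (hg z₀.1 hfr).eventually (lt_mem_nhds (by linarith))
    rw [eventually_nhdsWithin_iff] at hgc
    obtain ⟨rg, hrg, hgc⟩ := Metric.eventually_nhds_iff_ball.1 hgc
    obtain ⟨r, hr, c', hc', hcone⟩ := cone hρ hΩρ (hgr z₀.1 hfr)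
    set n := - gradient ρ z₀.1 with hn
    have hd1 : ∀ z z' : Euc N × ℝ, dist z.1 z'.1 ≤ dist z z' := fun z z' => by
      rw [Prod.dist_eq]; exact le_max_left _ _
    refine no_max hN hΩo isClosed_closure subset_closure hf hm hlam hμ0 hμ1 hKc0 hpow (huc.mono hS)
      ((lsc_neg hvc).mono hS) hu hv hχc hz₀S hloc (by linarith) hf1
      (δ := min (min rg (d / 2)) r) (by have : 0 < d := by linarith
                                        positivity) ?_ ?_
    · intro z hz hzd hB
      simp only [lt_min_iff] at hzd hB
      refine ⟨hz, ?_⟩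
      by_cases hzΩ : z.1 ∈ Ω
      · exact Or.inl hzΩ
      · right
        have h1 := hgc z.1 (lt_of_le_of_lt (hd1 z z₀) hzd.1.1) ⟨hz.1, by rwa [hΩo.interior_eq]⟩
        have h2 := (abs_lt.1 hB.1.2).1
        linarith
    · intro η hη
      obtain ⟨r', hr', hev⟩ := hcont η hη
      set ε := min (r / 2) (min (η / (2 * (‖n‖ + 1))) (r' / 2)) with hε
      have hε0 : 0 < ε := by positivity
      have hε1 : ε < r := lt_of_le_of_lt (min_le_left _ _) (by linarith)
      have hε2 : ε ≤ η / (2 * (‖n‖ + 1)) := (min_le_right _ _).trans (min_le_left _ _)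
      have hε3 : ε ≤ r' / 2 := (min_le_right _ _).trans (min_le_right _ _)
      have hn0 := norm_nonneg n
      rw [le_div_iff₀ (by positivity)] at hε2
      have hnorm : ‖ε • n‖ = ε * ‖n‖ := by rw [norm_smul, Real.norm_of_nonneg hε0.le]
      have hin : z₀.1 + ε • n ∈ Ω := hcone ε hε0 hε1 z₀.1 z₀.1 (by simpa using hr) (by simpa using hr)
        hz₀.1 (by simp; positivity)
      refine ⟨ε • n, by rw [hnorm]; nlinarith, subset_closure hin, ?_, c' * ε, by positivity, ?_⟩
      · have : z₀ + (ε • n, (0 : ℝ)) = (z₀.1 + ε • n, z₀.2) := by ext1 <;> simp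
        rw [this]
        exact hev ε hε0 (by linarith)
      · intro x y hx hy hyC hxy
        exact hcone ε hε0 hε1 x y (lt_of_lt_of_le hx (min_le_right _ _)) (lt_of_lt_of_le hy (min_le_right _ _)) hyC hxy

end VS

namespace VS

variable {N : ℕ}

lemma rho_nonpos {Ω : Set (Euc N)} {ρ : Euc N → ℝ} (hρ : ContDiff ℝ 2 ρ) (hΩ : Ω = {x | ρ x < 0}) :
    ∀ x ∈ closure Ω, ρ x ≤ 0 := by
  have : closure Ω ⊆ {x | ρ x ≤ 0} :=
    closure_minimal (by rw [hΩ]; intro x hx; have h : ρ x < 0 := hx; exact h.le)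
      (isClosed_le hρ.continuous continuous_const)
  exact this

/-- bounds near the boundary -/
lemma near_bdry {Ω : Set (Euc N)} (hΩo : IsOpen Ω) (hΩb : Bornology.IsBounded Ω) {ρ : Euc N → ℝ}
    (hρ : ContDiff ℝ 2 ρ) (hΩ : Ω = {x | ρ x < 0}) (hgr : ∀ x ∈ frontier Ω, gradient ρ x ≠ 0) :
    ∃ δ > 0, ∃ m₀ > 0, ∃ C > 0, ∀ x ∈ closure Ω,
      |lapl ρ x| ≤ C ∧ ‖gradient ρ x‖ ≤ C ∧ (- ρ x ≤ δ → m₀ ≤ ‖gradient ρ x‖ ^ 2) := by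
  have hK : IsCompact (closure Ω) := hΩb.isCompact_closure
  have hc1 := continuous_grad hρ
  have hc2 := continuous_lapl hρ
  obtain ⟨C1, h1⟩ := hK.exists_bound_of_continuousOn hc2.continuousOn
  obtain ⟨C2, h2⟩ := hK.exists_bound_of_continuousOn hc1.continuousOn
  obtain ⟨η, hη, H⟩ := usc_nested hK (h := fun x => - ‖gradient ρ x‖ ^ 2) (d := fun x => |ρ x|)
    (M := 0) (by
      have : Continuous (fun x => - ‖gradient ρ x‖ ^ 2) := by fun_prop
      exact this.upperSemicontinuous.upperSemicontinuousOn _)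
    hρ.continuous.abs (fun x => abs_nonneg _) (by
      intro q hq h0
      have h0' : ρ q = 0 := abs_eq_zero.1 h0
      have : q ∈ frontier Ω := ⟨hq, by
        rw [hΩo.interior_eq, hΩ]; intro h; have h : ρ q < 0 := h; linarith⟩
      have := norm_pos_iff.2 (hgr q this)
      have : 0 < ‖gradient ρ q‖ ^ 2 := by positivity
      linarith)
  refine ⟨η, hη, η, hη, max 1 (max C1 C2), by positivity, fun x hx => ⟨?_, ?_, fun hd => ?_⟩⟩
  · exact (h1 x hx).trans (by simp)
  · exact (h2 x hx).trans (by simp)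
  · have := H x hx (by rw [abs_of_nonpos (rho_nonpos hρ hΩ x hx)]; exact hd)
    linarith

/-- the quadratic barrier -/
noncomputable def qb (M δ : ℝ) (s : ℝ) : ℝ := M * (-s - s ^ 2 / (2 * δ))

lemma qb_cd (M δ : ℝ) : ContDiff ℝ 2 (qb M δ) := by unfold qb; fun_prop

lemma qb_deriv (M δ : ℝ) : deriv (qb M δ) = fun s => M * (-1 - s / δ) := by
  funext s
  have := (((hasDerivAt_id s).neg).sub (((hasDerivAt_id s).pow 2).div_const (2 * δ))).const_mul M
  have h2 : deriv (qb M δ) s = _ := HasDerivAt.deriv this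
  rw [h2]; simp; left; ring

lemma qb_deriv2 (M δ : ℝ) : deriv (deriv (qb M δ)) = fun _ => - M / δ := by
  rw [qb_deriv]
  funext s
  have := (((hasDerivAt_id s).div_const δ).const_sub (-1)).const_mul M
  have h2 : deriv (fun s => M * (-1 - s / δ)) s = _ := HasDerivAt.deriv this
  rw [h2]; ring

lemma lapl_qb {ρ : Euc N → ℝ} (hρ : ContDiff ℝ 2 ρ) (M δ : ℝ) (x : Euc N) :
    lapl (fun y => qb M δ (ρ y)) x = - M / δ * ‖gradient ρ x‖ ^ 2 + M * (-1 - ρ x / δ) * lapl ρ x := by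
  rw [lapl_comp hρ.contDiffAt (qb_cd M δ).contDiffAt, qb_deriv2, qb_deriv]

lemma lapl_qb_le {ρ : Euc N → ℝ} (hρ : ContDiff ℝ 2 ρ) {M δ m₀ C : ℝ} (hM : 0 ≤ M) (hδ : 0 < δ) {x : Euc N}
    (h1 : |lapl ρ x| ≤ C) (h2 : m₀ ≤ ‖gradient ρ x‖ ^ 2) (h3 : ρ x ≤ 0) (h4 : - ρ x ≤ δ) :
    lapl (fun y => qb M δ (ρ y)) x ≤ - (M * (m₀ / δ - C)) := by
  rw [lapl_qb hρ]
  have a1 : M / δ * m₀ ≤ M / δ * ‖gradient ρ x‖ ^ 2 := by gcongr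
  have a2 : |(-1 - ρ x / δ) * lapl ρ x| ≤ 1 * C := by
    rw [abs_mul]
    gcongr
    rw [abs_le]
    have : -1 ≤ ρ x / δ := by rw [le_div_iff₀ hδ]; linarith
    have : ρ x / δ ≤ 0 := div_nonpos_of_nonpos_of_nonneg h3 hδ.le
    constructor <;> linarith
  have a3 := mul_le_mul_of_nonneg_left (abs_le.1 a2).2 hM
  have e1 : -M / δ * ‖gradient ρ x‖ ^ 2 = - (M / δ * ‖gradient ρ x‖ ^ 2) := by ring
  have e2 : M / δ * m₀ = M * (m₀ / δ) := by ring
  rw [e1]; nlinarith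

lemma qb_nonneg {M δ s : ℝ} (hM : 0 ≤ M) (hδ : 0 < δ) (h1 : s ≤ 0) (h2 : - s ≤ δ) : M * (-s) / 2 ≤ qb M δ s := by
  unfold qb
  have : s ^ 2 / (2 * δ) ≤ -s / 2 := by
    rw [div_le_div_iff₀ (by positivity) (by positivity)]
    nlinarith
  nlinarith

set_option maxHeartbeats 1000000 in
/-- Boundary lemma: continuous generalized subsolutions lie below the boundary data. -/
lemma bdry_le {Ω : Set (Euc N)} (hΩo : IsOpen Ω) (hΩb : Bornology.IsBounded Ω) {ρ : Euc N → ℝ}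
    (hρ : ContDiff ℝ 2 ρ) (hΩ : Ω = {x | ρ x < 0}) (hgr : ∀ x ∈ frontier Ω, gradient ρ x ≠ 0)
    (hfr : frontier Ω = {x | ρ x = 0})
    {m lam : ℝ} {f g : Euc N → ℝ} (hlam : 0 ≤ lam)
    (hf : ContinuousOn f (closure Ω)) (hg : ContinuousOn g (frontier Ω))
    {u : Euc N × ℝ → ℝ} (huc : ContinuousOn u (closure Ω ×ˢ Ici 0))
    (hu : GSub (closure Ω ×ˢ Ioi 0) {z | z ∈ closure Ω ×ˢ Ioi (0 : ℝ) ∧ (z.1 ∈ Ω ∨ g z.1 < u z)}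
      (Gf 1 m lam f u) u) :
    ∀ z ∈ frontier Ω ×ˢ Ioi (0 : ℝ), u z ≤ g z.1 := by
  intro z₀ hz₀
  by_contra hcon
  push Not at hcon
  have ht0 : 0 < z₀.2 := hz₀.2
  have hzc : z₀ ∈ closure Ω ×ˢ Ici (0 : ℝ) := ⟨hz₀.1.1, ht0.le⟩
  have hρ0 : ρ z₀.1 = 0 := by
    have := hz₀.1; rw [hfr] at this; exact this
  obtain ⟨δ₀, hδ₀, m₀, hm₀, C, hC, hnb⟩ := near_bdry hΩo hΩb hρ hΩ hgr
  obtain ⟨Cf, hCf⟩ := hΩb.isCompact_closure.exists_bound_of_continuousOn hf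
  set e := (u z₀ - g z₀.1) / 3 with he
  have he0 : 0 < e := by linarith
  -- continuity radii
  have c1 : ∀ᶠ z in 𝓝[closure Ω ×ˢ Ici 0] z₀, |u z - u z₀| < min e 1 := by
    have : ContinuousWithinAt (fun z => |u z - u z₀|) (closure Ω ×ˢ Ici 0) z₀ :=
      ((huc z₀ hzc).sub continuousWithinAt_const).abs
    refine this.eventually (gt_mem_nhds ?_); simp only; simp; exact he0
  have c2 : ∀ᶠ x in 𝓝[frontier Ω] z₀.1, |g x - g z₀.1| < e := by
    have : ContinuousWithinAt (fun x => |g x - g z₀.1|) (frontier Ω) z₀.1 :=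
      ((hg z₀.1 hz₀.1).sub continuousWithinAt_const).abs
    refine this.eventually (gt_mem_nhds ?_); simp only; simp; exact he0
  rw [eventually_nhdsWithin_iff] at c1 c2
  obtain ⟨r1, hr1, c1⟩ := Metric.eventually_nhds_iff_ball.1 c1
  obtain ⟨r2, hr2, c2⟩ := Metric.eventually_nhds_iff_ball.1 c2
  set r := min (min r1 r2) (min z₀.2 1) / 2 with hr
  have hr0 : 0 < r := by positivity
  have hr1' : r < r1 := by
    have : min (min r1 r2) (min z₀.2 1) ≤ r1 := (min_le_left _ _).trans (min_le_left _ _)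
    linarith
  have hr2' : r < r2 := by
    have : min (min r1 r2) (min z₀.2 1) ≤ r2 := (min_le_left _ _).trans (min_le_right _ _)
    linarith
  have hr3 : r < z₀.2 := by
    have : min (min r1 r2) (min z₀.2 1) ≤ z₀.2 := (min_le_right _ _).trans (min_le_left _ _)
    linarith
  have hr4 : r < 1 := by
    have : min (min r1 r2) (min z₀.2 1) ≤ 1 := (min_le_right _ _).trans (min_le_right _ _)
    linarith
  set B := 2 / r ^ 2 with hB
  have hB0 : 0 < B := by positivity
  set δ := min δ₀ (m₀ / (2 * C)) with hδ
  have hδ0 : 0 < δ := by positivity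
  have hδC : 2 * C ≤ m₀ / δ := by
    rw [le_div_iff₀ hδ0]
    have : δ ≤ m₀ / (2 * C) := min_le_right _ _
    rw [le_div_iff₀ (by positivity)] at this; linarith
  set A := 2 * B + 2 * N * B + lam * (|u z₀| + 1) + Cf + 1 with hA
  set M := max (4 / δ) (|A| / C) with hM
  have hM0 : 0 < M := lt_of_lt_of_le (by positivity) (le_max_left _ _)
  have hMδ : 4 ≤ M * δ := by rw [← div_le_iff₀ hδ0]; exact le_max_left _ _
  have hMA : A ≤ M * C := (le_abs_self A).trans (by rw [← div_le_iff₀ hC]; exact le_max_right _ _)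
  set φ : Euc N × ℝ → ℝ := fun z => qb M δ (ρ z.1) + qd B z₀ z with hφ
  have hqc : ContDiff ℝ 2 (fun z : Euc N × ℝ => qb M δ (ρ z.1)) :=
    (qb_cd M δ).comp (hρ.comp contDiff_fst)
  have hφc : ContDiff ℝ 2 φ := hqc.add (qd_contDiff B z₀)
  set K : Set (Euc N × ℝ) := (closure Ω ×ˢ Icc 0 (z₀.2 + 1)) ∩ (closedBall z₀ r ∩ {z | - ρ z.1 ≤ δ}) with hK
  have hKc : IsCompact K := by
    refine (hΩb.isCompact_closure.prod isCompact_Icc).inter_right (isClosed_closedBall.inter ?_)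
    exact isClosed_le (hρ.continuous.comp continuous_fst).neg continuous_const
  have hz₀K : z₀ ∈ K := ⟨⟨hz₀.1.1, ht0.le, by linarith⟩, mem_closedBall_self hr0.le, by
    show - ρ z₀.1 ≤ δ; rw [hρ0]; simpa using hδ0.le⟩
  have hKS : K ⊆ closure Ω ×ˢ Ici 0 := fun z hz => ⟨hz.1.1, hz.1.2.1⟩
  obtain ⟨z, hzK, hmax⟩ := hKc.exists_isMaxOn ⟨z₀, hz₀K⟩
    (f := fun z => u z - φ z) ((huc.mono hKS).sub hφc.continuous.continuousOn)
  have hφ0 : φ z₀ = 0 := by simp [hφ, qd_self, hρ0, qb]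
  have h1 : u z₀ - φ z₀ ≤ u z - φ z := hmax hz₀K
  have hzd : dist z z₀ ≤ r := hzK.2.1
  have hzδ : - ρ z.1 ≤ δ := hzK.2.2
  have hρz : ρ z.1 ≤ 0 := rho_nonpos hρ hΩ _ hzK.1.1
  have h2 := c1 z (lt_of_le_of_lt hzd hr1') (hKS hzK)
  rw [lt_min_iff] at h2
  have h2a := abs_lt.1 h2.1
  have h2b := abs_lt.1 h2.2
  have h3 : φ z < 1 := by rw [hφ0] at h1; linarith
  have h4 : M * (- ρ z.1) / 2 ≤ qb M δ (ρ z.1) := qb_nonneg hM0.le hδ0 hρz hzδ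
  have h5 := qd_nonneg hB0.le z₀ z
  have h6 : φ z = qb M δ (ρ z.1) + qd B z₀ z := rfl
  have h7 : 0 ≤ M * (- ρ z.1) := mul_nonneg hM0.le (by linarith)
  have hzd' : dist z z₀ < r := by
    by_contra hcc
    push Not at hcc
    have := qd_ge hB0.le hr0.le hcc
    have e2 : B * r ^ 2 = 2 := by rw [hB]; field_simp
    linarith
  have hzδ' : - ρ z.1 < δ := by
    by_contra hcc
    push Not at hcc
    have := mul_le_mul_of_nonneg_left hcc hM0.le
    linarith
  have hzt : |z.2 - z₀.2| < r := by
    have : dist z.2 z₀.2 ≤ dist z z₀ := by rw [Prod.dist_eq]; exact le_max_right _ _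
    rw [Real.dist_eq] at this; linarith
  have hzt' := abs_lt.1 hzt
  have hzx : dist z.1 z₀.1 ≤ dist z z₀ := by rw [Prod.dist_eq]; exact le_max_left _ _
  have hzS : z ∈ closure Ω ×ˢ Ioi (0 : ℝ) := ⟨hzK.1.1, by show 0 < z.2; linarith⟩
  have hloc : IsLocalMaxOn (fun y => u y - φ y) (closure Ω ×ˢ Ioi 0) z := by
    have e1 : ∀ᶠ y in 𝓝[closure Ω ×ˢ Ioi 0] z, y ∈ ball z₀ r :=
      nhdsWithin_le_nhds (isOpen_ball.mem_nhds hzd')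
    have e2 : ∀ᶠ y : Euc N × ℝ in 𝓝[closure Ω ×ˢ Ioi 0] z, - ρ y.1 < δ :=
      nhdsWithin_le_nhds ((hρ.continuous.comp continuous_fst).neg.continuousAt.eventually (gt_mem_nhds hzδ'))
    filter_upwards [e1, e2, self_mem_nhdsWithin] with y y1 y2 y3
    refine hmax ⟨⟨y3.1, le_of_lt y3.2, ?_⟩, ball_subset_closedBall y1, y2.le⟩
    have : dist y.2 z₀.2 ≤ dist y z₀ := by rw [Prod.dist_eq]; exact le_max_right _ _
    have y1' : dist y z₀ < r := y1
    rw [Real.dist_eq] at this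
    have := (abs_lt.1 (lt_of_le_of_lt this y1')).2
    linarith
  have hD : z.1 ∈ Ω ∨ g z.1 < u z := by
    by_cases hzΩ : z.1 ∈ Ω
    · exact Or.inl hzΩ
    · right
      have := c2 z.1 (by rw [mem_ball]; linarith) ⟨hzK.1.1, by rwa [hΩo.interior_eq]⟩
      have := (abs_lt.1 this).2
      linarith
  have key := hu φ hφc z ⟨hzS, hD⟩ hloc
  obtain ⟨n1, n2, n3⟩ := hnb z.1 hzK.1.1
  have k1 : lapl (fun y => qb M δ (ρ y)) z.1 ≤ - (M * (m₀ / δ - C)) :=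
    lapl_qb_le hρ hM0.le hδ0 n1 (n3 (hzδ.trans (min_le_left _ _))) hρz hzδ
  have k2 : dL φ z = lapl (fun y => qb M δ (ρ y)) z.1 + 2 * N * B := by
    rw [hφ, dL_add hqc.contDiffAt (qd_contDiff B z₀).contDiffAt, dL_qd]; rfl
  have k3 : dT φ z = 2 * B * (z.2 - z₀.2) := by
    rw [hφ, dT_add hqc.contDiffAt (qd_contDiff B z₀).contDiffAt, dT_qd, dT_fst (fun x => qb M δ (ρ x)), zero_add]
  have k4 : M * C ≤ M * (m₀ / δ - C) := mul_le_mul_of_nonneg_left (by linarith) hM0.le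
  have k5 : 0 ≤ ‖dX φ z‖ ^ m := by positivity
  have k6 := hCf z.1 hzK.1.1
  rw [Real.norm_eq_abs] at k6
  have k6 := (abs_le.1 k6).2
  have k7 : - (lam * (|u z₀| + 1)) ≤ lam * u z := by
    have : -(|u z₀| + 1) ≤ u z := by
      have := neg_abs_le (u z₀); linarith
    have := mul_le_mul_of_nonneg_left this hlam
    linarith
  have k8 : -(2 * B) ≤ 2 * B * (z.2 - z₀.2) := by
    have := mul_le_mul_of_nonneg_left (show -1 ≤ z.2 - z₀.2 by linarith) (show 0 ≤ 2 * B by positivity)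
    linarith
  unfold Gf at key
  rw [k2, k3] at key
  linarith


lemma cube_cd (T : ℝ) : ContDiff ℝ 2 (fun t : ℝ => (max (t - T) 0) ^ 3) := by
  have h0 : ∀ t : ℝ, HasDerivAt (fun t : ℝ => (max (t - T) 0) ^ 3) (3 * (max (t - T) 0) ^ 2) t := by
    intro t
    rcases lt_trichotomy t T with h | h | h
    · have : (fun t : ℝ => (max (t - T) 0) ^ 3) =ᶠ[𝓝 t] fun _ => 0 := by
        filter_upwards [gt_mem_nhds h] with s hs
        rw [max_eq_right (by linarith)]; norm_num
      rw [max_eq_right (by linarith)]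
      simpa using (hasDerivAt_const t (0 : ℝ)).congr_of_eventuallyEq this
    · subst h
      rw [hasDerivAt_iff_isLittleO_nhds_zero]
      simp only [add_sub_cancel_left, sub_self, max_self]
      have : (fun h : ℝ => h ^ 3) =o[𝓝 0] fun h : ℝ => h := by
        simpa using Asymptotics.isLittleO_pow_pow (𝕜 := ℝ) (show 1 < 3 by norm_num)
      refine (Asymptotics.IsBigO.trans_isLittleO ?_ this)
      refine Asymptotics.IsBigO.of_bound 1 (Eventually.of_forall fun h => ?_)
      simp only [ne_eq, OfNat.ofNat_ne_zero, not_false_eq_true, zero_pow, mul_zero, smul_eq_mul, sub_zero, norm_pow, one_mul]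
      gcongr
      rw [Real.norm_eq_abs, Real.norm_eq_abs, abs_of_nonneg (le_max_right _ _)]
      exact max_le (le_abs_self h) (abs_nonneg h)
    · have : (fun t : ℝ => (max (t - T) 0) ^ 3) =ᶠ[𝓝 t] fun t => (t - T) ^ 3 := by
        filter_upwards [lt_mem_nhds h] with s hs
        rw [max_eq_left (by linarith)]
      rw [max_eq_left (by linarith)]
      have h2 := ((hasDerivAt_id' t).sub_const T).fun_pow 3
      refine HasDerivAt.congr_of_eventuallyEq ?_ this
      simpa using h2
  have h1 : ∀ t : ℝ, HasDerivAt (fun t : ℝ => 3 * (max (t - T) 0) ^ 2) (6 * (max (t - T) 0)) t := by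
    intro t
    rcases lt_trichotomy t T with h | h | h
    · have : (fun t : ℝ => 3 * (max (t - T) 0) ^ 2) =ᶠ[𝓝 t] fun _ => 0 := by
        filter_upwards [gt_mem_nhds h] with s hs
        rw [max_eq_right (by linarith)]; norm_num
      rw [max_eq_right (by linarith)]
      simpa using (hasDerivAt_const t (0 : ℝ)).congr_of_eventuallyEq this
    · subst h
      rw [hasDerivAt_iff_isLittleO_nhds_zero]
      simp only [add_sub_cancel_left, sub_self, max_self]
      have : (fun h : ℝ => h ^ 2) =o[𝓝 0] fun h : ℝ => h := by
        simpa using Asymptotics.isLittleO_pow_pow (𝕜 := ℝ) (show 1 < 2 by norm_num)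
      refine (Asymptotics.IsBigO.trans_isLittleO ?_ this)
      refine Asymptotics.IsBigO.of_bound 3 (Eventually.of_forall fun h => ?_)
      have : ‖max h 0‖ ≤ ‖h‖ := by
        rw [Real.norm_eq_abs, Real.norm_eq_abs, abs_of_nonneg (le_max_right _ _)]
        exact max_le (le_abs_self h) (abs_nonneg h)
      have h4 : ‖max h 0‖ ^ 2 ≤ ‖h‖ ^ 2 := by gcongr
      simp only [ne_eq, OfNat.ofNat_ne_zero, not_false_eq_true, zero_pow, mul_zero, smul_eq_mul, sub_zero,
        norm_mul, norm_pow, Real.norm_ofNat]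
      linarith
    · have : (fun t : ℝ => 3 * (max (t - T) 0) ^ 2) =ᶠ[𝓝 t] fun t => 3 * (t - T) ^ 2 := by
        filter_upwards [lt_mem_nhds h] with s hs
        rw [max_eq_left (by linarith)]
      rw [max_eq_left (by linarith)]
      have h2 := (((hasDerivAt_id' t).sub_const T).fun_pow 2).const_mul 3
      refine HasDerivAt.congr_of_eventuallyEq ?_ this
      have e3 : 6 * (t - T) = 3 * (((2 : ℕ) : ℝ) * (t - T) ^ (2 - 1) * 1) := by norm_num; ring
      rw [e3]; exact h2
  have e1 : deriv (fun t : ℝ => (max (t - T) 0) ^ 3) = fun t => 3 * (max (t - T) 0) ^ 2 :=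
    funext fun t => (h0 t).deriv
  have e2 : deriv (fun t : ℝ => 3 * (max (t - T) 0) ^ 2) = fun t => 6 * (max (t - T) 0) :=
    funext fun t => (h1 t).deriv
  rw [show (2 : WithTop ℕ∞) = 1 + 1 by norm_num, contDiff_succ_iff_deriv]
  refine ⟨fun t => (h0 t).differentiableAt, by simp, ?_⟩
  rw [e1, contDiff_one_iff_deriv, e2]
  exact ⟨fun t => (h1 t).differentiableAt, by fun_prop⟩

lemma cube_deriv_nonneg (T t : ℝ) : 0 ≤ deriv (fun t : ℝ => (max (t - T) 0) ^ 3) t := by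
  apply Monotone.deriv_nonneg
  intro a b hab
  show (max (a - T) 0) ^ 3 ≤ (max (b - T) 0) ^ 3
  gcongr

set_option maxHeartbeats 1000000 in
/-- Tests at a terminal time. -/
lemma terminal {S D : Set (Euc N × ℝ)} {C : Set (Euc N)} {z₀ : Euc N × ℝ} {R : ℝ} (hR : 0 < R)
    (hS : IsCompact (S ∩ closedBall z₀ R)) (hz₀ : z₀ ∈ S) (hSC : ∀ z ∈ S, z.1 ∈ C) {f : Euc N → ℝ}
    (hf : ContinuousWithinAt f C z₀.1) {m : ℝ} (hm0 : 0 < m) {σ lam : ℝ} (hlam : 0 ≤ lam)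
    {φ w : Euc N × ℝ → ℝ} (hφ : ContDiff ℝ 2 φ) (hw : UpperSemicontinuousOn w S)
    (hsub : GSub S D (Gf σ m lam f w) w) {δ : ℝ} (hδ : 0 < δ)
    (hD : ∀ y ∈ S, dist y z₀ < δ → w z₀ - δ < w y → y ∈ D)
    (hm : IsLocalMaxOn (fun y => w y - φ y) (S ∩ {z | z.2 ≤ z₀.2}) z₀) :
    dT φ z₀ - dL φ z₀ + Gf σ m lam f w z₀ (dX φ z₀) ≤ 0 := by
  classical
  set wl : Euc N × ℝ → ℝ := fun y => if y.2 ≤ z₀.2 then w y else φ y + (w z₀ - φ z₀) with hwl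
  have hwl0 : wl z₀ = w z₀ := by simp [hwl]
  have hml : IsLocalMaxOn (fun y => wl y - φ y) S z₀ := by
    have h1 : ∀ᶠ y in 𝓝[S ∩ {z | z.2 ≤ z₀.2}] z₀, w y - φ y ≤ w z₀ - φ z₀ := hm
    rw [eventually_nhdsWithin_iff] at h1
    refine eventually_nhdsWithin_iff.2 ?_
    filter_upwards [h1] with y hy hyS
    rw [hwl0]
    by_cases hc : y.2 ≤ z₀.2
    · have := hy ⟨hyS, hc⟩
      simp only [hwl, if_pos hc]; exact this
    · simp only [hwl, if_neg hc]; linarith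
  have hm' : ∀ᶠ y in 𝓝[S ∩ {z | z.2 ≤ z₀.2}] z₀, w y - φ y ≤ w z₀ - φ z₀ := hm
  rw [eventually_nhdsWithin_iff] at hm'
  obtain ⟨r1, hr1, hb⟩ := Metric.eventually_nhds_iff_ball.1 hm'
  set R1 := min R (r1 / 2) with hR1
  have hR10 : 0 < R1 := by positivity
  have hS1 : IsCompact (S ∩ closedBall z₀ R1) := by
    have : S ∩ closedBall z₀ R1 = (S ∩ closedBall z₀ R) ∩ closedBall z₀ R1 := by
      rw [inter_assoc, inter_eq_right.2 (closedBall_subset_closedBall (min_le_left _ _))]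
    rw [this]; exact hS.inter_right isClosed_closedBall
  have := stab (w := wl) (σ := σ) (lam := lam) hR10 hS1 hSC hf hm0 hφ hml hδ ?_
  · unfold Gf at this ⊢
    rw [hwl0] at this
    exact this
  intro R' hR' hRR η hη
  have hKc : IsCompact (S ∩ closedBall z₀ R') := by
    have : S ∩ closedBall z₀ R' = (S ∩ closedBall z₀ R1) ∩ closedBall z₀ R' := by
      rw [inter_assoc, inter_eq_right.2 (closedBall_subset_closedBall hRR)]
    rw [this]; exact hS1.inter_right isClosed_closedBall
  have hwK : UpperSemicontinuousOn w (S ∩ closedBall z₀ R') := hw.mono inter_subset_left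
  have hh : UpperSemicontinuousOn (fun y => w y + - φ y) (S ∩ closedBall z₀ R') :=
    hwK.add (hφ.continuous.neg.upperSemicontinuous.upperSemicontinuousOn _)
  have hz₀K : z₀ ∈ S ∩ closedBall z₀ R' := ⟨hz₀, mem_closedBall_self hR'.le⟩
  have hdc : Continuous (fun y : Euc N × ℝ => max (y.2 - z₀.2) 0) := by fun_prop
  obtain ⟨η', hη', hnest⟩ := usc_nested hKc hh hdc (fun x => le_max_right _ _)
    (M := w z₀ - φ z₀ + η) (by
      intro q hq hq0
      have hq1 : q.2 ≤ z₀.2 := by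
        have := le_max_left (q.2 - z₀.2) 0
        rw [hq0] at this; linarith
      have h2 : dist q z₀ ≤ R' := hq.2
      have h3 : R1 ≤ r1 / 2 := min_le_right _ _
      have := hb q (by rw [mem_ball]; linarith) ⟨hq.1, hq1⟩
      linarith)
  obtain ⟨ym, hymK, hym⟩ := hh.exists_isMaxOn ⟨z₀, hz₀K⟩ hKc
  set X := w ym + - φ ym with hX
  set n := |X - (w z₀ - φ z₀)| / η' ^ 3 with hn
  have hn0 : 0 ≤ n := by positivity
  set cu : Euc N × ℝ → ℝ := fun y => n * (max (y.2 - z₀.2) 0) ^ 3 with hcu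
  have hcu0 : ∀ y, 0 ≤ cu y := fun y => mul_nonneg hn0 (pow_nonneg (le_max_right _ _) 3)
  have hcb : ContDiff ℝ 2 (fun t : ℝ => n * (max (t - z₀.2) 0) ^ 3) := contDiff_const.mul (cube_cd z₀.2)
  have hcuc : ContDiff ℝ 2 cu := hcb.comp contDiff_snd
  refine ⟨fun y => w y + - cu y, D,
    hwK.add (hcuc.continuous.neg.upperSemicontinuous.upperSemicontinuousOn _), ?_, ⟨z₀, hz₀, by simpa using hη, ?_⟩, ?_, ?_⟩
  · intro y hy
    by_cases hc : y.2 ≤ z₀.2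
    · simp only [hwl, if_pos hc]
      have := hcu0 y
      linarith
    · simp only [hwl, if_neg hc]
      push Not at hc
      by_cases hc2 : max (y.2 - z₀.2) 0 ≤ η'
      · have := hnest y hy hc2
        have := hcu0 y
        linarith
      · push Not at hc2
        have h1 : w y + - φ y ≤ X := hym hy
        have h2 : n * η' ^ 3 ≤ cu y := by simp only [hcu]; gcongr
        have h3 : n * η' ^ 3 = |X - (w z₀ - φ z₀)| := by rw [hn]; field_simp
        have := le_abs_self (X - (w z₀ - φ z₀))
        linarith
  · rw [hwl0]; simp [hcu]; exact hη
  · intro y hy hyd hyw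
    refine hD y hy hyd ?_
    rw [hwl0] at hyw
    have := (abs_lt.1 hyw).1
    have := hcu0 y
    linarith
  · intro ψ hψ y hy hloc
    have h1 := hsub (fun y => ψ y + cu y) (hψ.add hcuc) y hy (by
      filter_upwards [hloc] with y' hy'
      linarith)
    rw [dT_add hψ.contDiffAt hcuc.contDiffAt, dX_add hψ.contDiffAt hcuc.contDiffAt,
      dL_add hψ.contDiffAt hcuc.contDiffAt] at h1
    have h2 : dX cu y = 0 := dX_snd (fun t : ℝ => n * (max (t - z₀.2) 0) ^ 3)
    have h3 : dL cu y = 0 := dL_snd (fun t : ℝ => n * (max (t - z₀.2) 0) ^ 3)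
    have h4 : 0 ≤ dT cu y := by
      have : dT cu y = deriv (fun t : ℝ => n * (max (t - z₀.2) 0) ^ 3) y.2 :=
        dT_snd (fun t : ℝ => n * (max (t - z₀.2) 0) ^ 3)
      rw [this, deriv_const_mul n ((cube_cd z₀.2).differentiable (by norm_num) _)]
      exact mul_nonneg hn0 (cube_deriv_nonneg _ _)
    rw [h2, h3, add_zero, add_zero] at h1
    unfold Gf at h1 ⊢
    show dT ψ y - dL ψ y + (σ * ‖dX ψ y‖ ^ m + lam * (w y + - cu y) - σ * f y.1) ≤ 0
    have h5 : lam * (w y + - cu y) ≤ lam * w y :=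
      mul_le_mul_of_nonneg_left (by have := hcu0 y; linarith) hlam
    linarith

end VS

namespace VS

variable {N : ℕ}

/-- `us` is the upper semicontinuous envelope of `u` (from `Q`) on `closure Q` -/
def IsUEnv (Q : Set (Euc N × ℝ)) (u us : Euc N × ℝ → ℝ) : Prop :=
  ∀ z ∈ closure Q, (∀ η > 0, ∃ r > 0, ∀ y ∈ Q, dist y z < r → u y < us z + η) ∧
    (∀ η > 0, ∃ y ∈ Q, dist y z < η ∧ us z - η < u y)

lemma exists_env {Q : Set (Euc N × ℝ)} {u A B : Euc N × ℝ → ℝ} (hA : ContinuousOn A (closure Q))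
    (hB : ContinuousOn B (closure Q)) (h1 : ∀ z ∈ Q, B z ≤ u z) (h2 : ∀ z ∈ Q, u z ≤ A z) :
    ∃ us, IsUEnv Q u us := by
  have : ∀ z : Euc N × ℝ, ∃ c : ℝ, z ∈ closure Q → (∀ η > 0, ∃ r > 0, ∀ y ∈ Q, dist y z < r → u y < c + η) ∧
    (∀ η > 0, ∃ y ∈ Q, dist y z < η ∧ c - η < u y) := by
    intro z
    by_cases hz : z ∈ closure Q
    swap
    · exact ⟨0, fun h => absurd h hz⟩
    set P : Set ℝ := {M | ∃ r > 0, ∀ y ∈ Q, dist y z < r → u y ≤ M} with hP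
    have hne : P.Nonempty := by
      have := (hA z hz).eventually (gt_mem_nhds (show A z < A z + 1 by linarith))
      rw [eventually_nhdsWithin_iff] at this
      obtain ⟨r, hr, hb⟩ := Metric.eventually_nhds_iff_ball.1 this
      exact ⟨A z + 1, r, hr, fun y hy hd => (h2 y hy).trans (hb y hd (subset_closure hy)).le⟩
    have hbd : BddBelow P := by
      have := (hB z hz).eventually (lt_mem_nhds (show B z - 1 < B z by linarith))
      rw [eventually_nhdsWithin_iff] at this
      obtain ⟨r, hr, hb⟩ := Metric.eventually_nhds_iff_ball.1 this
      refine ⟨B z - 1, ?_⟩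
      rintro M ⟨r', hr', hM⟩
      obtain ⟨y, hy, hd⟩ := Metric.mem_closure_iff.1 hz (min r r') (lt_min hr hr')
      rw [dist_comm] at hd
      have a1 := hb y (lt_of_lt_of_le hd (min_le_left _ _)) (subset_closure hy)
      have a2 := hM y hy (lt_of_lt_of_le hd (min_le_right _ _))
      have a3 := h1 y hy
      linarith
    refine ⟨sInf P, fun _ => ⟨fun η hη => ?_, fun η hη => ?_⟩⟩
    · obtain ⟨M, ⟨r, hr, hM⟩, hlt⟩ := exists_lt_of_csInf_lt hne (show sInf P < sInf P + η by linarith)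
      exact ⟨r, hr, fun y hy hd => lt_of_le_of_lt (hM y hy hd) hlt⟩
    · by_contra hcon
      push Not at hcon
      have : sInf P - η ∈ P := ⟨η, hη, hcon⟩
      have := csInf_le hbd this
      linarith
  choose us hus using this
  exact ⟨us, hus⟩

lemma IsUEnv.usc {Q : Set (Euc N × ℝ)} {u us : Euc N × ℝ → ℝ} (h : IsUEnv Q u us) :
    UpperSemicontinuousOn us (closure Q) := by
  intro z hz M hM
  have hM : us z < M := hM
  obtain ⟨r, hr, h1⟩ := (h z hz).1 ((M - us z) / 2) (by linarith)
  refine eventually_nhdsWithin_iff.2 ?_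
  filter_upwards [ball_mem_nhds z (show 0 < r / 2 by positivity)] with y hy hyQ
  have hy : dist y z < r / 2 := hy
  show us y < M
  by_contra hcon
  push Not at hcon
  obtain ⟨y', hy', hd, hu⟩ := (h y hyQ).2 (min (r / 2) ((M - us z) / 2)) (by
    have : 0 < M - us z := by linarith
    positivity)
  have a1 := h1 y' hy' (by
    have := dist_triangle y' y z
    have := lt_of_lt_of_le hd (min_le_left _ _)
    linarith)
  have := min_le_right (r / 2) ((M - us z) / 2)
  linarith

lemma IsUEnv.le {Q : Set (Euc N × ℝ)} {u us : Euc N × ℝ → ℝ} (h : IsUEnv Q u us) {z : Euc N × ℝ} (hz : z ∈ Q) :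
    u z ≤ us z := by
  by_contra hcon
  push Not at hcon
  obtain ⟨r, hr, h1⟩ := (h z (subset_closure hz)).1 (u z - us z) (by linarith)
  have := h1 z hz (by simpa using hr)
  linarith

lemma IsUEnv.le_cont {Q : Set (Euc N × ℝ)} {u us A : Euc N × ℝ → ℝ} (h : IsUEnv Q u us)
    (hA : ContinuousOn A (closure Q)) (h2 : ∀ z ∈ Q, u z ≤ A z) {z : Euc N × ℝ} (hz : z ∈ closure Q) :
    us z ≤ A z := by
  by_contra hcon
  push Not at hcon
  have := (hA z hz).eventually (gt_mem_nhds (show A z < A z + (us z - A z) / 2 by linarith))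
  rw [eventually_nhdsWithin_iff] at this
  obtain ⟨r, hr, hb⟩ := Metric.eventually_nhds_iff_ball.1 this
  obtain ⟨y, hy, hd, hu⟩ := (h z hz).2 (min r ((us z - A z) / 2)) (by
    have : 0 < us z - A z := by linarith
    positivity)
  have a1 := hb y (lt_of_lt_of_le hd (min_le_left _ _)) (subset_closure hy)
  have a2 := h2 y hy
  have := min_le_right r ((us z - A z) / 2)
  linarith

lemma IsUEnv.ge_cont {Q : Set (Euc N × ℝ)} {u us B : Euc N × ℝ → ℝ} (h : IsUEnv Q u us)
    (hB : ContinuousOn B (closure Q)) (h2 : ∀ z ∈ Q, B z ≤ u z) {z : Euc N × ℝ} (hz : z ∈ closure Q) :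
    B z ≤ us z := by
  by_contra hcon
  push Not at hcon
  have := (hB z hz).eventually (lt_mem_nhds (show B z - (B z - us z) / 2 < B z by linarith))
  rw [eventually_nhdsWithin_iff] at this
  obtain ⟨r, hr, hb⟩ := Metric.eventually_nhds_iff_ball.1 this
  obtain ⟨r', hr', h1⟩ := (h z hz).1 ((B z - us z) / 2) (by linarith)
  obtain ⟨y, hy, hd⟩ := Metric.mem_closure_iff.1 hz (min r r') (lt_min hr hr')
  rw [dist_comm] at hd
  have a1 := hb y (lt_of_lt_of_le hd (min_le_left _ _)) (subset_closure hy)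
  have a2 := h1 y hy (lt_of_lt_of_le hd (min_le_right _ _))
  have a3 := h2 y hy
  linarith

/-- subsolution property is pointwise and passes to functions touched from below -/
lemma gsub_glue {S D : Set (Euc N × ℝ)} {σ m lam : ℝ} {f : Euc N → ℝ} {w : Euc N × ℝ → ℝ}
    (h : ∀ z ∈ D, ∃ (w₂ : Euc N × ℝ → ℝ) (D₂ : Set (Euc N × ℝ)), z ∈ D₂ ∧ GSub S D₂ (Gf σ m lam f w₂) w₂ ∧
      w₂ z = w z ∧ ∀ᶠ y in 𝓝[S] z, w₂ y ≤ w y) : GSub S D (Gf σ m lam f w) w := by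
  intro φ hφ z hz hm
  obtain ⟨w₂, D₂, h1, h2, h3, h4⟩ := h z hz
  have := h2 φ hφ z h1 (by
    filter_upwards [hm, h4] with y hy1 hy2
    rw [h3]; linarith)
  unfold Gf at this ⊢
  rwa [h3] at this

lemma gsub_classical {S : Set (Euc N × ℝ)} {σ m lam : ℝ} {f : Euc N → ℝ} {b : Euc N × ℝ → ℝ} {z : Euc N × ℝ}
    (hS : S ∈ 𝓝 z) (hb : ContDiffAt ℝ 2 b z)
    (h : dT b z - dL b z + (σ * ‖dX b z‖ ^ m + lam * b z - σ * f z.1) ≤ 0) :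
    GSub S {z} (Gf σ m lam f b) b := by
  rintro φ hφ z' rfl hm
  obtain ⟨h1, h2, h3⟩ := classical_sub hS hb hφ.contDiffAt hm
  unfold Gf
  rw [← h1, ← h2]
  linarith

lemma open_compact {S : Set (Euc N × ℝ)} (hS : IsOpen S) {z : Euc N × ℝ} (hz : z ∈ S) :
    ∃ R > 0, IsCompact (S ∩ closedBall z R) := by
  obtain ⟨r, hr, hb⟩ := Metric.isOpen_iff.1 hS z hz
  refine ⟨r / 2, by positivity, ?_⟩
  have : S ∩ closedBall z (r / 2) = closedBall z (r / 2) :=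
    inter_eq_right.2 ((closedBall_subset_ball (by linarith)).trans hb)
  rw [this]; exact isCompact_closedBall _ _

lemma half_compact {C : Set (Euc N)} (hC : IsClosed C) {z : Euc N × ℝ} (hz : 0 < z.2) :
    ∃ R > 0, IsCompact ((C ×ˢ Ioi (0 : ℝ)) ∩ closedBall z R) := by
  refine ⟨z.2 / 2, by positivity, ?_⟩
  have : (C ×ˢ Ioi (0 : ℝ)) ∩ closedBall z (z.2 / 2) = closedBall z (z.2 / 2) ∩ (C ×ˢ univ) := by
    ext y
    constructor
    · rintro ⟨⟨h1, -⟩, h2⟩; exact ⟨h2, h1, trivial⟩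
    · rintro ⟨h2, h1, -⟩
      refine ⟨⟨h1, ?_⟩, h2⟩
      have h2 : dist y z ≤ z.2 / 2 := h2
      have : dist y.2 z.2 ≤ dist y z := by rw [Prod.dist_eq]; exact le_max_right _ _
      rw [Real.dist_eq] at this
      have := (abs_le.1 (this.trans h2)).1
      show 0 < y.2
      linarith
  rw [this]
  exact (isCompact_closedBall _ _).inter_right (hC.prod isClosed_univ)

end VS

namespace VS

variable {N : ℕ}

set_option maxHeartbeats 1000000 in
/-- The bump construction. -/
lemma bump {Ω : Set (Euc N)} (hΩo : IsOpen Ω)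
    {m lam : ℝ} (hm : 0 < m) {f : Euc N → ℝ} (hf : ContinuousOn f (closure Ω))
    {U us ul : Euc N × ℝ → ℝ} (hU : ContinuousOn U (closure Ω ×ˢ Ici 0))
    (husc : UpperSemicontinuousOn us (Ω ×ˢ Ioi 0))
    (hsub : GSub (Ω ×ˢ Ioi 0) (Ω ×ˢ Ioi 0) (Gf 1 m lam f us) us)
    (hle : ∀ z ∈ Ω ×ˢ Ioi (0 : ℝ), ul z ≤ us z) (hleU : ∀ z ∈ Ω ×ˢ Ioi (0 : ℝ), us z ≤ U z)
    (hmax : ∀ w, UpperSemicontinuousOn w (Ω ×ˢ Ioi 0) → GSub (Ω ×ˢ Ioi 0) (Ω ×ˢ Ioi 0) (Gf 1 m lam f w) w →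
      (∀ z ∈ Ω ×ˢ Ioi (0 : ℝ), w z ≤ U z) → ∀ z ∈ Ω ×ˢ Ioi (0 : ℝ), w z ≤ us z)
    {z₀ : Euc N × ℝ} (hz₀ : z₀ ∈ closure Ω ×ˢ Ioi (0 : ℝ)) (hlt : ul z₀ < U z₀)
    (happ : ∀ η > 0, ∃ y ∈ Ω ×ˢ Ioi (0 : ℝ), dist y z₀ < η ∧ us y < ul z₀ + η)
    {φ : Euc N × ℝ → ℝ} (hφ : ContDiff ℝ 2 φ)
    (hloc : IsLocalMaxOn (fun y => - ul y - φ y) (closure Ω ×ˢ Ioi 0) z₀) :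
    dT φ z₀ - dL φ z₀ + Gf (-1) m lam f (fun z => - ul z) z₀ (dX φ z₀) ≤ 0 := by
  classical
  by_contra hcon
  push Not at hcon
  have hQo : IsOpen (Ω ×ˢ Ioi (0 : ℝ)) := hΩo.prod isOpen_Ioi
  obtain ⟨ε, hε, hexp⟩ := expr_stab (hf z₀.1 hz₀.1) hm (-1) lam _ _ _ _ hcon
  set κ : ℝ := ε / (4 * (N + 1)) with hκ
  have hκ0 : 0 < κ := by positivity
  have hκN' : 2 * N * κ < ε := by
    have : κ * (4 * (N + 1)) = ε := by rw [hκ]; field_simp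
    nlinarith
  set ψ : Euc N × ℝ → ℝ := fun y => φ y + qd κ z₀ y with hψ
  have hψc : ContDiff ℝ 2 ψ := hφ.add (qd_contDiff κ z₀)
  have hT : dT ψ z₀ = dT φ z₀ := by
    rw [hψ, dT_add hφ.contDiffAt (qd_contDiff κ z₀).contDiffAt, dT_qd]; simp
  have hX : dX ψ z₀ = dX φ z₀ := by
    rw [hψ, dX_add hφ.contDiffAt (qd_contDiff κ z₀).contDiffAt, dX_qd]; simp
  have hL : dL ψ z₀ = dL φ z₀ + 2 * N * κ := by
    rw [hψ, dL_add hφ.contDiffAt (qd_contDiff κ z₀).contDiffAt, dL_qd]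
  have e1 : ∀ᶠ y in 𝓝 z₀, |dT ψ y - dT φ z₀| < ε := by
    have : ContinuousAt (fun y => |dT ψ y - dT φ z₀|) z₀ :=
      ((continuous_dT hψc).sub continuous_const).abs.continuousAt
    refine this.eventually (gt_mem_nhds ?_); simp only; rw [hT]; simpa using hε
  have e2 : ∀ᶠ y in 𝓝 z₀, ‖dX ψ y - dX φ z₀‖ < ε := by
    have : ContinuousAt (fun y => ‖dX ψ y - dX φ z₀‖) z₀ :=
      ((continuous_dX hψc).sub continuous_const).norm.continuousAt
    refine this.eventually (gt_mem_nhds ?_); simp only; rw [hX]; simpa using hε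
  have e3 : ∀ᶠ y in 𝓝 z₀, |dL ψ y - dL φ z₀| < ε := by
    have : ContinuousAt (fun y => |dL ψ y - dL φ z₀|) z₀ :=
      ((continuous_dL hψc).sub continuous_const).abs.continuousAt
    refine this.eventually (gt_mem_nhds ?_); simp only; rw [hL, abs_of_nonneg]
    · linarith
    · have : 0 ≤ 2 * (N : ℝ) * κ := by positivity
      linarith
  set e := (U z₀ - ul z₀) / 4 with he
  have he0 : 0 < e := by linarith
  have hψcl : ∀ c > 0, ∀ᶠ y in 𝓝 z₀, |ψ y - ψ z₀| < c := by
    intro c hc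
    have : ContinuousAt (fun y => |ψ y - ψ z₀|) z₀ :=
      (hψc.continuous.sub continuous_const).abs.continuousAt
    refine this.eventually (gt_mem_nhds ?_); simpa using hc
  have e5 : ∀ᶠ y in 𝓝 z₀, y ∈ closure Ω ×ˢ Ici (0 : ℝ) → U z₀ - e < U y := by
    have := (hU z₀ ⟨hz₀.1, (show (0:ℝ) ≤ _ from le_of_lt (show (0:ℝ) < z₀.2 from hz₀.2))⟩).eventually (lt_mem_nhds (show U z₀ - e < U z₀ by linarith))
    rwa [eventually_nhdsWithin_iff] at this
  have e6 : ∀ᶠ y in 𝓝 z₀, y ∈ closure Ω ×ˢ Ioi (0 : ℝ) → - ul y - φ y ≤ - ul z₀ - φ z₀ :=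
    eventually_nhdsWithin_iff.1 hloc
  obtain ⟨r0, hr0, hr⟩ := Metric.eventually_nhds_iff_ball.1 (e1.and (e2.and (e3.and
    ((hψcl (min e (ε / 2)) (by positivity)).and (e5.and e6)))))
  set r := min r0 ε with hrdef
  have hr1 : 0 < r := lt_min hr0 hε
  set s := min (min e (ε / 2)) (κ * (r / 2) ^ 2) / 2 with hs
  have hs0 : 0 < s := by positivity
  have hse : s < e := by
    have : min (min e (ε / 2)) (κ * (r / 2) ^ 2) ≤ e := (min_le_left _ _).trans (min_le_left _ _)
    linarith
  have hsε : s < ε / 2 := by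
    have : min (min e (ε / 2)) (κ * (r / 2) ^ 2) ≤ ε / 2 := (min_le_left _ _).trans (min_le_right _ _)
    linarith
  have hsκ : s < κ * (r / 2) ^ 2 := by
    have : min (min e (ε / 2)) (κ * (r / 2) ^ 2) ≤ κ * (r / 2) ^ 2 := min_le_right _ _
    linarith
  set c := ul z₀ + ψ z₀ + s with hc
  set b : Euc N × ℝ → ℝ := fun y => - ψ y + c with hb
  have hbc : ContDiff ℝ 2 b := hψc.neg.add contDiff_const
  have hψ0 : ψ z₀ = φ z₀ := by simp [hψ, qd_self]
  have hQS : ∀ y ∈ Ω ×ˢ Ioi (0 : ℝ), y ∈ closure Ω ×ˢ Ioi (0 : ℝ) := fun y hy => ⟨subset_closure hy.1, hy.2⟩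
  have hQC : ∀ y ∈ Ω ×ˢ Ioi (0 : ℝ), y ∈ closure Ω ×ˢ Ici (0 : ℝ) := fun y hy => ⟨subset_closure hy.1, (show (0:ℝ) ≤ _ from le_of_lt (show (0:ℝ) < y.2 from hy.2))⟩
  -- properties in the ball
  have p1 : ∀ y ∈ Ω ×ˢ Ioi (0 : ℝ), dist y z₀ < r → b y ≤ U y := by
    intro y hy hd
    obtain ⟨-, -, -, g4, g5, -⟩ := hr y (lt_of_lt_of_le hd (min_le_left _ _))
    have := g5 (hQC y hy)
    rw [lt_min_iff] at g4
    have := (abs_lt.1 g4.1).1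
    simp only [hb, hc]
    linarith
  have p2 : ∀ y ∈ Ω ×ˢ Ioi (0 : ℝ), dist y z₀ < r → r / 2 ≤ dist y z₀ → b y ≤ us y := by
    intro y hy hd hd2
    obtain ⟨-, -, -, -, -, g6⟩ := hr y (lt_of_lt_of_le hd (min_le_left _ _))
    have h1 := g6 (hQS y hy)
    have h2 := qd_ge hκ0.le (by positivity) hd2
    have h3 := hle y hy
    have h4 : ψ y = φ y + qd κ z₀ y := rfl
    simp only [hb, hc]
    linarith
  have p3 : ∀ y ∈ Ω ×ˢ Ioi (0 : ℝ), dist y z₀ < r → GSub (Ω ×ˢ Ioi 0) {y} (Gf 1 m lam f b) b := by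
    intro y hy hd
    obtain ⟨g1, g2, g3, g4, -, -⟩ := hr y (lt_of_lt_of_le hd (min_le_left _ _))
    rw [lt_min_iff] at g4
    have g4' := abs_lt.1 g4.2
    have h1 := hexp (dT ψ y) (dL ψ y) (- b y) (dX ψ y) y.1 g1 g3 (by
      rw [abs_lt]; simp only [hb, hc]; constructor <;> linarith) g2 (subset_closure hy.1)
      (lt_of_lt_of_le (lt_of_le_of_lt (by rw [Prod.dist_eq]; exact le_max_left _ _) hd) (min_le_right _ _))
    refine gsub_classical (hQo.mem_nhds hy) hbc.contDiffAt ?_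
    have k1 : dT b y = - dT ψ y := by
      rw [hb, dT_add hψc.neg.contDiffAt contDiffAt_const, dT_const, dT_neg, add_zero]
    have k2 : dX b y = - dX ψ y := by
      rw [hb, dX_add hψc.neg.contDiffAt contDiffAt_const, dX_const, dX_neg, add_zero]
    have k3 : dL b y = - dL ψ y := by
      rw [hb, dL_add hψc.neg.contDiffAt contDiffAt_const, dL_const, dL_neg, add_zero]
    rw [k1, k2, k3, norm_neg]
    linarith
  set w : Euc N × ℝ → ℝ := fun y => if dist y z₀ < r then max (us y) (b y) else us y with hw
  have w1 : ∀ y, dist y z₀ < r → w y = max (us y) (b y) := fun y hy => by simp only [hw, if_pos hy]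
  have w2 : ∀ y, ¬ dist y z₀ < r → w y = us y := fun y hy => by simp only [hw, if_neg hy]
  have w3 : ∀ y, us y ≤ w y := fun y => by
    by_cases hy : dist y z₀ < r
    · rw [w1 y hy]; exact le_max_left _ _
    · rw [w2 y hy]
  have w4 : ∀ y ∈ Ω ×ˢ Ioi (0 : ℝ), r / 2 ≤ dist y z₀ → w y = us y := by
    intro y hy hd
    by_cases hy' : dist y z₀ < r
    · rw [w1 y hy', max_eq_left (p2 y hy hy' hd)]
    · rw [w2 y hy']
  have hwusc : UpperSemicontinuousOn w (Ω ×ˢ Ioi 0) := by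
    intro z hz M hM
    have hM : w z < M := hM
    have a1 : ∀ᶠ y in 𝓝[Ω ×ˢ Ioi 0] z, us y < M := husc z hz M (lt_of_le_of_lt (w3 z) hM)
    by_cases hzd : dist z z₀ < r
    · rw [w1 z hzd, max_lt_iff] at hM
      have a2 : ∀ᶠ y in 𝓝[Ω ×ˢ Ioi 0] z, b y < M :=
        nhdsWithin_le_nhds (hbc.continuous.continuousAt.eventually (gt_mem_nhds hM.2))
      filter_upwards [a1, a2] with y h1 h2
      show w y < M
      by_cases hy : dist y z₀ < r
      · rw [w1 y hy]; exact max_lt h1 h2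
      · rw [w2 y hy]; exact h1
    · push Not at hzd
      have a2 : ∀ᶠ y in 𝓝[Ω ×ˢ Ioi 0] z, r / 2 < dist y z₀ :=
        nhdsWithin_le_nhds ((continuous_id.dist continuous_const).continuousAt.eventually
          (lt_mem_nhds (show r / 2 < dist (id z) z₀ by simp only [id]; linarith)))
      filter_upwards [a1, a2, self_mem_nhdsWithin] with y h1 h2 h3
      show w y < M
      rw [w4 y h3 h2.le]; exact h1
  have hwsub : GSub (Ω ×ˢ Ioi 0) (Ω ×ˢ Ioi 0) (Gf 1 m lam f w) w := by
    refine gsub_glue fun z hz => ?_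
    by_cases hzu : w z = us z
    · exact ⟨us, _, hz, hsub, hzu.symm, Eventually.of_forall w3⟩
    · have hzd : dist z z₀ < r := by
        by_contra hcc
        exact hzu (w2 z hcc)
      have hzb : b z = w z := by
        rw [w1 z hzd] at hzu ⊢
        rcases max_choice (us z) (b z) with h | h
        · exact absurd h hzu
        · exact h.symm
      refine ⟨b, {z}, rfl, p3 z hz hzd, hzb, ?_⟩
      refine nhdsWithin_le_nhds ?_
      filter_upwards [isOpen_ball.mem_nhds (show z ∈ ball z₀ r from hzd)] with y hy
      rw [w1 y hy]; exact le_max_right _ _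
  have hwU : ∀ z ∈ Ω ×ˢ Ioi (0 : ℝ), w z ≤ U z := by
    intro z hz
    by_cases hzd : dist z z₀ < r
    · rw [w1 z hzd]; exact max_le (hleU z hz) (p1 z hz hzd)
    · rw [w2 z hzd]; exact hleU z hz
  obtain ⟨r3, hr3, hb3⟩ := Metric.eventually_nhds_iff_ball.1 (hψcl (s / 2) (by positivity))
  obtain ⟨y, hyQ, hyd, hyu⟩ := happ (min r (min r3 (s / 2))) (by positivity)
  simp only [lt_min_iff] at hyd
  have h1 := hmax w hwusc hwsub hwU y hyQ
  rw [w1 y hyd.1] at h1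
  have h2 := (le_max_right (us y) (b y)).trans h1
  have h3 := (abs_lt.1 (hb3 y hyd.2.1)).2
  have h4 : min r (min r3 (s / 2)) ≤ s / 2 := (min_le_right _ _).trans (min_le_right _ _)
  simp only [hb, hc] at h2
  linarith

set_option maxHeartbeats 1000000 in
theorem perron {Ω : Set (Euc N)} (hΩo : IsOpen Ω)
    {m lam : ℝ} (hm : 0 < m) {f g : Euc N → ℝ} (hf : ContinuousOn f (closure Ω))
    {U L : Euc N × ℝ → ℝ} (hU : ContinuousOn U (closure Ω ×ˢ Ici 0)) (hL : ContinuousOn L (closure Ω ×ˢ Ici 0))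
    (hLU : ∀ z ∈ Ω ×ˢ Ioi (0 : ℝ), L z ≤ U z)
    (hLs : GSub (Ω ×ˢ Ioi 0) (Ω ×ˢ Ioi 0) (Gf 1 m lam f L) L)
    (hUs : GSub (Ω ×ˢ Ioi 0) (Ω ×ˢ Ioi 0) (Gf (-1) m lam f (fun z => - U z)) (fun z => - U z))
    (hUg : ∀ z ∈ frontier Ω ×ˢ Ioi (0 : ℝ), g z.1 ≤ U z) :
    ∃ us ul : Euc N × ℝ → ℝ, UpperSemicontinuousOn us (closure Ω ×ˢ Ici 0) ∧
      LowerSemicontinuousOn ul (closure Ω ×ˢ Ici 0) ∧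
      GSub (Ω ×ˢ Ioi 0) (Ω ×ˢ Ioi 0) (Gf 1 m lam f us) us ∧
      GSub (closure Ω ×ˢ Ioi 0) {z | z ∈ closure Ω ×ˢ Ioi (0 : ℝ) ∧ (z.1 ∈ Ω ∨ ul z < g z.1)}
        (Gf (-1) m lam f (fun z => - ul z)) (fun z => - ul z) ∧
      (∀ z ∈ closure Ω ×ˢ Ici (0 : ℝ), L z ≤ ul z ∧ ul z ≤ us z ∧ us z ≤ U z) ∧
      (∀ w, UpperSemicontinuousOn w (Ω ×ˢ Ioi 0) → GSub (Ω ×ˢ Ioi 0) (Ω ×ˢ Ioi 0) (Gf 1 m lam f w) w →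
        (∀ z ∈ Ω ×ˢ Ioi (0 : ℝ), w z ≤ U z) → ∀ z ∈ Ω ×ˢ Ioi (0 : ℝ), w z ≤ us z) ∧
      (∀ W, ContinuousOn W (closure Ω ×ˢ Ici 0) → (∀ z ∈ Ω ×ˢ Ioi (0 : ℝ), W z ≤ us z) →
        ∀ z ∈ closure Ω ×ˢ Ici (0 : ℝ), W z ≤ ul z) ∧
      IsUEnv (Ω ×ˢ Ioi 0) us us := by
  have hQo : IsOpen (Ω ×ˢ Ioi (0 : ℝ)) := hΩo.prod isOpen_Ioi
  have hcl : closure (Ω ×ˢ Ioi (0 : ℝ)) = closure Ω ×ˢ Ici 0 := by rw [closure_prod_eq, closure_Ioi]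
  rw [← hcl] at hU hL
  set F : Set (Euc N × ℝ → ℝ) := {w | UpperSemicontinuousOn w (Ω ×ˢ Ioi 0) ∧
    GSub (Ω ×ˢ Ioi 0) (Ω ×ˢ Ioi 0) (Gf 1 m lam f w) w ∧ ∀ z ∈ Ω ×ˢ Ioi (0 : ℝ), w z ≤ U z} with hF
  have hLF : L ∈ F := ⟨(hL.mono subset_closure).upperSemicontinuousOn, hLs, hLU⟩
  set u : Euc N × ℝ → ℝ := fun z => sSup ((fun w => w z) '' F) with hu
  have hbdd : ∀ z ∈ Ω ×ˢ Ioi (0 : ℝ), BddAbove ((fun w : Euc N × ℝ → ℝ => w z) '' F) := by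
    rintro z hz
    refine ⟨U z, ?_⟩
    rintro _ ⟨w, hw, rfl⟩
    exact hw.2.2 z hz
  have hwu : ∀ w ∈ F, ∀ z ∈ Ω ×ˢ Ioi (0 : ℝ), w z ≤ u z := fun w hw z hz =>
    le_csSup (hbdd z hz) ⟨w, hw, rfl⟩
  have huU : ∀ z ∈ Ω ×ˢ Ioi (0 : ℝ), u z ≤ U z := by
    intro z hz
    refine csSup_le ⟨L z, L, hLF, rfl⟩ ?_
    rintro _ ⟨w, hw, rfl⟩
    exact hw.2.2 z hz
  obtain ⟨us, hus⟩ := exists_env hU hL (fun z hz => hwu L hLF z hz) huU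
  have husU : ∀ z ∈ closure (Ω ×ˢ Ioi (0 : ℝ)), us z ≤ U z := fun z hz => hus.le_cont hU huU hz
  have hsub : GSub (Ω ×ˢ Ioi 0) (Ω ×ˢ Ioi 0) (Gf 1 m lam f us) us := by
    intro φ hφ z hz hmx
    obtain ⟨R, hR, hRc⟩ := open_compact hQo hz
    refine stab (C := closure Ω) hR hRc (fun y hy => subset_closure hy.1) (hf z.1 (subset_closure hz.1)) hm hφ hmx
      one_pos ?_
    intro R' hR' hRR η hη
    obtain ⟨y, hyQ, hyd, hyu⟩ := (hus z (subset_closure hz)).2 η hη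
    obtain ⟨_, ⟨w, hw, rfl⟩, hwy⟩ := exists_lt_of_lt_csSup (show ((fun w : Euc N × ℝ → ℝ => w y) '' F).Nonempty from ⟨L y, L, hLF, rfl⟩) hyu
    refine ⟨w, Ω ×ˢ Ioi 0, hw.1.mono inter_subset_left, ?_, ⟨y, hyQ, hyd, hwy⟩, fun y hy _ _ => hy, hw.2.1⟩
    intro y hy
    have := hwu w hw y hy.1
    have := hus.le hy.1
    linarith
  have husF : us ∈ F := ⟨hus.usc.mono subset_closure, hsub, fun z hz => husU z (subset_closure hz)⟩
  have heq : ∀ z ∈ Ω ×ˢ Ioi (0 : ℝ), u z = us z := fun z hz => le_antisymm (hus.le hz) (hwu us husF z hz)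
  have hus' : IsUEnv (Ω ×ˢ Ioi 0) us us := by
    intro z hz
    refine ⟨fun η hη => ?_, fun η hη => ?_⟩
    · obtain ⟨r, hr, h⟩ := (hus z hz).1 η hη
      exact ⟨r, hr, fun y hy hd => by rw [← heq y hy]; exact h y hy hd⟩
    · obtain ⟨y, hy, hd, h⟩ := (hus z hz).2 η hη
      exact ⟨y, hy, hd, by rw [← heq y hy]; exact h⟩
  have hLus : ∀ z ∈ Ω ×ˢ Ioi (0 : ℝ), L z ≤ us z := fun z hz => by rw [← heq z hz]; exact hwu L hLF z hz
  obtain ⟨v, hv⟩ := exists_env (u := fun z => - us z) hL.neg hU.neg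
    (fun z hz => neg_le_neg (husU z (subset_closure hz))) (fun z hz => neg_le_neg (hLus z hz))
  have hvle : ∀ z ∈ closure (Ω ×ˢ Ioi (0 : ℝ)), - v z ≤ us z := by
    intro z hz
    by_contra hcon
    push Not at hcon
    obtain ⟨r1, hr1, h1⟩ := (hv z hz).1 ((- v z - us z) / 2) (by linarith)
    obtain ⟨y, hy, hd, h2⟩ := (hus' z hz).2 r1 hr1
    obtain ⟨r2, hr2, h3⟩ := (hus' z hz).1 ((- v z - us z) / 2) (by linarith)
    obtain ⟨y', hy', hd'⟩ := Metric.mem_closure_iff.1 hz (min r1 r2) (lt_min hr1 hr2)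
    rw [dist_comm] at hd'
    have a1 := h1 y' hy' (lt_of_lt_of_le hd' (min_le_left _ _))
    have a2 := h3 y' hy' (lt_of_lt_of_le hd' (min_le_right _ _))
    linarith
  rw [← hcl]
  have hmaxF : ∀ w, UpperSemicontinuousOn w (Ω ×ˢ Ioi 0) → GSub (Ω ×ˢ Ioi 0) (Ω ×ˢ Ioi 0) (Gf 1 m lam f w) w →
        (∀ z ∈ Ω ×ˢ Ioi (0 : ℝ), w z ≤ U z) → ∀ z ∈ Ω ×ˢ Ioi (0 : ℝ), w z ≤ us z := by
    intro w h1 h2 h3 z hz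
    rw [← heq z hz]; exact hwu w ⟨h1, h2, h3⟩ z hz
  have hWl : ∀ W, ContinuousOn W (closure (Ω ×ˢ Ioi 0)) → (∀ z ∈ Ω ×ˢ Ioi (0 : ℝ), W z ≤ us z) →
        ∀ z ∈ closure (Ω ×ˢ Ioi (0 : ℝ)), W z ≤ - v z := by
    intro W hW h z hz
    have := hv.le_cont hW.neg (fun z hz => neg_le_neg (h z hz)) hz
    have : v z ≤ - W z := this
    linarith
  have hlsc : LowerSemicontinuousOn (fun z => - v z) (closure (Ω ×ˢ Ioi 0)) := by
    intro z hz M hM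
    have hM : M < - v z := hM
    have := hv.usc z hz (-M) (show v z < - M by linarith)
    filter_upwards [this] with y hy
    show M < - v y
    linarith
  refine ⟨us, fun z => - v z, hus.usc, hlsc, hsub, ?_, ?_, hmaxF, hWl, hus'⟩
  · intro φ hφ z₀ hz₀ hloc
    have hz₀c : z₀ ∈ closure (Ω ×ˢ Ioi (0 : ℝ)) := by rw [hcl]; exact ⟨hz₀.1.1, (show (0:ℝ) ≤ _ from le_of_lt (show (0:ℝ) < z₀.2 from hz₀.1.2))⟩
    by_cases hlt : - v z₀ < U z₀
    · refine bump hΩo hm hf (U := U) (us := us) (ul := fun z => - v z) (by rwa [hcl] at hU)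
        (hus.usc.mono subset_closure) hsub (fun z hz => hvle z (subset_closure hz))
        (fun z hz => husU z (subset_closure hz)) hmaxF hz₀.1 hlt ?_ hφ hloc
      intro η hη
      obtain ⟨y, hy, hd, h⟩ := (hv z₀ hz₀c).2 η hη
      exact ⟨y, hy, hd, by show us y < - v z₀ + η; linarith⟩
    · have heqU : - v z₀ = U z₀ := le_antisymm ((hvle z₀ hz₀c).trans (husU z₀ hz₀c)) (not_lt.1 hlt)
      have hzΩ : z₀.1 ∈ Ω := by
        by_contra hcc
        have h1 := hUg z₀ ⟨⟨hz₀.1.1, by rwa [hΩo.interior_eq]⟩, hz₀.1.2⟩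
        rcases hz₀.2 with h | h
        · exact hcc h
        · have h : - v z₀ < g z₀.1 := h
          linarith
      have := hUs φ hφ z₀ ⟨hzΩ, hz₀.1.2⟩ (by
        have h1 : ∀ᶠ y in 𝓝[closure Ω ×ˢ Ioi 0] z₀, - - v y - φ y ≤ - - v z₀ - φ z₀ := hloc
        have h2 : Ω ×ˢ Ioi (0 : ℝ) ⊆ closure Ω ×ˢ Ioi (0 : ℝ) := prod_mono subset_closure le_rfl
        filter_upwards [h1.filter_mono (nhdsWithin_mono _ h2), self_mem_nhdsWithin] with y hy hyQ
        have := hvle y (subset_closure hyQ)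
        have := husU y (subset_closure hyQ)
        linarith)
      unfold Gf at this ⊢
      simp only at this ⊢
      rw [heqU]; exact this
  · intro z hz
    exact ⟨hWl L hL hLus z hz, hvle z hz, husU z hz⟩

end VS

namespace VS

variable {N : ℕ}

lemma dT_aff (a q : Euc N → ℝ) (z : Euc N × ℝ) : dT (fun y => a y.1 + (1 + y.2) * q y.1) z = q z.1 := by
  unfold dT
  have : HasDerivAt (fun s : ℝ => a z.1 + (1 + s) * q z.1) (0 + 1 * q z.1) z.2 :=
    (hasDerivAt_const _ _).add (((hasDerivAt_id z.2).const_add 1).mul_const _)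
  simpa using this.deriv

lemma dL_aff {a q : Euc N → ℝ} {z : Euc N × ℝ} (ha : ContDiffAt ℝ 2 a z.1) (hq : ContDiffAt ℝ 2 q z.1) :
    dL (fun y => a y.1 + (1 + y.2) * q y.1) z = lapl a z.1 + (1 + z.2) * lapl q z.1 := by
  unfold dL; dsimp only
  rw [lapl_add ha (contDiffAt_const.mul hq), lapl_const_mul _ hq]

lemma cd_time (a : Euc N → ℝ) (ha : ContDiff ℝ 2 a) : ContDiff ℝ 2 (fun z : Euc N × ℝ => a z.1) := ha.comp contDiff_fst

set_option maxHeartbeats 1000000 in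
lemma upper_barrier {Ω : Set (Euc N)} (hΩo : IsOpen Ω) (hΩb : Bornology.IsBounded Ω) {ρ : Euc N → ℝ}
    (hρ : ContDiff ℝ 2 ρ) (hΩ : Ω = {x | ρ x < 0}) (hgr : ∀ x ∈ frontier Ω, gradient ρ x ≠ 0)
    (hfr : frontier Ω = {x | ρ x = 0})
    {m lam : ℝ} {f a : Euc N → ℝ} (hlam : 0 ≤ lam) (ha : ContDiff ℝ 2 a) {K : ℝ} (hK0 : 0 ≤ K)
    (hK : ∀ x ∈ closure Ω, |- lapl a x + lam * a x - f x| ≤ K) :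
    ∃ U : Euc N × ℝ → ℝ, Continuous U ∧
      GSub (Ω ×ˢ Ioi 0) (Ω ×ˢ Ioi 0) (Gf (-1) m lam f (fun z => - U z)) (fun z => - U z) ∧
      (∀ z ∈ frontier Ω ×ˢ Ici (0 : ℝ), U z = a z.1) ∧
      (∀ z ∈ closure Ω ×ˢ Ici (0 : ℝ), a z.1 ≤ U z ∧ U z ≤ a z.1 + K * z.2) ∧
      (∀ x ∈ closure Ω, ∀ s t : ℝ, 0 ≤ s → s ≤ t → U (x, s) ≤ U (x, t)) := by
  obtain ⟨δ₁, hδ₁, m₀, hm₀, C, hC, hnb⟩ := near_bdry hΩo hΩb hρ hΩ hgr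
  have hneg := rho_nonpos hρ hΩ
  obtain ⟨δ, hδ, hδ1, hδ2, hδ3⟩ : ∃ δ > 0, δ ≤ δ₁ ∧ δ ≤ 1 ∧ C + 1 ≤ m₀ / δ := by
    refine ⟨min δ₁ (min 1 (m₀ / (C + 1))), by positivity, min_le_left _ _,
      (min_le_right _ _).trans (min_le_left _ _), ?_⟩
    rw [le_div_iff₀ (by positivity)]
    have : min δ₁ (min 1 (m₀ / (C + 1))) ≤ m₀ / (C + 1) := (min_le_right _ _).trans (min_le_right _ _)
    rw [le_div_iff₀ (by positivity)] at this
    linarith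
  set M := 2 * K / δ with hM
  have hM0 : 0 ≤ M := by positivity
  have hMK : K ≤ M * (m₀ / δ - C) := by
    have h1 : K ≤ M := by
      rw [hM, le_div_iff₀ hδ]; nlinarith
    nlinarith
  set Z : Euc N → ℝ := fun x => qb M δ (max (ρ x) (-δ)) with hZ
  have hZc : Continuous Z := (qb_cd M δ).continuous.comp (hρ.continuous.max continuous_const)
  have hZ0 : ∀ x ∈ closure Ω, 0 ≤ Z x := by
    intro x hx
    have h1 : max (ρ x) (-δ) ≤ 0 := max_le (hneg x hx) (by linarith)
    have h2 := le_max_right (ρ x) (-δ)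
    have h3 := qb_nonneg hM0 hδ h1 (by linarith)
    have : 0 ≤ M * (- max (ρ x) (-δ)) := mul_nonneg hM0 (by linarith)
    simp only [hZ]; linarith
  have hZd : ∀ x, ρ x ≤ - δ → Z x = K := by
    intro x hx
    simp only [hZ]; rw [max_eq_right hx]; unfold qb; rw [hM]; field_simp; ring
  refine ⟨fun z => a z.1 + min (K * z.2) ((1 + z.2) * Z z.1), ?_, ?_, ?_, ?_, ?_⟩
  · have := ha.continuous
    fun_prop
  · refine gsub_glue fun z hz => ?_
    have hzt : 0 < z.2 := hz.2
    have hzΩ : z.1 ∈ closure Ω := subset_closure hz.1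
    have hQn : Ω ×ˢ Ioi (0 : ℝ) ∈ 𝓝 z := (hΩo.prod isOpen_Ioi).mem_nhds hz
    have hKz := abs_le.1 (hK z.1 hzΩ)
    rcases le_or_gt (K * z.2) ((1 + z.2) * Z z.1) with h | h
    · refine ⟨fun y => - (a y.1 + K * y.2), {z}, rfl, ?_, ?_, ?_⟩
      · have hb : ContDiff ℝ 2 (fun y : Euc N × ℝ => a y.1 + K * y.2) :=
          (cd_time a ha).add (contDiff_const.mul contDiff_snd)
        refine gsub_classical hQn hb.neg.contDiffAt ?_
        have k1 : dT (fun y : Euc N × ℝ => a y.1 + K * y.2) z = K := by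
          unfold dT
          have : HasDerivAt (fun s : ℝ => a z.1 + K * s) (0 + K * 1) z.2 :=
            (hasDerivAt_const _ _).add ((hasDerivAt_id z.2).const_mul _)
          simpa using this.deriv
        have k2 : dL (fun y : Euc N × ℝ => a y.1 + K * y.2) z = lapl a z.1 := by
          unfold dL; dsimp only
          rw [lapl_add ha.contDiffAt contDiffAt_const, lapl_const]; ring
        rw [dT_neg, dL_neg, k1, k2]
        have : 0 ≤ ‖dX (fun y : Euc N × ℝ => - (a y.1 + K * y.2)) z‖ ^ m := by positivity
        have : 0 ≤ lam * (K * z.2) := by positivity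
        nlinarith
      · simp only; rw [min_eq_left h]
      · refine Eventually.of_forall fun y => ?_
        have := min_le_left (K * y.2) ((1 + y.2) * Z y.1)
        simp only; linarith
    · have hdep : - δ < ρ z.1 := by
        by_contra hcc
        rw [hZd z.1 (not_lt.1 hcc)] at h
        nlinarith
      have hZz : Z z.1 = qb M δ (ρ z.1) := by simp only [hZ]; rw [max_eq_left hdep.le]
      refine ⟨fun y => - (a y.1 + (1 + y.2) * qb M δ (ρ y.1)), {z}, rfl, ?_, ?_, ?_⟩
      · have hq : ContDiff ℝ 2 (fun x => qb M δ (ρ x)) := (qb_cd M δ).comp hρ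
        have hb : ContDiff ℝ 2 (fun y : Euc N × ℝ => a y.1 + (1 + y.2) * qb M δ (ρ y.1)) :=
          (cd_time a ha).add ((contDiff_const.add contDiff_snd).mul (cd_time _ hq))
        refine gsub_classical hQn hb.neg.contDiffAt ?_
        have k1 := dT_aff a (fun x => qb M δ (ρ x)) z
        have k2 := dL_aff (z := z) ha.contDiffAt hq.contDiffAt
        rw [dT_neg, dL_neg, k1, k2]
        have e1 : 0 ≤ ‖dX (fun y : Euc N × ℝ => - (a y.1 + (1 + y.2) * qb M δ (ρ y.1))) z‖ ^ m := by positivity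
        have hZp := hZ0 z.1 hzΩ
        rw [hZz] at hZp
        have e2 : 0 ≤ lam * ((1 + z.2) * qb M δ (ρ z.1)) := by positivity
        obtain ⟨n1, -, n3⟩ := hnb z.1 hzΩ
        have e3 := lapl_qb_le hρ hM0 hδ n1 (n3 (by linarith)) (hneg _ hzΩ) (by linarith)
        have e4 : lapl (fun y => qb M δ (ρ y)) z.1 ≤ - K := by linarith
        have e5 : (1 + z.2) * lapl (fun y => qb M δ (ρ y)) z.1 ≤ - K := by nlinarith
        linarith
      · simp only; rw [min_eq_right h.le, hZz]
      · refine nhdsWithin_le_nhds ?_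
        filter_upwards [(hρ.continuous.comp continuous_fst).continuousAt.eventually (lt_mem_nhds hdep)] with y hy
        have hy : - δ < ρ y.1 := hy
        have := min_le_right (K * y.2) ((1 + y.2) * Z y.1)
        have e : Z y.1 = qb M δ (ρ y.1) := by simp only [hZ]; rw [max_eq_left hy.le]
        rw [← e]; linarith
  · intro z hz
    have h0 : ρ z.1 = 0 := by have := hz.1; rw [hfr] at this; exact this
    have ht : 0 ≤ z.2 := hz.2
    have : Z z.1 = 0 := by simp only [hZ]; rw [h0, max_eq_left (by linarith)]; simp [qb]
    simp only; rw [this, mul_zero, min_eq_right (by positivity), add_zero]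
  · intro z hz
    have ht : 0 ≤ z.2 := hz.2
    have := hZ0 z.1 hz.1
    refine ⟨?_, ?_⟩
    · have : 0 ≤ min (K * z.2) ((1 + z.2) * Z z.1) := by positivity
      simp only; linarith
    · have := min_le_left (K * z.2) ((1 + z.2) * Z z.1)
      simp only; linarith
  · intro x hx s t hs hst
    have := hZ0 x hx
    simp only
    gcongr

lemma lower_basic {Ω : Set (Euc N)} (hΩo : IsOpen Ω) {m lam : ℝ} {f a : Euc N → ℝ} (hlam : 0 ≤ lam)
    (ha : ContDiff ℝ 2 a) {K : ℝ} (hK0 : 0 ≤ K)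
    (hK : ∀ x ∈ closure Ω, - lapl a x + ‖gradient a x‖ ^ m + lam * a x - f x ≤ K) :
    GSub (Ω ×ˢ Ioi 0) (Ω ×ˢ Ioi 0) (Gf 1 m lam f (fun z => a z.1 - K * z.2)) (fun z => a z.1 - K * z.2) := by
  refine gsub_glue fun z hz => ⟨_, {z}, rfl, ?_, rfl, Eventually.of_forall fun y => le_rfl⟩
  have hzt : 0 < z.2 := hz.2
  have hQn : Ω ×ˢ Ioi (0 : ℝ) ∈ 𝓝 z := (hΩo.prod isOpen_Ioi).mem_nhds hz
  have hb : ContDiff ℝ 2 (fun y : Euc N × ℝ => a y.1 - K * y.2) :=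
    (cd_time a ha).sub (contDiff_const.mul contDiff_snd)
  refine gsub_classical hQn hb.contDiffAt ?_
  have k1 : dT (fun y : Euc N × ℝ => a y.1 - K * y.2) z = - K := by
    unfold dT
    have : HasDerivAt (fun s : ℝ => a z.1 - K * s) (0 - K * 1) z.2 :=
      (hasDerivAt_const _ _).sub ((hasDerivAt_id z.2).const_mul _)
    simpa using this.deriv
  have k2 : dL (fun y : Euc N × ℝ => a y.1 - K * y.2) z = lapl a z.1 := by
    unfold dL; dsimp only
    rw [lapl_sub ha.contDiffAt contDiffAt_const, lapl_const, sub_zero]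
  have k3 : dX (fun y : Euc N × ℝ => a y.1 - K * y.2) z = gradient a z.1 := by
    unfold dX; dsimp only
    rw [grad_sub (ha.contDiffAt.differentiableAt (by norm_num)) (differentiableAt_const _), grad_const, sub_zero]
  rw [k1, k2, k3]
  have := hK z.1 (subset_closure hz.1)
  have : 0 ≤ lam * (K * z.2) := by positivity
  nlinarith

/-- the logarithmic profile -/
noncomputable def lg (β κ s : ℝ) : ℝ := Real.log (1 - κ * s) / β

lemma lg_deriv {β κ s : ℝ} (hs : 0 < 1 - κ * s) : deriv (lg β κ) s = - κ / (β * (1 - κ * s)) := by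
  have h : HasDerivAt (fun s : ℝ => 1 - κ * s) (0 - κ * 1) s :=
    (hasDerivAt_const _ _).sub ((hasDerivAt_id s).const_mul κ)
  have h2 : HasDerivAt (lg β κ) _ s := (h.log hs.ne').div_const β
  rw [h2.deriv]
  rw [zero_sub, mul_one, div_div, mul_comm β]

lemma lg_cd {β κ s : ℝ} (hs : 0 < 1 - κ * s) : ContDiffAt ℝ 2 (lg β κ) s := by
  unfold lg
  have : ContDiffAt ℝ 2 (fun s : ℝ => 1 - κ * s) s := by fun_prop
  exact (this.log hs.ne').div_const β

lemma lg_deriv2 {β κ s : ℝ} (hβ : 0 < β) (hs : 0 < 1 - κ * s) :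
    deriv (deriv (lg β κ)) s = - β * (deriv (lg β κ) s) ^ 2 := by
  have hev : deriv (lg β κ) =ᶠ[𝓝 s] fun s => - κ / (β * (1 - κ * s)) := by
    have : ContinuousAt (fun s : ℝ => 1 - κ * s) s := by fun_prop
    filter_upwards [this.eventually (lt_mem_nhds hs)] with y hy
    exact lg_deriv hy
  rw [hev.deriv_eq, lg_deriv hs]
  have h : HasDerivAt (fun s : ℝ => β * (1 - κ * s)) (β * (0 - κ * 1)) s :=
    ((hasDerivAt_const _ _).sub ((hasDerivAt_id s).const_mul κ)).const_mul β
  have h2 := ((hasDerivAt_const s (-κ)).div h (by positivity)).deriv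
  rw [show (fun s => -κ / (β * (1 - κ * s))) = (fun _ => -κ) / (fun s => β * (1 - κ * s)) from rfl, h2]
  field_simp
  ring

lemma ar1 (x y : ℝ) : (x + y) ^ 2 ≤ 2 * x ^ 2 + 2 * y ^ 2 := by nlinarith [sq_nonneg (x - y)]
lemma ar2 {p C K : ℝ} (hp : p ≤ -1) (hC : 0 ≤ C) (hK : 0 ≤ K) : - p * C + K ≤ (C + K) * p ^ 2 := by
  have q1 : - p ≤ p ^ 2 := by nlinarith
  have q2 : 1 ≤ p ^ 2 := by nlinarith
  nlinarith
lemma ar3 {β κ δ r : ℝ} (hβ : 0 < β) (hκ : 0 < κ) (h1 : 2 * β ≤ κ) (h2 : δ * (2 * β) ≤ 1) (h3 : - r ≤ δ) :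
    β * (1 - κ * r) ≤ κ := by
  have e1 : κ * (- r) ≤ κ * δ := by gcongr
  have e2 : β * (κ * δ) * 2 ≤ κ := by nlinarith
  nlinarith
lemma rpow_le_sq {s m : ℝ} (hs : 0 ≤ s) (hm : 0 < m) (hm2 : m ≤ 2) : s ^ m ≤ 1 + s ^ 2 := by
  rcases le_total s 1 with h | h
  · have := Real.rpow_le_one hs h hm.le
    nlinarith [sq_nonneg s]
  · have := Real.rpow_le_rpow_of_exponent_le h hm2
    rw [Real.rpow_two] at this
    linarith

set_option maxHeartbeats 1000000 in
lemma lower_log {Ω : Set (Euc N)} (hΩo : IsOpen Ω) (hΩb : Bornology.IsBounded Ω) {ρ : Euc N → ℝ}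
    (hρ : ContDiff ℝ 2 ρ) (hΩ : Ω = {x | ρ x < 0}) (hgr : ∀ x ∈ frontier Ω, gradient ρ x ≠ 0)
    (hfr : frontier Ω = {x | ρ x = 0})
    {m lam : ℝ} {f a : Euc N → ℝ} (hm : 0 < m) (hm2 : m ≤ 2) (hlam : 0 ≤ lam) (hf : ContinuousOn f (closure Ω))
    (ha : ContDiff ℝ 2 a) {K : ℝ} (hK0 : 0 ≤ K)
    (hK : ∀ x ∈ closure Ω, - lapl a x + ‖gradient a x‖ ^ m + lam * a x - f x ≤ K) {η : ℝ} (hη : 0 < η) :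
    ∃ W : Euc N × ℝ → ℝ, ContinuousOn W (closure Ω ×ˢ Ici 0) ∧
      GSub (Ω ×ˢ Ioi 0) (Ω ×ˢ Ioi 0) (Gf 1 m lam f W) W ∧
      (∀ z ∈ closure Ω ×ˢ Ici (0 : ℝ), W z ≤ a z.1) ∧
      (∀ z ∈ frontier Ω ×ˢ Ici (0 : ℝ), a z.1 - η * z.2 ^ 2 ≤ W z) := by
  obtain ⟨δ₁, hδ₁, m₀, hm₀, C, hC, hnb⟩ := near_bdry hΩo hΩb hρ hΩ hgr
  have hneg := rho_nonpos hρ hΩ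
  obtain ⟨K', hK'0, hK'⟩ : ∃ K' ≥ 0, ∀ x ∈ closure Ω,
      - lapl a x + (1 + 2 * ‖gradient a x‖ ^ 2) + lam * a x - f x ≤ K' := by
    have hc1 := continuous_grad ha
    have hc2 := continuous_lapl ha
    have hc3 := ha.continuous
    have : ContinuousOn (fun x => - lapl a x + (1 + 2 * ‖gradient a x‖ ^ 2) + lam * a x - f x) (closure Ω) :=
      ContinuousOn.sub (by fun_prop) hf
    obtain ⟨B, hB⟩ := hΩb.isCompact_closure.exists_bound_of_continuousOn this
    exact ⟨|B|, abs_nonneg _, fun x hx => (le_abs_self _).trans ((hB x hx).trans (le_abs_self _))⟩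
  set β := 2 + (C + K') / m₀ with hβ
  have hβ0 : 0 < β := by positivity
  have hβ1 : (β - 2) * m₀ = C + K' := by rw [hβ]; field_simp; ring
  set δ := min δ₁ (1 / (2 * β)) with hδ
  have hδ0 : 0 < δ := by positivity
  have hδβ : δ * (2 * β) ≤ 1 := by
    have : δ ≤ 1 / (2 * β) := min_le_right _ _
    rwa [le_div_iff₀ (by positivity)] at this
  set E := β * (K ^ 2 / (4 * η)) with hE
  set κ := max (2 * β) (Real.exp E / δ) with hκ
  have hκ1 : 2 * β ≤ κ := le_max_left _ _
  have hκ0 : 0 < κ := by linarith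
  have hκ2 : Real.exp E ≤ κ * δ := by
    have : Real.exp E / δ ≤ κ := le_max_right _ _
    rwa [div_le_iff₀ hδ0] at this
  have hpos : ∀ s ≤ (0 : ℝ), 0 < 1 - κ * s := fun s hs => by nlinarith
  have hlgδ : K ^ 2 / (4 * η) ≤ lg β κ (-δ) := by
    unfold lg
    rw [le_div_iff₀ hβ0, mul_comm, ← hE, Real.le_log_iff_exp_le (hpos _ (by linarith))]
    linarith
  have hlg0 : ∀ s ≤ (0 : ℝ), 0 ≤ lg β κ s := by
    intro s hs
    unfold lg
    refine div_nonneg (Real.log_nonneg ?_) hβ0.le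
    nlinarith
  have hquad : ∀ t : ℝ, K * t - η * t ^ 2 ≤ K ^ 2 / (4 * η) := by
    intro t
    rw [le_div_iff₀ (by positivity)]
    nlinarith [sq_nonneg (K - 2 * η * t)]
  set Z : Euc N → ℝ := fun x => lg β κ (max (ρ x) (-δ)) with hZ
  have hmx : ∀ x ∈ closure Ω, max (ρ x) (-δ) ≤ 0 := fun x hx => max_le (hneg x hx) (by linarith)
  have hZc : ContinuousOn Z (closure Ω) := by
    intro x hx
    have h1 : ContinuousAt (fun x => max (ρ x) (-δ)) x := (hρ.continuous.max continuous_const).continuousAt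
    exact (ContinuousAt.comp (g := lg β κ) (f := fun x => max (ρ x) (-δ)) (x := x) (lg_cd (hpos _ (hmx x hx))).continuousAt h1).continuousWithinAt
  refine ⟨fun z => a z.1 + max (- (K * z.2)) (- (Z z.1) - η * z.2 ^ 2), ?_, ?_, ?_, ?_⟩
  · have h1 : ContinuousOn (fun z : Euc N × ℝ => Z z.1) (closure Ω ×ˢ Ici 0) :=
      hZc.comp continuousOn_fst (fun z hz => hz.1)
    have h2 := ha.continuous
    refine ContinuousOn.add (by fun_prop) (ContinuousOn.sup (by fun_prop) (h1.neg.sub (by fun_prop)))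
  · refine gsub_glue fun z hz => ?_
    have hzt : 0 < z.2 := hz.2
    have hzΩ : z.1 ∈ closure Ω := subset_closure hz.1
    have hQn : Ω ×ˢ Ioi (0 : ℝ) ∈ 𝓝 z := (hΩo.prod isOpen_Ioi).mem_nhds hz
    rcases le_or_gt (- (Z z.1) - η * z.2 ^ 2) (- (K * z.2)) with h | h
    · refine ⟨fun y => a y.1 - K * y.2, Ω ×ˢ Ioi 0, hz, lower_basic hΩo hlam ha hK0 hK, ?_, ?_⟩
      · simp only; rw [max_eq_left h]; ring
      · refine Eventually.of_forall fun y => ?_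
        have := le_max_left (- (K * y.2)) (- (Z y.1) - η * y.2 ^ 2)
        simp only; linarith
    · have hdep : - δ < ρ z.1 := by
        by_contra hcc
        have : Z z.1 = lg β κ (-δ) := by simp only [hZ]; rw [max_eq_right (not_lt.1 hcc)]
        have := hquad z.2
        linarith
      have hZz : Z z.1 = lg β κ (ρ z.1) := by simp only [hZ]; rw [max_eq_left hdep.le]
      refine ⟨fun y => a y.1 - lg β κ (ρ y.1) - η * y.2 ^ 2, {z}, rfl, ?_, ?_, ?_⟩
      · have hp := hpos _ (hneg _ hzΩ)
        have hq : ContDiffAt ℝ 2 (fun x => lg β κ (ρ x)) z.1 :=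
          ContDiffAt.comp (g := lg β κ) z.1 (lg_cd hp) hρ.contDiffAt
        have hq2 : ContDiffAt ℝ 2 (fun y : Euc N × ℝ => lg β κ (ρ y.1)) z :=
          ContDiffAt.comp (g := fun x => lg β κ (ρ x)) z hq contDiff_fst.contDiffAt
        have hb : ContDiffAt ℝ 2 (fun y : Euc N × ℝ => a y.1 - lg β κ (ρ y.1) - η * y.2 ^ 2) z :=
          ((cd_time a ha).contDiffAt.sub hq2).sub (contDiff_const.mul (contDiff_snd.pow 2)).contDiffAt
        refine gsub_classical hQn hb ?_
        have k1 : dT (fun y : Euc N × ℝ => a y.1 - lg β κ (ρ y.1) - η * y.2 ^ 2) z = - (2 * η * z.2) := by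
          unfold dT; dsimp only
          have : HasDerivAt (fun s : ℝ => a z.1 - lg β κ (ρ z.1) - η * s ^ 2) _ z.2 :=
            (hasDerivAt_const _ _).sub (((hasDerivAt_id z.2).pow 2).const_mul η)
          rw [this.deriv]; simp; ring
        have k2 : dL (fun y : Euc N × ℝ => a y.1 - lg β κ (ρ y.1) - η * y.2 ^ 2) z =
            lapl a z.1 - lapl (fun x => lg β κ (ρ x)) z.1 := by
          unfold dL; dsimp only
          rw [lapl_sub (ha.contDiffAt.sub hq) contDiffAt_const, lapl_const, sub_zero, lapl_sub ha.contDiffAt hq]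
        have k3 : dX (fun y : Euc N × ℝ => a y.1 - lg β κ (ρ y.1) - η * y.2 ^ 2) z =
            gradient a z.1 - deriv (lg β κ) (ρ z.1) • gradient ρ z.1 := by
          have d1 := ha.contDiffAt.differentiableAt (by norm_num) (x := z.1)
          have d2 := hq.differentiableAt (by norm_num)
          unfold dX; dsimp only
          rw [grad_sub (d1.fun_sub d2) (differentiableAt_const _), grad_const, sub_zero, grad_sub d1 d2,
            grad_comp (hρ.contDiffAt.differentiableAt (by norm_num)) ((lg_cd hp).differentiableAt (by norm_num))]
        rw [k1, k2, k3, lapl_comp hρ.contDiffAt (lg_cd hp), lg_deriv2 hβ0 hp]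
        set p := deriv (lg β κ) (ρ z.1) with hpdef
        obtain ⟨n1, -, n3⟩ := hnb z.1 hzΩ
        have n3 := n3 (by have : δ ≤ δ₁ := min_le_left _ _; linarith)
        have p1 : p ≤ -1 := by
          rw [hpdef, lg_deriv hp, neg_div, neg_le_neg_iff, le_div_iff₀ (by positivity), one_mul]
          exact ar3 hβ0 hκ0 hκ1 hδβ (by linarith)
        have e1 := rpow_le_sq (norm_nonneg (gradient a z.1 - p • gradient ρ z.1)) hm hm2
        have e2 : ‖gradient a z.1 - p • gradient ρ z.1‖ ^ 2 ≤ 2 * ‖gradient a z.1‖ ^ 2 + 2 * (p ^ 2 * ‖gradient ρ z.1‖ ^ 2) := by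
          have h1 := norm_sub_le (gradient a z.1) (p • gradient ρ z.1)
          have h2 : ‖p • gradient ρ z.1‖ ^ 2 = p ^ 2 * ‖gradient ρ z.1‖ ^ 2 := by
            rw [norm_smul, mul_pow, Real.norm_eq_abs, sq_abs]
          have h3 : ‖gradient a z.1 - p • gradient ρ z.1‖ ^ 2 ≤ (‖gradient a z.1‖ + ‖p • gradient ρ z.1‖) ^ 2 := by
            gcongr
          rw [← h2]
          exact h3.trans (ar1 _ _)
        have e3 := hK' z.1 hzΩ
        have e4 := hlg0 _ (hneg _ hzΩ)
        have e5 : 0 ≤ lam * (lg β κ (ρ z.1) + η * z.2 ^ 2) := by positivity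
        have e6 : p * lapl ρ z.1 ≤ - p * C := by
          have := mul_le_mul_of_nonpos_left (abs_le.1 n1).1 (show p ≤ 0 by linarith)
          linarith
        have e7 : (β - 2) * p ^ 2 * m₀ ≤ (β - 2) * p ^ 2 * ‖gradient ρ z.1‖ ^ 2 := by
          have : 0 ≤ β - 2 := by rw [hβ]; simp only [add_sub_cancel_left]; positivity
          gcongr
        have e8 : (β - 2) * p ^ 2 * m₀ = (C + K') * p ^ 2 := by rw [← hβ1]; ring
        have e9 : - p * C + K' ≤ (C + K') * p ^ 2 := ar2 p1 hC.le hK'0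
        have e10 : 0 ≤ η * z.2 := by positivity
        linarith
      · simp only; rw [max_eq_right h.le, hZz]; ring
      · refine nhdsWithin_le_nhds ?_
        filter_upwards [(hρ.continuous.comp continuous_fst).continuousAt.eventually (lt_mem_nhds hdep)] with y hy
        have hy : - δ < ρ y.1 := hy
        have := le_max_right (- (K * y.2)) (- (Z y.1) - η * y.2 ^ 2)
        have e : Z y.1 = lg β κ (ρ y.1) := by simp only [hZ]; rw [max_eq_left hy.le]
        rw [← e]; linarith
  · intro z hz
    have ht : 0 ≤ z.2 := hz.2
    have h1 : 0 ≤ Z z.1 := hlg0 _ (hmx _ hz.1)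
    have : max (- (K * z.2)) (- (Z z.1) - η * z.2 ^ 2) ≤ 0 := max_le (by nlinarith) (by nlinarith [sq_nonneg z.2])
    simp only; linarith
  · intro z hz
    have h0 : ρ z.1 = 0 := by have := hz.1; rw [hfr] at this; exact this
    have : Z z.1 = 0 := by simp only [hZ]; rw [h0, max_eq_left (by linarith)]; simp [lg]
    have h2 := le_max_right (- (K * z.2)) (- (Z z.1) - η * z.2 ^ 2)
    simp only; linarith

end VS

namespace VS

variable {N : ℕ}

lemma sqrt_d2 {q : ℝ} (hq : 0 < q) : deriv (deriv Real.sqrt) q = - (1 / (4 * (Real.sqrt q) ^ 3)) := by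
  have hev : deriv Real.sqrt =ᶠ[𝓝 q] fun s => 1 / (2 * Real.sqrt s) := by
    filter_upwards [lt_mem_nhds hq] with y hy
    exact (Real.hasDerivAt_sqrt hy.ne').deriv
  have hs : 0 < Real.sqrt q := Real.sqrt_pos.2 hq
  rw [hev.deriv_eq]
  have h := ((hasDerivAt_const q (1 : ℝ)).div ((Real.hasDerivAt_sqrt hq.ne').const_mul 2) (by positivity)).deriv
  rw [show (fun s => 1 / (2 * Real.sqrt s)) = (fun _ => (1 : ℝ)) / (fun s => 2 * Real.sqrt s) from rfl, h]
  field_simp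
  ring

lemma norm_cd {c y : Euc N} (h : y ≠ c) : ContDiffAt ℝ 2 (fun x : Euc N => ‖x - c‖) y := by
  have h1 : ContDiffAt ℝ 2 (fun x : Euc N => x - c) y := contDiffAt_id.sub contDiffAt_const
  exact h1.norm ℝ (sub_ne_zero.2 h)

lemma norm_eq_sqrt (c : Euc N) : (fun x : Euc N => ‖x - c‖) = fun x => Real.sqrt (‖x - c‖ ^ 2) := by
  funext x; rw [Real.sqrt_sq (norm_nonneg _)]

lemma lapl_norm {c y : Euc N} (h : y ≠ c) : lapl (fun x : Euc N => ‖x - c‖) y = (N - 1) / ‖y - c‖ := by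
  have hp : 0 < ‖y - c‖ := norm_pos_iff.2 (sub_ne_zero.2 h)
  have hq : 0 < ‖y - c‖ ^ 2 := by positivity
  rw [norm_eq_sqrt, lapl_comp (d := fun x => ‖x - c‖ ^ 2) (contDiff_normsq c).contDiffAt
    (Real.contDiffAt_sqrt hq.ne'), grad_normsq, lapl_normsq, sqrt_d2 hq,
    (Real.hasDerivAt_sqrt hq.ne').deriv, Real.sqrt_sq hp.le, norm_smul]
  simp only [Real.norm_eq_abs, abs_two]
  field_simp
  ring

lemma grad_norm {c y : Euc N} (h : y ≠ c) : ‖gradient (fun x : Euc N => ‖x - c‖) y‖ = 1 := by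
  have hp : 0 < ‖y - c‖ := norm_pos_iff.2 (sub_ne_zero.2 h)
  have hq : 0 < ‖y - c‖ ^ 2 := by positivity
  rw [norm_eq_sqrt, grad_comp (d := fun x => ‖x - c‖ ^ 2) ((contDiff_normsq c).contDiffAt.differentiableAt (by norm_num))
    (Real.hasDerivAt_sqrt hq.ne').differentiableAt, grad_normsq,
    (Real.hasDerivAt_sqrt hq.ne').deriv, Real.sqrt_sq hp.le, norm_smul, norm_smul]
  simp only [Real.norm_eq_abs, abs_two]
  rw [abs_of_pos (by positivity)]
  field_simp

/-- the radial barrier -/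
noncomputable def rb (A α e R s : ℝ) : ℝ := A * (s ^ α + R ^ α - (R - s) ^ α) - e * Real.log (1 - s / R)

lemma rb_hd {A α e R s : ℝ} (hs : 0 < s) (hsR : s < R) :
    HasDerivAt (rb A α e R) (A * α * (s ^ (α - 1) + (R - s) ^ (α - 1)) + e * (R - s)⁻¹) s := by
  have hR : 0 < R := hs.trans hsR
  have h1 : HasDerivAt (fun s : ℝ => s ^ α) (α * s ^ (α - 1)) s := Real.hasDerivAt_rpow_const (Or.inl hs.ne')
  have h2 : HasDerivAt (fun s : ℝ => R - s) (-1) s := by simpa using (hasDerivAt_id s).const_sub R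
  have h3 : HasDerivAt (fun s : ℝ => (R - s) ^ α) (-1 * α * (R - s) ^ (α - 1)) s :=
    h2.rpow_const (Or.inl (by linarith))
  have h4 : HasDerivAt (fun s : ℝ => 1 - s / R) (- (1 / R)) s := by
    simpa using ((hasDerivAt_id s).div_const R).const_sub 1
  have h5 : 1 - s / R ≠ 0 := by
    have : s / R < 1 := by rw [div_lt_one hR]; exact hsR
    linarith
  have h6 := (((h1.add_const (R ^ α)).sub h3).const_mul A).sub ((h4.log h5).const_mul e)
  refine h6.congr_deriv ?_
  have : R - s ≠ 0 := by linarith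
  have h7 : - (1 / R) / (1 - s / R) = - (R - s)⁻¹ := by field_simp
  rw [h7]; ring

lemma rb_cd {A α e R s : ℝ} (hs : 0 < s) (hsR : s < R) : ContDiffAt ℝ 2 (rb A α e R) s := by
  have hR : 0 < R := hs.trans hsR
  have h5 : 1 - s / R ≠ 0 := by
    have : s / R < 1 := by rw [div_lt_one hR]; exact hsR
    linarith
  unfold rb
  have h1 : ContDiffAt ℝ 2 (fun s : ℝ => s ^ α) s := contDiffAt_id.rpow_const_of_ne hs.ne'
  have h2 : ContDiffAt ℝ 2 (fun s : ℝ => (R - s) ^ α) s :=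
    (contDiffAt_const.sub contDiffAt_id).rpow_const_of_ne (by simp only [id]; linarith)
  have h3 : ContDiffAt ℝ 2 (fun s : ℝ => Real.log (1 - s / R)) s :=
    (contDiffAt_const.sub (contDiffAt_id.div_const R)).log h5
  exact (contDiffAt_const.mul ((h1.add contDiffAt_const).sub h2)).sub (contDiffAt_const.mul h3)

lemma rb_d2 {A α e R s : ℝ} (hs : 0 < s) (hsR : s < R) :
    deriv (deriv (rb A α e R)) s =
      A * α * ((α - 1) * s ^ (α - 1 - 1) + (1 - α) * (R - s) ^ (α - 1 - 1)) + e * ((R - s)⁻¹) ^ 2 := by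
  have hev : deriv (rb A α e R) =ᶠ[𝓝 s] fun s => A * α * (s ^ (α - 1) + (R - s) ^ (α - 1)) + e * (R - s)⁻¹ := by
    filter_upwards [lt_mem_nhds hs, gt_mem_nhds hsR] with y h1 h2
    exact (rb_hd h1 h2).deriv
  rw [hev.deriv_eq]
  have h1 : HasDerivAt (fun s : ℝ => s ^ (α - 1)) ((α - 1) * s ^ (α - 1 - 1)) s :=
    Real.hasDerivAt_rpow_const (Or.inl hs.ne')
  have h2 : HasDerivAt (fun s : ℝ => R - s) (-1) s := by simpa using (hasDerivAt_id s).const_sub R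
  have h0 : R - s ≠ 0 := by linarith
  have h3 : HasDerivAt (fun s : ℝ => (R - s) ^ (α - 1)) (-1 * (α - 1) * (R - s) ^ (α - 1 - 1)) s :=
    h2.rpow_const (Or.inl h0)
  have h6 := ((h1.add h3).const_mul (A * α)).add ((h2.inv h0).const_mul e)
  refine (h6.congr_deriv ?_).deriv
  field_simp
  ring

/-- The key differential inequality -/
lemma rb_ineq {A m e R s C : ℝ} (hm : 2 < m) (hs : 0 < s) (hsR : s < R) (hR1 : R ≤ 1) (he : 0 < e)
    (hA1 : 1 ≤ A * ((m - 2) / (m - 1))) (hAN : 2 * (N + 1) ≤ A * ((m - 2) / (m - 1)))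
    (hAC : C ≤ A * ((m - 2) / (m - 1))) :
    C < - (deriv (deriv (rb A ((m - 2) / (m - 1)) e R)) s + deriv (rb A ((m - 2) / (m - 1)) e R) s * ((N - 1) / s))
      + (deriv (rb A ((m - 2) / (m - 1)) e R) s) ^ m ∧ 0 ≤ deriv (rb A ((m - 2) / (m - 1)) e R) s := by
  set α := (m - 2) / (m - 1) with hα
  have hm1 : 0 < m - 1 := by linarith
  have hα0 : 0 < α := div_pos (by linarith) hm1
  have hα1 : α < 1 := by rw [hα, div_lt_one hm1]; linarith
  have hRs : 0 < R - s := by linarith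
  have hexp : (α - 1) * (m - 1) = -1 := by rw [hα]; field_simp; ring
  set B := A * α with hB
  set a := s ^ (α - 1) with ha
  set b := (R - s) ^ (α - 1) with hb
  have ha0 : 0 < a := Real.rpow_pos_of_pos hs _
  have hb0 : 0 < b := Real.rpow_pos_of_pos hRs _
  have ha1 : 1 ≤ a := Real.one_le_rpow_of_pos_of_le_one_of_nonpos hs (by linarith) (by linarith)
  set a' := a ^ (m - 1) with ha'
  set b' := b ^ (m - 1) with hb'
  have ea : a' = s⁻¹ := by
    rw [ha', ha, ← Real.rpow_mul hs.le, hexp, Real.rpow_neg_one]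
  have eb : b' = (R - s)⁻¹ := by
    rw [hb', hb, ← Real.rpow_mul hRs.le, hexp, Real.rpow_neg_one]
  have fa : s ^ (α - 1 - 1) = a * a' := by
    rw [ea, Real.rpow_sub_one hs.ne', div_eq_mul_inv]
  have fb : (R - s) ^ (α - 1 - 1) = b * b' := by
    rw [eb, Real.rpow_sub_one hRs.ne', div_eq_mul_inv]
  have ha'1 : 1 ≤ a' := Real.one_le_rpow ha1 hm1.le
  have hb'0 : 0 < b' := Real.rpow_pos_of_pos hb0 _
  rw [rb_d2 hs hsR, (rb_hd hs hsR).deriv, fa, fb, ← eb, div_eq_mul_inv, ← ea, ← hB]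
  set p := B * (a + b) + e * b' with hp
  have hB0 : 0 < B := by linarith
  have hp0 : 0 < p := by positivity
  refine ⟨?_, hp0.le⟩
  have hpm : p ^ m = p ^ (m - 1) * p := by
    rw [Real.rpow_sub_one hp0.ne']; field_simp
  have g1 : (2 * (N + 1)) * a' ≤ p ^ (m - 1) := by
    calc (2 * ((N : ℝ) + 1)) * a' ≤ B ^ (m - 1) * a' := by
          gcongr
          refine hAN.trans ?_
          have := Real.rpow_le_rpow_of_exponent_le hA1 (show 1 ≤ m - 1 by linarith)
          rwa [Real.rpow_one] at this
      _ = (B * a) ^ (m - 1) := by rw [Real.mul_rpow hB0.le ha0.le]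
      _ ≤ p ^ (m - 1) := by
          gcongr
          rw [hp]
          have : 0 ≤ B * b + e * b' := by positivity
          linarith
  have g2 : (2 * (N + 1)) * b' ≤ p ^ (m - 1) := by
    calc (2 * ((N : ℝ) + 1)) * b' ≤ B ^ (m - 1) * b' := by
          gcongr
          refine hAN.trans ?_
          have := Real.rpow_le_rpow_of_exponent_le hA1 (show 1 ≤ m - 1 by linarith)
          rwa [Real.rpow_one] at this
      _ = (B * b) ^ (m - 1) := by rw [Real.mul_rpow hB0.le hb0.le]
      _ ≤ p ^ (m - 1) := by
          gcongr
          rw [hp]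
          have : 0 ≤ B * a + e * b' := by positivity
          linarith
  have g3 : (N + 1) * (a' + b') * p ≤ p ^ m := by
    rw [hpm]
    gcongr
    linarith
  have hN0 : (0 : ℝ) ≤ N := Nat.cast_nonneg N
  have g4 : B * ((α - 1) * (a * a') + (1 - α) * (b * b')) + e * b' ^ 2 ≤ b' * p := by
    have h1 : 0 ≤ B * ((1 - α) * (a * a')) := by
      have : 0 ≤ 1 - α := by linarith
      positivity
    have h2 : 0 ≤ B * (α * (b * b')) := by positivity
    have h3 : 0 ≤ B * a * b' := by positivity
    have h4 : b' * p = B * a * b' + B * (b * b') + e * b' ^ 2 := by rw [hp]; ring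
    rw [h4]; linarith
  have g5 : C < 2 * a' * p := by
    have h1 : B ≤ p := by
      have : 0 ≤ B * b + e * b' := by positivity
      have : B * 1 ≤ B * a := by gcongr
      rw [hp]; linarith
    have h2 : 1 * p ≤ a' * p := by gcongr
    linarith
  have g6 : 0 ≤ N * b' * p := by positivity
  linarith

end VS

namespace VS

variable {N : ℕ}

lemma rb_zero {A α e R : ℝ} (hα : 0 < α) : rb A α e R 0 = 0 := by
  unfold rb; simp [Real.zero_rpow hα.ne']

lemma rb_cont {A α e R s : ℝ} (hα : 0 < α) (hR : 0 < R) (hsR : s < R) : ContinuousAt (rb A α e R) s := by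
  have h5 : 1 - s / R ≠ 0 := by
    have : s / R < 1 := by rw [div_lt_one hR]; exact hsR
    linarith
  unfold rb
  have h1 : ContinuousAt (fun s : ℝ => s ^ α) s := Real.continuousAt_rpow_const _ _ (Or.inr hα.le)
  have h2 : ContinuousAt (fun s : ℝ => (R - s) ^ α) s :=
    (by fun_prop : ContinuousAt (fun s : ℝ => R - s) s).rpow_const (Or.inr hα.le)
  have h3 : ContinuousAt (fun s : ℝ => Real.log (1 - s / R)) s :=
    (by fun_prop : ContinuousAt (fun s : ℝ => 1 - s / R) s).log h5
  exact (continuousAt_const.mul ((h1.add continuousAt_const).sub h2)).sub (continuousAt_const.mul h3)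

lemma rb_ge {A α e R s : ℝ} (hα : 0 < α) (hA : 0 ≤ A) (hs : 0 ≤ s) (hsR : s < R) :
    - (e * Real.log (1 - s / R)) ≤ rb A α e R s := by
  unfold rb
  have h1 : (R - s) ^ α ≤ R ^ α := by
    apply Real.rpow_le_rpow <;> linarith
  have h2 : 0 ≤ s ^ α := by positivity
  have : 0 ≤ A * (s ^ α + R ^ α - (R - s) ^ α) := mul_nonneg hA (by linarith)
  linarith

lemma rb_le {A α e R s : ℝ} (hα : 0 < α) (hA : 0 ≤ A) (hs : 0 ≤ s) (hsR : s < R) :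
    rb A α e R s ≤ 2 * A * R ^ α - e * Real.log (1 - s / R) := by
  unfold rb
  have h1 : s ^ α ≤ R ^ α := by
    apply Real.rpow_le_rpow <;> linarith
  have h2 : 0 ≤ (R - s) ^ α := Real.rpow_nonneg (by linarith) _
  have : A * (s ^ α + R ^ α - (R - s) ^ α) ≤ A * (2 * R ^ α) := by gcongr; linarith
  linarith

set_option maxHeartbeats 1000000 in
lemma ball_est {w : Euc N → ℝ} {m A C R M : ℝ} {c : Euc N} (hm : 2 < m) (hR0 : 0 < R) (hR1 : R ≤ 1)
    (hA1 : 1 ≤ A * ((m - 2) / (m - 1))) (hAN : 2 * (N + 1) ≤ A * ((m - 2) / (m - 1)))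
    (hAC : C ≤ A * ((m - 2) / (m - 1)))
    (hw : UpperSemicontinuousOn w (ball c R)) (hM : ∀ y ∈ ball c R, w y ≤ M)
    (hsub : ∀ (θ : Euc N → ℝ), ∀ y ∈ ball c R, ContDiffAt ℝ 2 θ y → (∀ᶠ x in 𝓝 y, w x - θ x ≤ w y - θ y) →
      - lapl θ y + ‖gradient θ y‖ ^ m ≤ C) :
    ∀ x ∈ ball c R, w x ≤ w c + 2 * A * R ^ ((m - 2) / (m - 1)) := by
  have hα0 : 0 < (m - 2) / (m - 1) := div_pos (by linarith) (by linarith)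
  have hA0 : 0 ≤ A := by
    by_contra hcc
    have := mul_neg_of_neg_of_pos (not_le.1 hcc) hα0
    linarith
  -- main claim
  have key : ∀ e > 0, ∀ x ∈ ball c R, w x ≤ w c + rb A ((m - 2) / (m - 1)) e R ‖x - c‖ := by
    intro e he x₁ hx₁
    by_contra hcon
    push Not at hcon
    set α := (m - 2) / (m - 1) with hα
    have hx₁' : ‖x₁ - c‖ < R := by rw [← dist_eq_norm]; exact hx₁
    have hblow : ∃ R' < R, 0 < R' ∧ ∀ s, R' ≤ s → s < R → M - w c < rb A α e R s := by
      have ht : Real.exp (- ((|M - w c| + 1) / e)) > 0 := Real.exp_pos _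
      set q := Real.exp (- ((|M - w c| + 1) / e)) with hq
      have hq1 : q < 1 := by
        rw [hq, Real.exp_lt_one_iff]
        have : 0 < (|M - w c| + 1) / e := by positivity
        linarith
      refine ⟨R * (1 - q), by nlinarith, mul_pos hR0 (by linarith), fun s hs1 hs2 => ?_⟩
      have hs0 : 0 ≤ s := le_trans (mul_nonneg hR0.le (by linarith)) hs1
      refine lt_of_lt_of_le ?_ (rb_ge hα0 hA0 hs0 hs2)
      have h1 : 1 - s / R ≤ q := by
        have : 1 - q ≤ s / R := by rw [le_div_iff₀ hR0]; linarith
        linarith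
      have h0 : 0 < 1 - s / R := by
        have : s / R < 1 := by rw [div_lt_one hR0]; exact hs2
        linarith
      have h2 := Real.log_le_log h0 h1
      rw [hq, Real.log_exp] at h2
      have h3 : e * Real.log (1 - s / R) ≤ e * (- ((|M - w c| + 1) / e)) := by gcongr
      have h4 : e * (- ((|M - w c| + 1) / e)) = - (|M - w c| + 1) := by field_simp
      have := le_abs_self (M - w c)
      linarith
    obtain ⟨R', hR'R, hR'0, hbl⟩ := hblow
    have hsubb : closedBall c R' ⊆ ball c R := closedBall_subset_ball hR'R
    have hθc : ∀ y ∈ ball c R, ContinuousAt (fun y => rb A α e R ‖y - c‖) y := by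
      intro y hy
      have hy : ‖y - c‖ < R := by rw [← dist_eq_norm]; exact hy
      exact ContinuousAt.comp (g := rb A α e R) (f := fun y : Euc N => ‖y - c‖) (x := y)
        (rb_cont hα0 hR0 hy) (by fun_prop)
    have husc : UpperSemicontinuousOn (fun y => w y + - rb A α e R ‖y - c‖) (closedBall c R') := by
      refine (hw.mono hsubb).add ?_
      exact ContinuousOn.upperSemicontinuousOn
        (fun y hy => (hθc y (hsubb hy)).continuousWithinAt.neg)
    obtain ⟨y, hyB, hymax⟩ := husc.exists_isMaxOn (⟨c, mem_closedBall_self hR'0.le⟩) (isCompact_closedBall c R')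
    have hymax : ∀ x ∈ closedBall c R', w x + - rb A α e R ‖x - c‖ ≤ w y + - rb A α e R ‖y - c‖ := hymax
    have hx₁B : x₁ ∈ closedBall c R' := by
      rw [mem_closedBall, dist_eq_norm]
      by_contra hcc
      have := hbl _ (not_le.1 hcc).le hx₁'
      have := hM x₁ hx₁
      linarith
    have hv := hymax x₁ hx₁B
    have hyc : y ≠ c := by
      rintro rfl
      rw [sub_self, norm_zero, rb_zero hα0] at hv
      linarith
    have hyR' : ‖y - c‖ < R' := by
      have h1 : ‖y - c‖ ≤ R' := by rw [← dist_eq_norm]; exact hyB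
      rcases h1.lt_or_eq with h | h
      · exact h
      · have := hbl R' le_rfl hR'R
        have := hM y (hsubb hyB)
        rw [h] at hv
        linarith
    have hyR : ‖y - c‖ < R := hyR'.trans hR'R
    have hy0 : 0 < ‖y - c‖ := norm_pos_iff.2 (sub_ne_zero.2 hyc)
    have hcd : ContDiffAt ℝ 2 (fun x => rb A α e R ‖x - c‖) y :=
      ContDiffAt.comp (g := rb A α e R) (f := fun x : Euc N => ‖x - c‖) y (rb_cd hy0 hyR) (norm_cd hyc)
    have hfin := hsub (fun x => rb A α e R ‖x - c‖) y (hsubb hyB) hcd (by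
      have : y ∈ ball c R' := by rw [mem_ball, dist_eq_norm]; exact hyR'
      filter_upwards [isOpen_ball.mem_nhds this] with x hx
      have := hymax x (ball_subset_closedBall hx)
      linarith)
    rw [lapl_comp (d := fun x : Euc N => ‖x - c‖) (norm_cd hyc) (rb_cd hy0 hyR),
      grad_comp (d := fun x : Euc N => ‖x - c‖) ((norm_cd hyc).differentiableAt (by norm_num))
        ((rb_cd hy0 hyR).differentiableAt (by norm_num)), norm_smul, lapl_norm hyc, grad_norm hyc] at hfin
    obtain ⟨i1, i2⟩ := rb_ineq (N := N) hm hy0 hyR hR1 he hA1 hAN hAC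
    rw [Real.norm_eq_abs, abs_of_nonneg i2] at hfin
    simp only [one_pow, mul_one] at hfin
    linarith
  intro x hx
  have hx' : ‖x - c‖ < R := by rw [← dist_eq_norm]; exact hx
  refine le_of_forall_pos_le_add fun η hη => ?_
  set l := - Real.log (1 - ‖x - c‖ / R) with hl
  have hl0 : 0 ≤ l := by
    rw [hl]
    have h1 : 1 - ‖x - c‖ / R ≤ 1 := by
      have : 0 ≤ ‖x - c‖ / R := by positivity
      linarith
    have h0 : 0 ≤ 1 - ‖x - c‖ / R := by
      have : ‖x - c‖ / R < 1 := by rw [div_lt_one hR0]; exact hx'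
      linarith
    have := Real.log_nonpos h0 h1
    linarith
  have h1 := key (η / (l + 1)) (by positivity) x hx
  have h2 := rb_le (A := A) (e := η / (l + 1)) hα0 hA0 (norm_nonneg (x - c)) hx'
  have h3 : η / (l + 1) * l ≤ η := by
    rw [div_mul_eq_mul_div, div_le_iff₀ (by positivity)]; nlinarith
  have h4 : η / (l + 1) * l = - (η / (l + 1) * Real.log (1 - ‖x - c‖ / R)) := by rw [hl]; ring
  linarith

set_option maxHeartbeats 1000000 in
/-- One-sided time regularity of the maximal subsolution. -/
lemma time_shift {Ω : Set (Euc N)} (hΩo : IsOpen Ω) {m lam : ℝ} {f a : Euc N → ℝ} (hlam : 0 ≤ lam)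
    (ha : ContDiff ℝ 2 a) {K : ℝ} (hK0 : 0 ≤ K)
    (hLs : GSub (Ω ×ˢ Ioi 0) (Ω ×ˢ Ioi 0) (Gf 1 m lam f (fun z => a z.1 - K * z.2)) (fun z => a z.1 - K * z.2))
    {U us : Euc N × ℝ → ℝ} (hUa : ∀ z ∈ closure Ω ×ˢ Ici (0 : ℝ), a z.1 ≤ U z)
    (hU0 : ∀ x ∈ closure Ω, U (x, 0) ≤ a x)
    (hUm : ∀ x ∈ closure Ω, ∀ s t : ℝ, 0 ≤ s → s ≤ t → U (x, s) ≤ U (x, t))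
    (husc : UpperSemicontinuousOn us (closure Ω ×ˢ Ici 0))
    (hsub : GSub (Ω ×ˢ Ioi 0) (Ω ×ˢ Ioi 0) (Gf 1 m lam f us) us)
    (hleU : ∀ z ∈ closure Ω ×ˢ Ici (0 : ℝ), us z ≤ U z)
    (hmax : ∀ w, UpperSemicontinuousOn w (Ω ×ˢ Ioi 0) → GSub (Ω ×ˢ Ioi 0) (Ω ×ˢ Ioi 0) (Gf 1 m lam f w) w →
        (∀ z ∈ Ω ×ˢ Ioi (0 : ℝ), w z ≤ U z) → ∀ z ∈ Ω ×ˢ Ioi (0 : ℝ), w z ≤ us z) :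
    ∀ x ∈ Ω, ∀ s t : ℝ, 0 < s → s ≤ t → us (x, s) - K * (t - s) ≤ us (x, t) := by
  classical
  intro x₀ hx₀ s₀ t₀ hs₀ hst
  rcases hst.eq_or_lt with h | hst
  · subst h; simp
  set h := t₀ - s₀ with hh
  have hh0 : 0 < h := by linarith
  set v : Euc N × ℝ → ℝ := fun z => us (z.1, z.2 - h) - K * h with hv
  set L : Euc N × ℝ → ℝ := fun z => a z.1 - K * z.2 with hL
  have hLc : Continuous L := by have := ha.continuous; fun_prop
  set w : Euc N × ℝ → ℝ := fun z => if h < z.2 then max (L z) (v z) else L z with hw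
  have w1 : ∀ z : Euc N × ℝ, h < z.2 → w z = max (L z) (v z) := fun z hz => by simp only [hw, if_pos hz]
  have w2 : ∀ z : Euc N × ℝ, ¬ h < z.2 → w z = L z := fun z hz => by simp only [hw, if_neg hz]
  have w3 : ∀ z, L z ≤ w z := fun z => by
    by_cases hz : h < z.2
    · rw [w1 z hz]; exact le_max_left _ _
    · rw [w2 z hz]
  -- upper semicontinuity of the shifted function
  have hvu : ∀ z ∈ Ω ×ˢ Ioi (0 : ℝ), h ≤ z.2 → ∀ M, v z < M → ∀ᶠ y in 𝓝 z, y ∈ Ω ×ˢ Ioi (0 : ℝ) → h ≤ y.2 → v y < M := by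
    intro z hz hzh M hM
    have h1 : ∀ᶠ y in 𝓝[closure Ω ×ˢ Ici 0] (z.1, z.2 - h), us y < M + K * h :=
      husc (z.1, z.2 - h) ⟨subset_closure hz.1, (show (0:ℝ) ≤ z.2 - h by linarith)⟩ (M + K * h)
        (show us (z.1, z.2 - h) < M + K * h by simp only [hv] at hM; linarith)
    rw [eventually_nhdsWithin_iff] at h1
    have hc : ContinuousAt (fun y : Euc N × ℝ => (y.1, y.2 - h)) z := by fun_prop
    filter_upwards [hc.eventually h1] with y hy hyQ hyh
    have := hy ⟨subset_closure hyQ.1, (show (0:ℝ) ≤ y.2 - h by linarith)⟩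
    simp only [hv]; linarith
  have hwusc : UpperSemicontinuousOn w (Ω ×ˢ Ioi 0) := by
    intro z hz M hM
    have hM : w z < M := hM
    have a1 : ∀ᶠ y in 𝓝 z, L y < M := hLc.continuousAt.eventually (gt_mem_nhds (lt_of_le_of_lt (w3 z) hM))
    rcases lt_or_ge z.2 h with hzh | hzh
    · have a2 : ∀ᶠ y in 𝓝 z, y.2 < h := continuous_snd.continuousAt.eventually (gt_mem_nhds hzh)
      refine nhdsWithin_le_nhds ?_
      filter_upwards [a1, a2] with y h1 h2
      show w y < M
      rw [w2 y (by linarith)]; exact h1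
    · have hvz : v z < M := by
        rcases hzh.lt_or_eq with h' | h'
        · rw [w1 z h'] at hM; exact (max_lt_iff.1 hM).2
        · rw [w2 z (by linarith)] at hM
          have e1 := hleU (z.1, 0) ⟨subset_closure hz.1, (le_refl (0:ℝ))⟩
          have e2 := hU0 z.1 (subset_closure hz.1)
          have e3 : v z = us (z.1, 0) - K * h := by simp only [hv]; rw [← h', sub_self]
          have e4 : L z = a z.1 - K * h := by simp only [hL]; rw [← h']
          linarith
      refine eventually_nhdsWithin_iff.2 ?_
      filter_upwards [a1, hvu z hz hzh M hvz] with y h1 h2 hyQ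
      show w y < M
      by_cases hy : h < y.2
      · rw [w1 y hy]; exact max_lt h1 (h2 hyQ hy.le)
      · rw [w2 y hy]; exact h1
  have hwsub : GSub (Ω ×ˢ Ioi 0) (Ω ×ˢ Ioi 0) (Gf 1 m lam f w) w := by
    refine gsub_glue fun z hz => ?_
    by_cases hzL : w z = L z
    · exact ⟨L, _, hz, hLs, hzL.symm, Eventually.of_forall w3⟩
    · have hzh : h < z.2 := by
        by_contra hcc
        exact hzL (w2 z hcc)
      have hzv : v z = w z := by
        rw [w1 z hzh] at hzL ⊢
        rcases max_choice (L z) (v z) with h | h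
        · exact absurd h hzL
        · exact h.symm
      refine ⟨v, {z}, rfl, ?_, hzv, ?_⟩
      · rintro φ hφ z' rfl hmx
        have hmx : ∀ᶠ y in 𝓝[Ω ×ˢ Ioi 0] z', v y - φ y ≤ v z' - φ z' := hmx
        have e0 : (z'.1, z'.2 - h) + ((0, h) : Euc N × ℝ) = z' := by ext <;> simp
        have := hsub (fun y => φ (y + (0, h))) (hφ.comp (contDiff_id.add contDiff_const)) (z'.1, z'.2 - h)
          ⟨hz.1, (show (0:ℝ) < z'.2 - h by linarith)⟩ (by
            rw [eventually_nhdsWithin_iff] at hmx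
            have hc : ContinuousAt (fun y : Euc N × ℝ => y + ((0, h) : Euc N × ℝ)) (z'.1, z'.2 - h) := by fun_prop
            have hc2 : Tendsto (fun y : Euc N × ℝ => y + ((0, h) : Euc N × ℝ)) (𝓝 (z'.1, z'.2 - h)) (𝓝 z') := by
              have := hc.tendsto; rwa [e0] at this
            refine eventually_nhdsWithin_iff.2 ?_
            filter_upwards [hc2.eventually hmx] with y hy hyQ
            have hy2 : (0:ℝ) < y.2 := hyQ.2
            have := hy ⟨by simpa using hyQ.1, (show (0:ℝ) < y.2 + h by linarith)⟩
            simp only [hv] at this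
            have e1 : ((y + ((0, h) : Euc N × ℝ)).1, (y + ((0, h) : Euc N × ℝ)).2 - h) = y := by ext <;> simp
            rw [e1] at this
            rw [e0]; linarith)
        rw [dT_translate, dX_translate, dL_translate, e0] at this
        unfold Gf at this ⊢
        have e2 : lam * v z' ≤ lam * us (z'.1, z'.2 - h) := by
          refine mul_le_mul_of_nonneg_left ?_ hlam
          simp only [hv]
          have : 0 ≤ K * h := by positivity
          linarith
        simp only at this
        linarith
      · refine nhdsWithin_le_nhds ?_
        filter_upwards [continuous_snd.continuousAt.eventually (lt_mem_nhds hzh)] with y hy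
        rw [w1 y hy]; exact le_max_right _ _
  have hwU : ∀ z ∈ Ω ×ˢ Ioi (0 : ℝ), w z ≤ U z := by
    intro z hz
    have hzt : (0:ℝ) < z.2 := hz.2
    have hzc : z ∈ closure Ω ×ˢ Ici (0 : ℝ) := ⟨subset_closure hz.1, hzt.le⟩
    have e1 : L z ≤ U z := by
      have := hUa z hzc
      have : 0 ≤ K * z.2 := by positivity
      simp only [hL]; linarith
    by_cases hzh : h < z.2
    · rw [w1 z hzh]
      refine max_le e1 ?_
      have e2 := hleU (z.1, z.2 - h) ⟨hzc.1, (show (0:ℝ) ≤ z.2 - h by linarith)⟩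
      have e3 := hUm z.1 hzc.1 (z.2 - h) z.2 (by linarith) (by linarith)
      have : 0 ≤ K * h := by positivity
      simp only [hv]; linarith
    · rw [w2 z hzh]; exact e1
  have hfin := hmax w hwusc hwsub hwU (x₀, t₀) ⟨hx₀, (show (0:ℝ) < t₀ by linarith)⟩
  rw [w1 _ (show h < t₀ by linarith)] at hfin
  have h2 := (le_max_right _ _).trans hfin
  simp only [hv] at h2
  rwa [show t₀ - h = s₀ by rw [hh]; ring] at h2

end VS

namespace VS

variable {N : ℕ}

lemma slice_sub {Ω : Set (Euc N)} (hΩo : IsOpen Ω) {m lam : ℝ} {f : Euc N → ℝ} (hm : 0 < m) (hlam : 0 ≤ lam)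
    (hf : ContinuousOn f (closure Ω)) {K : ℝ} {us : Euc N × ℝ → ℝ}
    (hT : ∀ x ∈ Ω, ∀ s t : ℝ, 0 < s → s ≤ t → us (x, s) - K * (t - s) ≤ us (x, t))
    (husc : UpperSemicontinuousOn us (closure Ω ×ˢ Ici 0))
    (hsub : GSub (Ω ×ˢ Ioi 0) (Ω ×ˢ Ioi 0) (Gf 1 m lam f us) us)
    {x₀ : Euc N} (hx₀ : x₀ ∈ Ω) {t₀ : ℝ} (ht₀ : 0 < t₀) {θ : Euc N → ℝ} (hθ : ContDiffAt ℝ 2 θ x₀)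
    (hmx : ∀ᶠ x in 𝓝 x₀, us (x, t₀) - θ x ≤ us (x₀, t₀) - θ x₀) :
    - lapl θ x₀ + ‖gradient θ x₀‖ ^ m ≤ K + f x₀ - lam * us (x₀, t₀) := by
  have hQo : IsOpen (Ω ×ˢ Ioi (0 : ℝ)) := hΩo.prod isOpen_Ioi
  have hz : ((x₀, t₀) : Euc N × ℝ) ∈ Ω ×ˢ Ioi (0 : ℝ) := ⟨hx₀, ht₀⟩
  have hb : ContDiff ℝ 2 (fun t : ℝ => K * (t₀ - t)) := contDiff_const.mul (contDiff_const.sub contDiff_id)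
  have hφ : ContDiffAt ℝ 2 (fun z : Euc N × ℝ => θ z.1 + (fun t : ℝ => K * (t₀ - t)) z.2) (x₀, t₀) :=
    (cd_fst (z := (x₀, t₀)) hθ).add (cd_snd (z := (x₀, t₀)) (b := fun t : ℝ => K * (t₀ - t)) hb.contDiffAt)
  obtain ⟨ψ, hψ, hψe⟩ := exists_global hφ
  obtain ⟨R, hR, hRc⟩ := open_compact hQo hz
  have key := terminal (C := Ω) (D := Ω ×ˢ Ioi (0 : ℝ)) hR hRc hz (fun z hz => hz.1)
    ((hf x₀ (subset_closure hx₀)).mono subset_closure) hm hlam hψ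
    (husc.mono (prod_mono subset_closure Ioi_subset_Ici_self)) hsub one_pos (fun y hy _ _ => hy)
    (by
      refine localMaxOn_congr hψe ?_
      have h1 : ∀ᶠ z : Euc N × ℝ in 𝓝 (x₀, t₀), us (z.1, t₀) - θ z.1 ≤ us (x₀, t₀) - θ x₀ :=
        (continuous_fst.tendsto ((x₀, t₀) : Euc N × ℝ)).eventually hmx
      rw [IsLocalMaxOn, IsMaxFilter]
      filter_upwards [mem_nhdsWithin_of_mem_nhds h1, self_mem_nhdsWithin] with z hz1 hz2
      have h2 := hT z.1 hz2.1.1 z.2 t₀ hz2.1.2 hz2.2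
      have h3 : us z = us (z.1, z.2) := rfl
      rw [h3]
      have : us (z.1, t₀) - θ z.1 ≤ us (x₀, t₀) - θ x₀ := hz1
      linarith)
  rw [dT_congr hψe, dL_congr hψe, dX_congr hψe, dT_split (z := (x₀, t₀)) (a := θ) (b := fun t : ℝ => K * (t₀ - t)),
    dX_split (z := (x₀, t₀)) (a := θ) (b := fun t : ℝ => K * (t₀ - t)),
    dL_split (z := (x₀, t₀)) (a := θ) (b := fun t : ℝ => K * (t₀ - t))] at key
  have hd : deriv (fun t : ℝ => K * (t₀ - t)) t₀ = - K := by
    have : HasDerivAt (fun t : ℝ => K * (t₀ - t)) (K * (0 - 1)) t₀ :=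
      ((hasDerivAt_const t₀ t₀).sub (hasDerivAt_id t₀)).const_mul K
    rw [this.deriv]; ring
  dsimp only at key
  rw [hd] at key
  unfold Gf at key
  dsimp only at key
  linarith

lemma taylor2 {ρ : Euc N → ℝ} (hρ : ContDiff ℝ 2 ρ) (x₀ : Euc N) :
    ∃ r > (0 : ℝ), ∃ H > (0 : ℝ), ∀ x y, dist x x₀ < r → dist y x₀ < r →
      ρ y ≤ ρ x + inner ℝ (gradient ρ x) (y - x) + H * ‖y - x‖ ^ 2 := by
  have h1 : ContDiffAt ℝ 1 (fderiv ℝ ρ) x₀ := (hρ.fderiv_right (m := 1) (by norm_num)).contDiffAt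
  obtain ⟨H, t, ht, hL⟩ := h1.exists_lipschitzOnWith
  obtain ⟨r, hr, hrt⟩ := Metric.mem_nhds_iff.1 ht
  refine ⟨r, hr, H + 1, by positivity, fun x y hx hy => ?_⟩
  have hd : Differentiable ℝ ρ := hρ.differentiable (by norm_num)
  have hcv : Convex ℝ (ball x₀ r ∩ closedBall x ‖y - x‖) := (convex_ball _ _).inter (convex_closedBall _ _)
  have := hcv.norm_image_sub_le_of_norm_fderiv_le' (𝕜 := ℝ) (f := ρ) (φ := fderiv ℝ ρ x) (C := H * ‖y - x‖)
    (x := x) (y := y) (fun z _ => hd z) (fun z hz => by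
      have := hL.dist_le_mul z (hrt hz.1) x (hrt hx)
      rw [dist_eq_norm] at this
      refine this.trans (mul_le_mul_of_nonneg_left ?_ H.2)
      exact hz.2)
    ⟨hx, by simp⟩ ⟨hy, by simp [dist_eq_norm]⟩
  have h3 : fderiv ℝ ρ x (y - x) = inner ℝ (gradient ρ x) (y - x) := by
    unfold gradient; simp
  rw [h3, Real.norm_eq_abs] at this
  have h4 := (abs_le.1 this).2
  nlinarith [sq_nonneg ‖y - x‖]

lemma ball_arith {ε τ H p d q r s : ℝ} (hε : 0 < ε) (hH : 2 * ε * H ≤ 1) (hd : 0 ≤ d)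
    (h1 : d - 2 * ε * q + s < s + τ) (h2 : τ ≤ - (ε * p)) (hp : p < 0) (h3 : r ≤ p - q + H * d) : r < 0 := by
  have h4 : 2 * ε * r ≤ 2 * ε * (p - q + H * d) := by gcongr
  have h5 : 2 * ε * H * d ≤ 1 * d := by gcongr
  have h6 : ε * p < 0 := mul_neg_of_pos_of_neg hε hp
  have h7 : 2 * ε * r < 0 := by nlinarith
  by_contra hr
  push Not at hr
  have : 0 ≤ 2 * ε * r := by positivity
  linarith

lemma int_ball {Ω : Set (Euc N)} {ρ : Euc N → ℝ} (hρ : ContDiff ℝ 2 ρ) (hΩ : Ω = {x | ρ x < 0}) (x₀ : Euc N) :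
    ∃ r > (0 : ℝ), ∃ B > (0 : ℝ), ∃ ε₁ > (0 : ℝ), ∀ x ∈ Ω, dist x x₀ < r → ∀ ε > (0 : ℝ), ε < ε₁ →
      ∃ R > (0 : ℝ), R ≤ 2 * ε * B ∧ x ∈ ball (x + ε • (- gradient ρ x)) R ∧
        ball (x + ε • (- gradient ρ x)) R ⊆ Ω := by
  obtain ⟨r, hr, H, hH, hTay⟩ := taylor2 hρ x₀
  have hgc : Continuous (gradient ρ) := continuous_grad hρ
  obtain ⟨r1, hr1, hB⟩ := Metric.continuousAt_iff.1 (hgc.norm.continuousAt (x := x₀)) 1 one_pos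
  set B : ℝ := ‖gradient ρ x₀‖ + 1 with hBdef
  have hB0 : 0 < B := by positivity
  refine ⟨min (r / 2) r1, by positivity, B, hB0, min (1 / (2 * H)) (r / (8 * B)), by positivity, ?_⟩
  intro x hx hxr ε hε hεl
  have hρx : ρ x < 0 := by rw [hΩ] at hx; exact hx
  have hxr2 : dist x x₀ < r / 2 := hxr.trans_le (min_le_left _ _)
  have hn : ‖gradient ρ x‖ ≤ B := by
    have := hB (hxr.trans_le (min_le_right _ _))
    rw [Real.dist_eq] at this
    have := (abs_lt.1 this).2
    linarith
  have hεH : 2 * ε * H ≤ 1 := by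
    have := (hεl.trans_le (min_le_left _ _)).le
    rw [le_div_iff₀ (by positivity)] at this
    linarith
  have hεB : 8 * (ε * B) < r := by
    have := (hεl.trans_le (min_le_right _ _))
    rw [lt_div_iff₀ (by positivity)] at this
    linarith
  set n := ‖gradient ρ x‖ with hndef
  have hn0 : 0 ≤ n := norm_nonneg _
  set τ : ℝ := min ((ε * B) ^ 2) (- (ε * ρ x)) with hτ
  have hερ : 0 < - (ε * ρ x) := by have := mul_neg_of_pos_of_neg hε hρx; linarith
  have hτ0 : 0 < τ := lt_min (by positivity) hερ
  set R : ℝ := Real.sqrt ((ε * n) ^ 2 + τ) with hRdef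
  have hRsq : R ^ 2 = (ε * n) ^ 2 + τ := Real.sq_sqrt (by positivity)
  have hR0 : 0 < R := Real.sqrt_pos.2 (by positivity)
  have hεn : ε * n ≤ ε * B := by gcongr
  have hR2 : R ≤ 2 * ε * B := by
    apply Real.sqrt_le_iff.2
    refine ⟨by positivity, ?_⟩
    have h1 : τ ≤ (ε * B) ^ 2 := min_le_left _ _
    have h2 : (ε * n) ^ 2 ≤ (ε * B) ^ 2 := by gcongr
    nlinarith [sq_nonneg (ε * B)]
  have hxc : x ∈ ball (x + ε • (- gradient ρ x)) R := by
    rw [mem_ball, dist_eq_norm]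
    have : x - (x + ε • (- gradient ρ x)) = ε • gradient ρ x := by
      rw [smul_neg]; abel
    rw [this, norm_smul, Real.norm_eq_abs, abs_of_pos hε]
    exact lt_of_pow_lt_pow_left₀ 2 hR0.le (by rw [hRsq]; linarith)
  refine ⟨R, hR0, hR2, hxc, ?_⟩
  intro y hy
  have hyd : dist y x < r / 2 := by
    have h1 := mem_ball.1 hy
    have h2 := mem_ball'.1 hxc
    have := dist_triangle y (x + ε • (- gradient ρ x)) x
    linarith
  have hyr : dist y x₀ < r := by
    have := dist_triangle y x x₀
    linarith
  have ht := hTay x y (by linarith) hyr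
  have hsq : ‖y - x - ε • (- gradient ρ x)‖ ^ 2 < (ε * n) ^ 2 + τ := by
    rw [← hRsq]
    have h1 := mem_ball.1 hy
    rw [dist_eq_norm] at h1
    rw [sub_sub]
    gcongr
  rw [norm_sub_sq_real, norm_smul, norm_neg, Real.norm_eq_abs, abs_of_pos hε, inner_smul_right,
    inner_neg_right, ← hndef] at hsq
  rw [real_inner_comm] at ht
  rw [hΩ]
  refine ball_arith (H := H) (d := ‖y - x‖ ^ 2) (q := - inner ℝ (y - x) (gradient ρ x)) (s := (ε * n) ^ 2)
    (τ := τ) hε hεH (sq_nonneg _) ?_ (min_le_right _ _) hρx ?_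
  · linarith
  · linarith

set_option maxHeartbeats 1000000 in
lemma holder_bdry {Ω : Set (Euc N)} (hΩo : IsOpen Ω) (hΩb : Bornology.IsBounded Ω) {ρ : Euc N → ℝ}
    (hρ : ContDiff ℝ 2 ρ) (hΩ : Ω = {x | ρ x < 0}) (hgr : ∀ x ∈ frontier Ω, gradient ρ x ≠ 0)
    {m lam : ℝ} {f : Euc N → ℝ} (hm : 2 < m) (hlam : 0 ≤ lam)
    (hf : ContinuousOn f (closure Ω)) {K : ℝ} {us L : Euc N × ℝ → ℝ}
    (hT : ∀ x ∈ Ω, ∀ s t : ℝ, 0 < s → s ≤ t → us (x, s) - K * (t - s) ≤ us (x, t))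
    (husc : UpperSemicontinuousOn us (closure Ω ×ˢ Ici 0))
    (hsub : GSub (Ω ×ˢ Ioi 0) (Ω ×ˢ Ioi 0) (Gf 1 m lam f us) us)
    (hL : ContinuousOn L (closure Ω ×ˢ Ici 0)) (hLu : ∀ z ∈ closure Ω ×ˢ Ici (0 : ℝ), L z ≤ us z)
    (henv : IsUEnv (Ω ×ˢ Ioi 0) us us) :
    ∀ z ∈ frontier Ω ×ˢ Ioi (0 : ℝ), ∀ η > (0 : ℝ), ∃ ε₀ > (0 : ℝ), ∀ ε > (0 : ℝ), ε < ε₀ →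
      us z - η < us (z.1 + ε • (- gradient ρ z.1), z.2) := by
  intro z hz η hη
  have hz2 : (0 : ℝ) < z.2 := hz.2
  have hzc : z.1 ∈ closure Ω := frontier_subset_closure hz.1
  have hΩc : IsCompact (closure Ω) := hΩb.isCompact_closure
  set KK : Set (Euc N × ℝ) := closure Ω ×ˢ Icc 0 (z.2 + 1) with hKK
  have hKc : IsCompact KK := hΩc.prod isCompact_Icc
  have hKs : KK ⊆ closure Ω ×ˢ Ici 0 := prod_mono le_rfl (fun t ht => ht.1)
  have hne : KK.Nonempty := ⟨z, hzc, hz2.le, by linarith⟩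
  obtain ⟨zu, hzu, hU⟩ := (husc.mono hKs).exists_isMaxOn hne hKc
  obtain ⟨zl, hzl, hLmin⟩ := hKc.exists_isMinOn hne (hL.mono hKs)
  obtain ⟨xf, hxf, hfmax⟩ := hΩc.exists_isMaxOn ⟨_, hzc⟩ hf
  set C : ℝ := K + f xf - lam * L zl with hC
  set α : ℝ := (m - 2) / (m - 1) with hα
  have hα0 : 0 < α := div_pos (by linarith) (by linarith)
  set A : ℝ := (max (max 1 (2 * ((N : ℝ) + 1))) C) / α with hA
  have hAα : A * α = max (max 1 (2 * ((N : ℝ) + 1))) C := div_mul_cancel₀ _ hα0.ne'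
  have hA0 : 0 < A := div_pos (lt_of_lt_of_le one_pos ((le_max_left _ _).trans (le_max_left _ _))) hα0
  obtain ⟨r, hr, B, hB, ε₁, hε₁, hball⟩ := int_ball hρ hΩ z.1
  obtain ⟨rc, hrc, cc, hcc, hcone⟩ := cone hρ hΩ (hgr z.1 hz.1)
  have hcont : Tendsto (fun ε : ℝ => 2 * A * (2 * ε * B) ^ α) (𝓝 0) (𝓝 0) := by
    have : ContinuousAt (fun ε : ℝ => 2 * A * (2 * ε * B) ^ α) 0 := by
      apply ContinuousAt.mul continuousAt_const
      apply ContinuousAt.rpow_const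
      · fun_prop
      · right; exact hα0.le
    have h2 := this.tendsto
    simp only [mul_zero, zero_mul, Real.zero_rpow hα0.ne'] at h2
    exact h2
  obtain ⟨ε₂, hε₂, hsm⟩ := Metric.eventually_nhds_iff.1 (hcont.eventually (gt_mem_nhds (show (0 : ℝ) < η / 4 by positivity)))
  refine ⟨min (min ε₁ ε₂) (min rc (1 / (2 * B))), by positivity, ?_⟩
  intro ε hε hεl
  have he1 : ε < ε₁ := hεl.trans_le ((min_le_left _ _).trans (min_le_left _ _))
  have he2 : ε < ε₂ := hεl.trans_le ((min_le_left _ _).trans (min_le_right _ _))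
  have he3 : ε < rc := hεl.trans_le ((min_le_right _ _).trans (min_le_left _ _))
  have he4 : 2 * ε * B ≤ 1 := by
    have := (hεl.trans_le ((min_le_right _ _).trans (min_le_right _ _))).le
    rw [le_div_iff₀ (by positivity)] at this
    linarith
  have hs : 2 * A * (2 * ε * B) ^ α < η / 4 := hsm (by rw [Real.dist_eq, sub_zero, abs_of_pos hε]; exact he2)
  have hpt : z.1 + ε • (- gradient ρ z.1) ∈ Ω :=
    hcone ε hε he3 z.1 z.1 (by simpa using hrc) (by simpa using hrc) hzc (by rw [dist_self]; positivity)
  set pt : Euc N × ℝ := (z.1 + ε • (- gradient ρ z.1), z.2) with hptd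
  have hptQ : pt ∈ closure Ω ×ˢ Ici (0 : ℝ) := ⟨subset_closure hpt, hz2.le⟩
  have hus : ∀ᶠ y in 𝓝[closure Ω ×ˢ Ici (0 : ℝ)] pt, us y < us pt + η / 4 :=
    husc pt hptQ _ (by linarith)
  obtain ⟨r₂, hr₂, hus2⟩ := Metric.mem_nhdsWithin_iff.1 hus
  have hgc : Continuous (gradient ρ) := continuous_grad hρ
  have hF : Continuous (fun y : Euc N × ℝ => ((y.1 + ε • (- gradient ρ y.1), y.2) : Euc N × ℝ)) := by fun_prop
  obtain ⟨r₃, hr₃, hF3⟩ := Metric.continuousAt_iff.1 (hF.continuousAt (x := z)) r₂ hr₂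
  have hcl : closure (Ω ×ˢ Ioi (0 : ℝ)) = closure Ω ×ˢ Ici 0 := by rw [closure_prod_eq, closure_Ioi]
  obtain ⟨y, hyQ, hyd, hyu⟩ := (henv z (by rw [hcl]; exact ⟨hzc, hz2.le⟩)).2
    (min (min r r₃) (min (η / 4) 1)) (by positivity)
  have hd1 : dist y z < r := hyd.trans_le ((min_le_left _ _).trans (min_le_left _ _))
  have hd2 : dist y z < r₃ := hyd.trans_le ((min_le_left _ _).trans (min_le_right _ _))
  have hd3 : dist y z < 1 := hyd.trans_le ((min_le_right _ _).trans (min_le_right _ _))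
  have hη4 : min (min r r₃) (min (η / 4) 1) ≤ η / 4 := (min_le_right _ _).trans (min_le_left _ _)
  have hy2 : (0 : ℝ) < y.2 := hyQ.2
  have hyT : y.2 ≤ z.2 + 1 := by
    have h1 : dist y.2 z.2 ≤ dist y z := by rw [Prod.dist_eq]; exact le_max_right _ _
    rw [Real.dist_eq] at h1
    have := (abs_le.1 (h1.trans hd3.le)).2
    linarith
  have hyx : dist y.1 z.1 < r := lt_of_le_of_lt (by rw [Prod.dist_eq]; exact le_max_left _ _) hd1
  obtain ⟨R, hR0, hRB, hyR, hRΩ⟩ := hball y.1 hyQ.1 hyx ε hε he1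
  have hKmem : ∀ x ∈ Ω, (x, y.2) ∈ KK := fun x hx => ⟨subset_closure hx, hy2.le, hyT⟩
  have hbe := ball_est (w := fun x => us (x, y.2)) (A := A) (C := C) (M := us zu) hm hR0 (hRB.trans he4)
    (by rw [← hα, hAα]; exact (le_max_left _ _).trans (le_max_left _ _))
    (by rw [← hα, hAα]; exact (le_max_right _ _).trans (le_max_left _ _))
    (by rw [← hα, hAα]; exact le_max_right _ _)
    (c := y.1 + ε • (- gradient ρ y.1))
    (by
      intro x hx c hc
      have h1 : ((x, y.2) : Euc N × ℝ) ∈ closure Ω ×ˢ Ici (0 : ℝ) := ⟨subset_closure (hRΩ hx), hy2.le⟩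
      have h2 := husc _ h1 c hc
      have h3 : Tendsto (fun x' : Euc N => ((x', y.2) : Euc N × ℝ)) (𝓝[ball (y.1 + ε • (- gradient ρ y.1)) R] x)
          (𝓝[closure Ω ×ˢ Ici (0 : ℝ)] (x, y.2)) := by
        refine tendsto_nhdsWithin_iff.2 ⟨?_, ?_⟩
        · exact ((continuous_id.prodMk continuous_const).tendsto x).mono_left nhdsWithin_le_nhds
        · filter_upwards [self_mem_nhdsWithin] with x' hx'
          exact ⟨subset_closure (hRΩ hx'), hy2.le⟩
      exact h3.eventually h2)
    (fun x hx => hU (hKmem x (hRΩ hx)))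
    (by
      intro θ x hx hθ hmx
      have h1 := slice_sub hΩo (by linarith) hlam hf hT husc hsub (hRΩ hx) hy2 hθ hmx
      have h2 : f x ≤ f xf := hfmax (subset_closure (hRΩ hx))
      have h3 : L zl ≤ us (x, y.2) := (hLmin (hKmem x (hRΩ hx))).trans (hLu _ (hKs (hKmem x (hRΩ hx))))
      have h4 : lam * L zl ≤ lam * us (x, y.2) := by gcongr
      linarith)
    y.1 hyR
  have h5 : R ^ α ≤ (2 * ε * B) ^ α := Real.rpow_le_rpow hR0.le hRB hα0.le
  have h6 : 2 * A * R ^ α ≤ 2 * A * (2 * ε * B) ^ α := by gcongr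
  have h7 : us (y.1 + ε • (- gradient ρ y.1), y.2) < us pt + η / 4 :=
    hus2 ⟨hF3 hd2, subset_closure (hRΩ (mem_ball_self hR0)), hy2.le⟩
  have h8 : us y = us (y.1, y.2) := rfl
  rw [← hα] at hbe
  linarith

end VS

namespace VS

variable {N : ℕ}

/-- continuous solutions, in the working formulation (open time interval) -/
structure Sol (Ω : Set (Euc N)) (m lam : ℝ) (f g : Euc N → ℝ) (u : Euc N × ℝ → ℝ) : Prop where
  cont : ContinuousOn u (closure Ω ×ˢ Ici 0)
  sub : GSub (Ω ×ˢ Ioi 0) (Ω ×ˢ Ioi 0) (Gf 1 m lam f u) u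
  sup : GSub (closure Ω ×ˢ Ioi 0) {z | z ∈ closure Ω ×ˢ Ioi (0 : ℝ) ∧ (z.1 ∈ Ω ∨ u z < g z.1)}
    (Gf (-1) m lam f (fun z => - u z)) (fun z => - u z)
  le : ∀ z ∈ frontier Ω ×ˢ Ioi (0 : ℝ), u z ≤ g z.1

lemma gsub_congr {S D D' : Set (Euc N × ℝ)} {σ m lam : ℝ} {f : Euc N → ℝ} {w w' : Euc N × ℝ → ℝ}
    (h : GSub S D (Gf σ m lam f w) w) (hw : ∀ z ∈ S, w' z = w z) (hD : D' ⊆ D) (hDS : D' ⊆ S) :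
    GSub S D' (Gf σ m lam f w') w' := by
  intro φ hφ z hz hm
  have := h φ hφ z (hD hz) (by
    rw [IsLocalMaxOn, IsMaxFilter] at hm ⊢
    filter_upwards [hm, self_mem_nhdsWithin] with y hy hyS
    rw [hw y hyS, hw z (hDS hz)] at hy
    exact hy)
  unfold Gf at this ⊢
  rw [hw z (hDS hz)]
  exact this

lemma cont_of_semi {S : Set (Euc N × ℝ)} {u v : Euc N × ℝ → ℝ} (hu : UpperSemicontinuousOn u S)
    (hv : LowerSemicontinuousOn v S) (h : ∀ z ∈ S, u z = v z) : ContinuousOn u S := by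
  intro z hz
  refine tendsto_order.2 ⟨fun c hc => ?_, fun c hc => hu z hz c hc⟩
  have h1 : c < v z := by rw [← h z hz]; exact hc
  have h2 : ∀ᶠ y in 𝓝[S] z, c < v y := hv z hz c h1
  filter_upwards [h2, self_mem_nhdsWithin] with y hy hyS
  rw [h y hyS]; exact hy

set_option maxHeartbeats 1000000 in
lemma exists_C2 (hN : 1 ≤ N) {Ω : Set (Euc N)} (hΩo : IsOpen Ω) (hΩb : Bornology.IsBounded Ω) {ρ : Euc N → ℝ}
    (hρ : ContDiff ℝ 2 ρ) (hΩ : Ω = {x | ρ x < 0}) (hgr : ∀ x ∈ frontier Ω, gradient ρ x ≠ 0)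
    (hfr : frontier Ω = {x | ρ x = 0})
    {m lam : ℝ} {f a : Euc N → ℝ} (hm : 0 < m) (hlam : 0 ≤ lam) (hf : ContinuousOn f (closure Ω))
    (ha : ContDiff ℝ 2 a) : ∃ u, Sol Ω m lam f a u ∧ ∀ x ∈ closure Ω, u (x, 0) = a x := by
  have hΩc : IsCompact (closure Ω) := hΩb.isCompact_closure
  have hac : Continuous a := ha.continuous
  have hlc : Continuous (lapl a) := continuous_lapl ha
  have hgc : Continuous (gradient a) := continuous_grad ha
  have hgm : Continuous (fun x => ‖gradient a x‖ ^ m) := hgc.norm.rpow_const (fun _ => Or.inr hm.le)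
  obtain ⟨K1, hK1⟩ := hΩc.exists_bound_of_continuousOn (f := fun x => - lapl a x + lam * a x - f x)
    ((hlc.neg.add (continuous_const.mul hac)).continuousOn.sub hf)
  obtain ⟨K2, hK2⟩ := hΩc.exists_bound_of_continuousOn
    (f := fun x => - lapl a x + ‖gradient a x‖ ^ m + lam * a x - f x)
    (((hlc.neg.add hgm).add (continuous_const.mul hac)).continuousOn.sub hf)
  set K : ℝ := max (max K1 K2) 0 with hKd
  have hK0 : 0 ≤ K := le_max_right _ _
  have hKa : ∀ x ∈ closure Ω, |- lapl a x + lam * a x - f x| ≤ K := fun x hx =>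
    (hK1 x hx).trans ((le_max_left _ _).trans (le_max_left _ _))
  have hKb : ∀ x ∈ closure Ω, - lapl a x + ‖gradient a x‖ ^ m + lam * a x - f x ≤ K := fun x hx =>
    (le_abs_self _).trans ((hK2 x hx).trans ((le_max_right _ _).trans (le_max_left _ _)))
  obtain ⟨U, hUc, hUs, hUfr, hUb, hUm⟩ := upper_barrier (m := m) hΩo hΩb hρ hΩ hgr hfr hlam ha hK0 hKa
  have hLs := lower_basic (m := m) hΩo hlam ha hK0 hKb
  have hLc : Continuous (fun z : Euc N × ℝ => a z.1 - K * z.2) := by fun_prop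
  have hQc : ∀ z ∈ Ω ×ˢ Ioi (0 : ℝ), z ∈ closure Ω ×ˢ Ici (0 : ℝ) := fun z hz =>
    prod_mono subset_closure Ioi_subset_Ici_self hz
  have hFc : ∀ z ∈ frontier Ω ×ˢ Ioi (0 : ℝ), z ∈ closure Ω ×ˢ Ici (0 : ℝ) := fun z hz =>
    prod_mono frontier_subset_closure Ioi_subset_Ici_self hz
  obtain ⟨us, ul, husc, hlsc, hsub, hsup, hord, hmax, hWl, henv⟩ := perron (g := a) hΩo hm hf hUc.continuousOn
    hLc.continuousOn
    (fun z hz => by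
      have h1 := (hUb z (hQc z hz)).1
      have h2 : (0 : ℝ) < z.2 := hz.2
      have : 0 ≤ K * z.2 := by positivity
      linarith) hLs hUs
    (fun z hz => (hUb z (hFc z hz)).1)
  have husa : ∀ z ∈ frontier Ω ×ˢ Ioi (0 : ℝ), us z ≤ a z.1 := by
    intro z hz
    have := (hord z (hFc z hz)).2.2
    rwa [hUfr z (prod_mono le_rfl Ioi_subset_Ici_self hz)] at this
  have hU0 : ∀ x ∈ closure Ω, U (x, 0) ≤ a x := by
    intro x hx
    have := (hUb (x, 0) ⟨hx, (show (0 : ℝ) ≤ 0 from le_rfl)⟩).2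
    simpa using this
  have h0mem : ∀ x ∈ closure Ω, ((x, 0) : Euc N × ℝ) ∈ closure Ω ×ˢ Ici (0 : ℝ) := fun x hx =>
    ⟨hx, (show (0 : ℝ) ≤ 0 from le_rfl)⟩
  have hul0 : ∀ x ∈ closure Ω, a x ≤ ul (x, 0) := by
    intro x hx
    have := (hord (x, 0) (h0mem x hx)).1
    simpa using this
  have hus0 : ∀ x ∈ closure Ω, us (x, 0) ≤ a x := fun x hx =>
    (hord (x, 0) (h0mem x hx)).2.2.trans (hU0 x hx)
  have hle := comparison hN hΩo hΩb hρ hΩ hgr hm hlam hf hac.continuousOn husc hlsc hsub husa hsup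
    (fun x hx => (hus0 x hx).trans (hul0 x hx)) (by
      intro z hz
      rcases le_or_gt m 2 with hm2 | hm2
      · left
        refine (husa z hz).trans ?_
        refine le_of_forall_pos_le_add fun e he => ?_
        have hz2 : (0 : ℝ) < z.2 := hz.2
        obtain ⟨W, hWc, hWs, hWa, hWf⟩ := lower_log (η := e / z.2 ^ 2) hΩo hΩb hρ hΩ hgr hfr hm hm2 hlam hf ha hK0
          hKb (by positivity)
        have h1 := hmax W ((hWc.mono hQc).upperSemicontinuousOn) hWs
          (fun z hz => (hWa z (hQc z hz)).trans (hUb z (hQc z hz)).1)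
        have h2 := hWl W hWc h1 z (hFc z hz)
        have h3 := hWf z (prod_mono le_rfl Ioi_subset_Ici_self hz)
        rw [div_mul_cancel₀ _ (by positivity)] at h3
        linarith
      · right
        exact holder_bdry hΩo hΩb hρ hΩ hgr hm2 hlam hf
          (time_shift hΩo hlam ha hK0 hLs (fun z hz => (hUb z hz).1) hU0 hUm husc hsub
            (fun z hz => (hord z hz).2.2) hmax) husc hsub hLc.continuousOn
          (fun z hz => (hord z hz).1.trans (hord z hz).2.1) henv z hz)
  have heq : ∀ z ∈ closure Ω ×ˢ Ici (0 : ℝ), us z = ul z := fun z hz => le_antisymm (hle z hz) (hord z hz).2.1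
  have hmono : closure Ω ×ˢ Ioi (0 : ℝ) ⊆ closure Ω ×ˢ Ici (0 : ℝ) := prod_mono le_rfl Ioi_subset_Ici_self
  refine ⟨us, ⟨cont_of_semi husc hlsc heq, hsub, ?_, husa⟩, ?_⟩
  · refine gsub_congr hsup (fun z hz => by rw [heq z (hmono hz)]) ?_ (fun z hz => hz.1)
    intro z hz
    refine ⟨hz.1, ?_⟩
    rw [← heq z (hmono hz.1)]
    exact hz.2
  · intro x hx
    refine le_antisymm (hus0 x hx) ?_
    rw [heq _ (h0mem x hx)]
    exact hul0 x hx

lemma sol_le (hN : 1 ≤ N) {Ω : Set (Euc N)} (hΩo : IsOpen Ω) (hΩb : Bornology.IsBounded Ω) {ρ : Euc N → ℝ}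
    (hρ : ContDiff ℝ 2 ρ) (hΩ : Ω = {x | ρ x < 0}) (hgr : ∀ x ∈ frontier Ω, gradient ρ x ≠ 0)
    {m lam : ℝ} {f g g' : Euc N → ℝ} (hm : 0 < m) (hlam : 0 ≤ lam) (hf : ContinuousOn f (closure Ω))
    (hg' : ContinuousOn g' (frontier Ω)) {u v : Euc N × ℝ → ℝ} (hu : Sol Ω m lam f g u) (hv : Sol Ω m lam f g' v)
    {c : ℝ} (hc : 0 ≤ c) (hgg : ∀ x ∈ frontier Ω, g x ≤ g' x + c) (h0 : ∀ x ∈ closure Ω, u (x, 0) ≤ v (x, 0) + c) :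
    ∀ z ∈ closure Ω ×ˢ Ici (0 : ℝ), u z ≤ v z + c := by
  refine comparison (g := fun x => g' x + c) (v := fun z => v z + c) hN hΩo hΩb hρ hΩ hgr hm hlam hf
    (hg'.add continuousOn_const) hu.cont.upperSemicontinuousOn
    (hv.cont.add continuousOn_const).lowerSemicontinuousOn hu.sub
    (fun z hz => (hu.le z hz).trans (hgg z.1 hz.1)) ?_ h0 ?_
  · intro φ hφ z hz hmx
    have h1 := hv.sup φ hφ z ⟨hz.1, hz.2.imp_right (fun h => by
      have h : v z + c < g' z.1 + c := h
      linarith)⟩ (by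
        rw [IsLocalMaxOn, IsMaxFilter] at hmx ⊢
        filter_upwards [hmx] with y hy
        linarith)
    unfold Gf at h1 ⊢
    have : 0 ≤ lam * c := by positivity
    dsimp only at h1 ⊢
    linarith
  · intro z hz
    right
    intro η hη
    have hz2 : (0 : ℝ) < z.2 := hz.2
    have hzc : z.1 ∈ closure Ω := frontier_subset_closure hz.1
    obtain ⟨rc, hrc, cc, hcc, hcone⟩ := cone hρ hΩ (hgr z.1 hz.1)
    have h1 : ∀ᶠ y in 𝓝[closure Ω ×ˢ Ici (0 : ℝ)] z, u z - η < u y :=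
      (hu.cont z ⟨hzc, hz2.le⟩).eventually (lt_mem_nhds (by linarith))
    have h2 : Tendsto (fun ε : ℝ => ((z.1 + ε • (- gradient ρ z.1), z.2) : Euc N × ℝ)) (𝓝[>] 0)
        (𝓝[closure Ω ×ˢ Ici (0 : ℝ)] z) := by
      refine tendsto_nhdsWithin_iff.2 ⟨?_, ?_⟩
      · have h3 : Continuous (fun ε : ℝ => ((z.1 + ε • (- gradient ρ z.1), z.2) : Euc N × ℝ)) := by fun_prop
        have h4 := h3.tendsto 0
        simp only [zero_smul, add_zero] at h4
        exact h4.mono_left nhdsWithin_le_nhds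
      · filter_upwards [Ioo_mem_nhdsGT hrc] with ε hε
        exact ⟨subset_closure (hcone ε hε.1 hε.2 z.1 z.1 (by simpa using hrc) (by simpa using hrc) hzc
          (by rw [dist_self]; exact mul_pos hcc hε.1)), hz2.le⟩
    obtain ⟨ε₀, hε₀, h5⟩ := mem_nhdsGT_iff_exists_Ioo_subset.1 (h2.eventually h1)
    exact ⟨ε₀, hε₀, fun ε he hel => h5 ⟨he, hel⟩⟩

end VS

namespace VS

variable {N : ℕ}

lemma sol_limit {Ω : Set (Euc N)} (hΩo : IsOpen Ω) {m lam : ℝ} {f g : Euc N → ℝ} (hm : 0 < m)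
    (hf : ContinuousOn f (closure Ω)) (hg : ContinuousOn g (closure Ω)) {u : Euc N × ℝ → ℝ}
    (H : ∀ e > (0 : ℝ), ∃ a w, (∀ x ∈ closure Ω, |a x - g x| < e) ∧ Sol Ω m lam f a w ∧
      ∀ z ∈ closure Ω ×ˢ Ici (0 : ℝ), |w z - u z| ≤ e) : Sol Ω m lam f g u := by
  have hmono : closure Ω ×ˢ Ioi (0 : ℝ) ⊆ closure Ω ×ˢ Ici (0 : ℝ) := prod_mono le_rfl Ioi_subset_Ici_self
  have hmono2 : Ω ×ˢ Ioi (0 : ℝ) ⊆ closure Ω ×ˢ Ici (0 : ℝ) := prod_mono subset_closure Ioi_subset_Ici_self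
  have hQo : IsOpen (Ω ×ˢ Ioi (0 : ℝ)) := hΩo.prod isOpen_Ioi
  refine ⟨?_, ?_, ?_, ?_⟩
  · refine continuousOn_of_uniform_approx_of_continuousOn fun V hV => ?_
    obtain ⟨e, he, hV⟩ := Metric.mem_uniformity_dist.1 hV
    obtain ⟨a, w, -, hw, hwu⟩ := H (e / 2) (by positivity)
    refine ⟨w, hw.cont, fun z hz => hV ?_⟩
    rw [dist_comm, Real.dist_eq]
    exact (hwu z hz).trans_lt (by linarith)
  · intro φ hφ z hz hmx
    obtain ⟨R, hR, hRc⟩ := open_compact hQo hz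
    refine stab (C := Ω) hR hRc (fun z hz => hz.1) ((hf z.1 (subset_closure hz.1)).mono subset_closure) hm hφ hmx
      one_pos ?_
    intro R' hR' _ η hη
    obtain ⟨a, w, -, hw, hwu⟩ := H (η / 2) (by positivity)
    refine ⟨w, Ω ×ˢ Ioi (0 : ℝ), ?_, ?_, ⟨z, hz, by simpa using hη, ?_⟩, fun y hy _ _ => hy, hw.sub⟩
    · exact hw.cont.upperSemicontinuousOn.mono (inter_subset_left.trans hmono2)
    · intro y hy
      have := (abs_le.1 (hwu y (hmono2 hy.1))).2
      linarith
    · have := (abs_le.1 (hwu z (hmono2 hz))).1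
      linarith
  · intro φ hφ z hz hmx
    have hz2 : (0 : ℝ) < z.2 := hz.1.2
    have hzc : z.1 ∈ closure Ω := hz.1.1
    obtain ⟨R, hR, hRc⟩ := half_compact (isClosed_closure (s := Ω)) hz2
    have hδ : ∃ δ > (0 : ℝ), ∀ a w : _ → ℝ, (∀ x ∈ closure Ω, |a x - g x| < δ) → ∀ y ∈ closure Ω ×ˢ Ioi (0 : ℝ),
        dist y z < δ → |w y - u z| < δ → (y.1 ∈ Ω ∨ w y < a y.1) := by
      rcases hz.2 with h | h
      · obtain ⟨δ, hδ, hb⟩ := Metric.isOpen_iff.1 hΩo z.1 h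
        refine ⟨δ, hδ, fun a w _ y hy hd _ => Or.inl (hb ?_)⟩
        exact lt_of_le_of_lt (by rw [Prod.dist_eq]; exact le_max_left _ _) hd
      · have h : u z < g z.1 := h
        obtain ⟨δ, hδ, hb⟩ := Metric.continuousOn_iff.1 hg z.1 hzc ((g z.1 - u z) / 4) (by linarith)
        refine ⟨min δ ((g z.1 - u z) / 4), lt_min hδ (by linarith), fun a w ha y hy hd hw => Or.inr ?_⟩
        have h1 := hb y.1 hy.1 (lt_of_le_of_lt (by rw [Prod.dist_eq]; exact le_max_left _ _)
          (hd.trans_le (min_le_left _ _)))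
        rw [Real.dist_eq] at h1
        have h2 := (abs_lt.1 h1).1
        have h3 := (abs_lt.1 ((ha y.1 hy.1).trans_le (min_le_right _ _))).1
        have h4 := (abs_lt.1 (hw.trans_le (min_le_right _ _))).2
        linarith
    obtain ⟨δ, hδ, hδ2⟩ := hδ
    refine stab (C := closure Ω) hR hRc (fun z hz => hz.1) (hf z.1 hzc) hm hφ hmx hδ ?_
    intro R' hR' _ η hη
    obtain ⟨a, w, hag, hw, hwu⟩ := H (min (η / 2) δ) (by positivity)
    refine ⟨fun z => - w z, _, ?_, ?_, ⟨z, hz.1, by simpa using hη, ?_⟩, ?_, hw.sup⟩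
    · exact hw.cont.neg.upperSemicontinuousOn.mono (inter_subset_left.trans hmono)
    · intro y hy
      have := (abs_le.1 ((hwu y (hmono hy.1)).trans (min_le_left _ _))).1
      linarith
    · have := (abs_le.1 ((hwu z (hmono hz.1)).trans (min_le_left _ _))).2
      linarith
    · intro y hy hd hwy
      refine ⟨hy, hδ2 a w (fun x hx => (hag x hx).trans_le (min_le_right _ _)) y hy hd ?_⟩
      rw [← abs_neg]
      convert hwy using 2
      ring
  · intro z hz
    have hzc : z ∈ closure Ω ×ˢ Ici (0 : ℝ) := prod_mono frontier_subset_closure Ioi_subset_Ici_self hz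
    refine le_of_forall_pos_le_add fun e he => ?_
    obtain ⟨a, w, hag, hw, hwu⟩ := H (e / 2) (by positivity)
    have h1 := hw.le z hz
    have h2 := (abs_lt.1 (hag z.1 hzc.1)).2
    have h3 := (abs_le.1 (hwu z hzc)).1
    linarith

lemma exists_sol (hN : 1 ≤ N) {Ω : Set (Euc N)} (hΩo : IsOpen Ω) (hΩb : Bornology.IsBounded Ω) {ρ : Euc N → ℝ}
    (hρ : ContDiff ℝ 2 ρ) (hΩ : Ω = {x | ρ x < 0}) (hgr : ∀ x ∈ frontier Ω, gradient ρ x ≠ 0)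
    (hfr : frontier Ω = {x | ρ x = 0})
    {m lam : ℝ} {f u₀ : Euc N → ℝ} (hm : 0 < m) (hlam : 0 ≤ lam) (hf : ContinuousOn f (closure Ω))
    (hu₀ : ContinuousOn u₀ (closure Ω)) :
    ∃ u, Sol Ω m lam f u₀ u ∧ ∀ x ∈ closure Ω, u (x, 0) = u₀ x := by
  have hΩc : IsCompact (closure Ω) := hΩb.isCompact_closure
  have hp : ∀ n : ℕ, ∃ (a : Euc N → ℝ) (w : Euc N × ℝ → ℝ), Continuous a ∧
      (∀ x ∈ closure Ω, |a x - u₀ x| < 1 / ((n : ℝ) + 1)) ∧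
      Sol Ω m lam f a w ∧ ∀ x ∈ closure Ω, w (x, 0) = a x := by
    intro n
    obtain ⟨P, hP⟩ := exists_poly hΩc hu₀ (ε := 1 / ((n : ℝ) + 1)) (by positivity)
    obtain ⟨w, hw, hw0⟩ := exists_C2 (m := m) hN hΩo hΩb hρ hΩ hgr hfr hm hlam hf (pe_contDiff P)
    exact ⟨pe P, w, (pe_contDiff P).continuous, hP, hw, hw0⟩
  choose a w hac hau hw hw0 using hp
  have hle : ∀ n k : ℕ, ∀ z ∈ closure Ω ×ˢ Ici (0 : ℝ), w n z ≤ w k z + (1 / ((n : ℝ) + 1) + 1 / ((k : ℝ) + 1)) := by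
    intro n k
    have hak : ∀ x ∈ closure Ω, a n x ≤ a k x + (1 / ((n : ℝ) + 1) + 1 / ((k : ℝ) + 1)) := by
      intro x hx
      have h1 := (abs_lt.1 (hau n x hx)).2
      have h2 := (abs_lt.1 (hau k x hx)).1
      linarith
    exact sol_le hN hΩo hΩb hρ hΩ hgr hm hlam hf (hac k).continuousOn (hw n) (hw k) (by positivity)
      (fun x hx => hak x (frontier_subset_closure hx))
      (fun x hx => by rw [hw0 n x hx, hw0 k x hx]; exact hak x hx)
  have hab : ∀ n k : ℕ, ∀ z ∈ closure Ω ×ˢ Ici (0 : ℝ), |w n z - w k z| ≤ 1 / ((n : ℝ) + 1) + 1 / ((k : ℝ) + 1) := by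
    intro n k z hz
    have h1 := hle n k z hz
    have h2 := hle k n z hz
    exact abs_le.2 ⟨by linarith, by linarith⟩
  have ht0 : Tendsto (fun n : ℕ => 1 / ((n : ℝ) + 1)) atTop (𝓝 0) := tendsto_one_div_add_atTop_nhds_zero_nat
  have hlim : ∀ z ∈ closure Ω ×ˢ Ici (0 : ℝ), ∃ l, Tendsto (fun n => w n z) atTop (𝓝 l) := by
    intro z hz
    refine cauchySeq_tendsto_of_complete ?_
    refine Metric.cauchySeq_iff'.2 fun e he => ?_
    obtain ⟨n₀, hn₀⟩ := (ht0.eventually (gt_mem_nhds (show (0 : ℝ) < e / 2 by positivity))).exists_forall_of_atTop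
    refine ⟨n₀, fun n hn => ?_⟩
    rw [Real.dist_eq]
    refine (hab n n₀ z hz).trans_lt ?_
    have h1 := hn₀ n hn
    have h2 := hn₀ n₀ le_rfl
    linarith
  choose! u hu using hlim
  have hun : ∀ n : ℕ, ∀ z ∈ closure Ω ×ˢ Ici (0 : ℝ), |w n z - u z| ≤ 1 / ((n : ℝ) + 1) := by
    intro n z hz
    have h1 : Tendsto (fun k => |w n z - w k z|) atTop (𝓝 |w n z - u z|) :=
      (tendsto_const_nhds.sub (hu z hz)).abs
    have h2 : Tendsto (fun k : ℕ => 1 / ((n : ℝ) + 1) + 1 / ((k : ℝ) + 1)) atTop (𝓝 (1 / ((n : ℝ) + 1) + 0)) :=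
      tendsto_const_nhds.add ht0
    rw [add_zero] at h2
    exact le_of_tendsto_of_tendsto' h1 h2 (fun k => hab n k z hz)
  refine ⟨u, sol_limit hΩo hm hf hu₀ ?_, ?_⟩
  · intro e he
    obtain ⟨n, hn⟩ := exists_nat_one_div_lt he
    exact ⟨a n, w n, fun x hx => (hau n x hx).trans hn, hw n, fun z hz => (hun n z hz).trans hn.le⟩
  · intro x hx
    have hz : ((x, 0) : Euc N × ℝ) ∈ closure Ω ×ˢ Ici (0 : ℝ) := ⟨hx, (show (0 : ℝ) ≤ 0 from le_rfl)⟩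
    refine tendsto_nhds_unique (hu (x, 0) hz) ?_
    refine tendsto_iff_dist_tendsto_zero.2 (squeeze_zero (fun _ => dist_nonneg) (fun n => ?_) ht0)
    rw [Real.dist_eq, hw0 n x hx]
    exact (hau n x hx).le

lemma sol_par {Ω : Set (Euc N)} (hΩo : IsOpen Ω) {m lam : ℝ} {f g u₀ : Euc N → ℝ} (hm : 0 < m) (hlam : 0 ≤ lam)
    (hf : ContinuousOn f (closure Ω)) (hu₀ : ContinuousOn u₀ (closure Ω)) (hcomp : ∀ x ∈ frontier Ω, u₀ x = g x)
    {u : Euc N × ℝ → ℝ} (hu : Sol Ω m lam f u₀ u) (hu0 : ∀ x ∈ closure Ω, u (x, 0) = u₀ x) :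
    IsGlobalParSol Ω f g u₀ lam m (fun x t => u (x, t)) := by
  have hmono : closure Ω ×ˢ Ioi (0 : ℝ) ⊆ closure Ω ×ˢ Ici (0 : ℝ) := prod_mono le_rfl Ioi_subset_Ici_self
  have hmono2 : Ω ×ˢ Ioi (0 : ℝ) ⊆ closure Ω ×ˢ Ici (0 : ℝ) := prod_mono subset_closure Ioi_subset_Ici_self
  have hQo : IsOpen (Ω ×ˢ Ioi (0 : ℝ)) := hΩo.prod isOpen_Ioi
  refine ⟨hu.cont, fun T hT => ⟨⟨?_, fun x hx => (hu0 x hx).le, ?_⟩, ⟨?_, fun x hx => (hu0 x hx).ge, ?_⟩⟩⟩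
  · exact hu.cont.upperSemicontinuousOn.mono (prod_mono le_rfl (fun t ht => ht.1))
  · intro φ hφ x₀ t₀ hz hmx
    have ht0 : 0 < t₀ := hz.2.1
    refine ⟨fun hx => ?_, fun hx => ?_⟩
    · obtain ⟨R, hR, hRc⟩ := open_compact hQo (z := (x₀, t₀)) ⟨hx, ht0⟩
      have key := terminal (C := Ω) (D := Ω ×ˢ Ioi (0 : ℝ)) hR hRc ⟨hx, ht0⟩ (fun z hz => hz.1)
        ((hf x₀ hz.1).mono subset_closure) hm hlam hφ (hu.cont.upperSemicontinuousOn.mono hmono2) hu.sub one_pos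
        (fun y hy _ _ => hy) (hmx.on_subset (fun z hz' => ⟨subset_closure hz'.1.1, hz'.1.2,
          le_trans (show z.2 ≤ t₀ from hz'.2) hz.2.2⟩))
      have h2 := parOp_eq (f := f) (lam := lam) (m := m) (φ := φ) (r := u (x₀, t₀)) (z := (x₀, t₀))
      dsimp only at h2 ⊢
      rw [h2]
      unfold Gf at key
      dsimp only at key
      linarith
    · refine (min_le_right _ _).trans ?_
      have := hu.le (x₀, t₀) ⟨hx, ht0⟩
      dsimp only at this ⊢
      rw [hcomp x₀ hx] at this
      linarith
  · exact hu.cont.lowerSemicontinuousOn.mono (prod_mono le_rfl (fun t ht => ht.1))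
  · intro φ hφ x₀ t₀ hz hmn
    have ht0 : 0 < t₀ := hz.2.1
    have main : (x₀ ∈ Ω ∨ u (x₀, t₀) < u₀ x₀) → 0 ≤ parOp f lam m φ (u (x₀, t₀)) x₀ t₀ := by
      intro hor
      obtain ⟨R, hR, hRc⟩ := half_compact (isClosed_closure (s := Ω)) (z := (x₀, t₀)) ht0
      have hδ : ∃ δ > (0 : ℝ), ∀ y ∈ closure Ω ×ˢ Ioi (0 : ℝ), dist y (x₀, t₀) < δ →
          (y.1 ∈ Ω ∨ u y < u₀ y.1) := by
        rcases hor with h | h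
        · obtain ⟨δ, hδ, hb⟩ := Metric.isOpen_iff.1 hΩo x₀ h
          refine ⟨δ, hδ, fun y hy hd => Or.inl (hb ?_)⟩
          exact lt_of_le_of_lt (by rw [Prod.dist_eq]; exact le_max_left _ _) hd
        · obtain ⟨δ1, hδ1, hb1⟩ := Metric.continuousOn_iff.1 hu₀ x₀ hz.1 ((u₀ x₀ - u (x₀, t₀)) / 2) (by linarith)
          obtain ⟨δ2, hδ2, hb2⟩ := Metric.continuousOn_iff.1 hu.cont (x₀, t₀) (hmono ⟨hz.1, ht0⟩)
            ((u₀ x₀ - u (x₀, t₀)) / 2) (by linarith)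
          refine ⟨min δ1 δ2, lt_min hδ1 hδ2, fun y hy hd => Or.inr ?_⟩
          have h1 := hb1 y.1 hy.1 (lt_of_le_of_lt (by rw [Prod.dist_eq]; exact le_max_left _ _)
            (hd.trans_le (min_le_left _ _)))
          have h2 := hb2 y (hmono hy) (hd.trans_le (min_le_right _ _))
          rw [Real.dist_eq] at h1 h2
          have h3 := (abs_lt.1 h1).1
          have h4 := (abs_lt.1 h2).2
          linarith
      obtain ⟨δ, hδ, hδ2⟩ := hδ
      have hφn : ContDiff ℝ 2 (fun y => - φ y) := hφ.neg
      have key := terminal (C := closure Ω) hR hRc (show (x₀, t₀) ∈ closure Ω ×ˢ Ioi (0 : ℝ) from ⟨hz.1, ht0⟩)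
        (fun z hz => hz.1) (hf x₀ hz.1) hm hlam hφn (hu.cont.neg.upperSemicontinuousOn.mono hmono) hu.sup hδ
        (fun y hy hd _ => ⟨hy, hδ2 y hy hd⟩) (by
          have h1 := hmn.on_subset (s := (closure Ω ×ˢ Ioi (0 : ℝ)) ∩ {z | z.2 ≤ t₀}) (fun z hz' => ⟨hz'.1.1, hz'.1.2,
            le_trans (show z.2 ≤ t₀ from hz'.2) hz.2.2⟩)
          rw [IsLocalMinOn, IsMinFilter] at h1
          rw [IsLocalMaxOn, IsMaxFilter]
          filter_upwards [h1] with y hy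
          have hy : u (x₀, t₀) - φ (x₀, t₀) ≤ u y - φ y := hy
          show - u y - - φ y ≤ - u (x₀, t₀) - - φ (x₀, t₀)
          linarith)
      rw [dT_neg, dL_neg, dX_neg] at key
      have h2 := parOp_eq (f := f) (lam := lam) (m := m) (φ := φ) (r := u (x₀, t₀)) (z := (x₀, t₀))
      dsimp only at h2 ⊢
      rw [h2]
      unfold Gf at key
      rw [norm_neg, Pi.neg_apply] at key
      dsimp only at key
      linarith
    refine ⟨fun hx => main (Or.inl hx), fun hx => ?_⟩
    rcases lt_or_ge (u (x₀, t₀)) (u₀ x₀) with h | h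
    · exact le_max_of_le_left (main (Or.inr h))
    · refine le_max_of_le_right ?_
      rw [← hcomp x₀ hx]
      dsimp only
      linarith

lemma par_sol {Ω : Set (Euc N)} (hΩo : IsOpen Ω) (hΩb : Bornology.IsBounded Ω) {ρ : Euc N → ℝ}
    (hρ : ContDiff ℝ 2 ρ) (hΩ : Ω = {x | ρ x < 0}) (hgr : ∀ x ∈ frontier Ω, gradient ρ x ≠ 0)
    (hfr : frontier Ω = {x | ρ x = 0})
    {m lam : ℝ} {f g u₀ : Euc N → ℝ} (hlam : 0 ≤ lam)
    (hf : ContinuousOn f (closure Ω)) (hu₀ : ContinuousOn u₀ (closure Ω)) (hcomp : ∀ x ∈ frontier Ω, u₀ x = g x)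
    {v : Euc N → ℝ → ℝ} (hv : IsGlobalParSol Ω f g u₀ lam m v) :
    Sol Ω m lam f u₀ (fun z => v z.1 z.2) ∧ ∀ x ∈ closure Ω, v x 0 = u₀ x := by
  have hfro : ∀ x ∈ closure Ω, x ∉ Ω → x ∈ frontier Ω := fun x hx hn => ⟨hx, by rwa [hΩo.interior_eq]⟩
  have hloc : ∀ z : Euc N × ℝ, z ∈ closure Ω ×ˢ Ioi (0 : ℝ) →
      𝓝[closure Ω ×ˢ Ioc 0 (z.2 + 1)] z = 𝓝[closure Ω ×ˢ Ioi (0 : ℝ)] z := by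
    intro z hz
    have h1 : closure Ω ×ˢ Ioc 0 (z.2 + 1) = (closure Ω ×ˢ Ioi (0 : ℝ)) ∩ {y | y.2 ≤ z.2 + 1} := by
      ext y
      simp only [mem_prod, mem_Ioc, mem_inter_iff, mem_Ioi, mem_ofPred_eq]
      tauto
    rw [h1]
    refine nhdsWithin_inter_of_mem' (mem_nhdsWithin_of_mem_nhds ?_)
    have h2 : ∀ᶠ y : Euc N × ℝ in 𝓝 z, y.2 < z.2 + 1 :=
      (continuous_snd.tendsto z).eventually (gt_mem_nhds (by linarith))
    filter_upwards [h2] with y hy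
    exact hy.le
  have hsub : GSub (closure Ω ×ˢ Ioi 0)
      {z : Euc N × ℝ | z ∈ closure Ω ×ˢ Ioi (0 : ℝ) ∧ (z.1 ∈ Ω ∨ u₀ z.1 < v z.1 z.2)}
      (Gf 1 m lam f (fun z => v z.1 z.2)) (fun z => v z.1 z.2) := by
    intro φ hφ z hz hmx
    have hz2 : (0 : ℝ) < z.2 := hz.1.2
    rw [IsLocalMaxOn, ← hloc z hz.1] at hmx
    have h1 := (hv.2 (z.2 + 1) (by linarith)).1.2.2 φ hφ z.1 z.2 ⟨hz.1.1, hz2, by linarith⟩ hmx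
    have h2 : parOp f lam m φ (v z.1 z.2) z.1 z.2 ≤ 0 := by
      by_cases hx : z.1 ∈ Ω
      · exact h1.1 hx
      · have hf1 := hfro z.1 hz.1.1 hx
        rcases min_le_iff.1 (h1.2 hf1) with h | h
        · exact h
        · rcases hz.2 with h' | h'
          · exact absurd h' hx
          · rw [hcomp z.1 hf1] at h'
            linarith
    rw [parOp_eq] at h2
    unfold Gf
    dsimp only at h2 ⊢
    linarith
  have hle : ∀ z ∈ frontier Ω ×ˢ Ioi (0 : ℝ), v z.1 z.2 ≤ u₀ z.1 :=
    bdry_le (u := fun z => v z.1 z.2) hΩo hΩb hρ hΩ hgr hfr hlam hf (hu₀.mono frontier_subset_closure) hv.1 hsub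
  refine ⟨⟨hv.1, ?_, ?_, hle⟩, ?_⟩
  · refine hsub.mono_set (fun z hz => ⟨⟨subset_closure hz.1, hz.2⟩, Or.inl hz.1⟩) ?_
    intro z hz
    exact mem_nhdsWithin_of_mem_nhds ((hΩo.prod isOpen_Ioi).mem_nhds hz)
  · intro φ hφ z hz hmx
    have hz2 : (0 : ℝ) < z.2 := hz.1.2
    rw [IsLocalMaxOn, ← hloc z hz.1] at hmx
    have hφn : ContDiff ℝ 2 (fun y => - φ y) := hφ.neg
    have h1 := (hv.2 (z.2 + 1) (by linarith)).2.2.2 (fun y => - φ y) hφn z.1 z.2 ⟨hz.1.1, hz2, by linarith⟩ (by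
      rw [IsMaxFilter] at hmx
      rw [IsLocalMinOn, IsMinFilter]
      filter_upwards [hmx] with y hy
      have hy : - v y.1 y.2 - φ y ≤ - v z.1 z.2 - φ z := hy
      show v z.1 z.2 - - φ z ≤ v y.1 y.2 - - φ y
      linarith)
    have h2 : 0 ≤ parOp f lam m (fun y => - φ y) (v z.1 z.2) z.1 z.2 := by
      by_cases hx : z.1 ∈ Ω
      · exact h1.1 hx
      · have hf1 := hfro z.1 hz.1.1 hx
        rcases le_max_iff.1 (h1.2 hf1) with h | h
        · exact h
        · rcases hz.2 with h' | h'
          · exact absurd h' hx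
          · rw [hcomp z.1 hf1] at h'
            linarith
    rw [parOp_eq, dT_neg, dL_neg, dX_neg, norm_neg] at h2
    unfold Gf
    dsimp only at h2 ⊢
    linarith
  · intro x hx
    have := hv.2 1 one_pos
    exact le_antisymm (this.1.2.1 x hx) (this.2.2.1 x hx)

end VS

theorem stmt2 {N : ℕ} (hN : 1 ≤ N) (Ω : Set (Euc N))
    (hΩo : IsOpen Ω) (hΩb : Bornology.IsBounded Ω) (hΩc : IsConnected Ω)
    (hΩ2 : HasC2Boundary Ω)
    (m lam : ℝ) (hm : 0 < m) (hlam : 0 ≤ lam)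
    (f u₀ g : Euc N → ℝ)
    (hf : ContinuousOn f (closure Ω)) (hu₀ : ContinuousOn u₀ (closure Ω))
    (hg : ContinuousOn g (frontier Ω))
    (hcomp : ∀ x ∈ frontier Ω, u₀ x = g x) :
    ∃ u : Euc N → ℝ → ℝ, IsGlobalParSol Ω f g u₀ lam m u ∧
      ∀ v : Euc N → ℝ → ℝ, IsGlobalParSol Ω f g u₀ lam m v →
        ∀ x ∈ closure Ω, ∀ t : ℝ, 0 ≤ t → v x t = u x t := by
  obtain ⟨ρ, hρ, hΩ, hfr, hgr⟩ := hΩ2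
  obtain ⟨u, hu, hu0⟩ := VS.exists_sol (m := m) hN hΩo hΩb hρ hΩ hgr hfr hm hlam hf hu₀
  refine ⟨fun x t => u (x, t), VS.sol_par hΩo hm hlam hf hu₀ hcomp hu hu0, ?_⟩
  intro v hv x hx t ht
  obtain ⟨hvs, hv0⟩ := VS.par_sol hΩo hΩb hρ hΩ hgr hfr hlam hf hu₀ hcomp hv
  have hgc := hu₀.mono (frontier_subset_closure (s := Ω))
  have h1 := VS.sol_le hN hΩo hΩb hρ hΩ hgr hm hlam hf hgc hu hvs le_rfl (fun x _ => by simp)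
    (fun x hx => by dsimp only; rw [hu0 x hx, hv0 x hx, add_zero]) (x, t) ⟨hx, ht⟩
  have h2 := VS.sol_le hN hΩo hΩb hρ hΩ hgr hm hlam hf hgc hvs hu le_rfl (fun x _ => by simp)
    (fun x hx => by dsimp only; rw [hu0 x hx, hv0 x hx, add_zero]) (x, t) ⟨hx, ht⟩
  rw [add_zero] at h1 h2
  exact le_antisymm h2 h1
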